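/- arXiv:0811.1395 — 5 statements merged into one kernel-verified Lean document; each statement's English description precedes it below -/
import Mathlib

section
/- Let I be a C*-algebra with the property that whenever a unital C*-algebra D contains I as a closed two-sided ideal, every extremal partial isometry in D/I lifts to a partial isometry in D. If A is a unital extremally rich C*-algebra containing I as a closed two-sided ideal, then every extremal partial isometry in A/I lifts to an extremal partial isometry in A. -/
universe u

/-- A unital C*-algebra `A` is *extremally rich* if the set
`A⁻¹ 𝓔(A) A⁻¹ = {x * u * y : x, y invertible, u an extreme point of the closed unit ball}`
is dense in `A`. -/
def ExtremallyRich (A : Type*) [CStarAlgebra A] : Prop :=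
  Dense {a : A | ∃ x u y : A, IsUnit x ∧ IsUnit y ∧
    u ∈ Set.extremePoints ℝ (Metric.closedBall (0 : A) 1) ∧ a = x * u * y}

section PartialIsometries

variable {A : Type*} [CStarAlgebra A]

lemma norm_le_one_iff_star_mul_self_le_one [PartialOrder A] [StarOrderedRing A] (x : A) :
    ‖x‖ ≤ 1 ↔ star x * x ≤ 1 := by
  rw [← CStarAlgebra.norm_le_one_iff_of_nonneg _ (star_mul_self_nonneg x),
    CStarRing.norm_star_mul_self, ← sq, sq_le_one_iff₀ (norm_nonneg _)]

lemma partialIsometry_star {v : A} (hv : v * star v * v = v) :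
    star v * v * star v = star v := by
  simpa [mul_assoc] using congrArg star hv

lemma eq_of_mem_extremePoints_of_add_of_sub {v e : A}
    (hv : v ∈ Set.extremePoints ℝ (Metric.closedBall (0 : A) 1))
    (h₁ : ‖v + e‖ ≤ 1) (h₂ : ‖v - e‖ ≤ 1) : e = 0 := by
  have h := hv.2 (x₁ := v + e) (by simpa using h₁) (x₂ := v - e) (by simpa using h₂)
    ⟨1 / 2, 1 / 2, by norm_num, by norm_num, by norm_num, by module⟩
  simpa using h

lemma mul_star_mul_self_of_mem_extremePoints {v : A}
    (hv : v ∈ Set.extremePoints ℝ (Metric.closedBall (0 : A) 1)) :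
    v * star v * v = v := by
  let _ := CStarAlgebra.spectralOrder A
  have _ := CStarAlgebra.spectralOrderedRing A
  have hv1 : ‖v‖ ≤ 1 := by simpa using hv.1
  set s : A := 1 - star v * v with hs
  have hb : star v * v = 1 - s := by simp [hs]
  have hs0 : 0 ≤ s := sub_nonneg.2 ((norm_le_one_iff_star_mul_self_le_one v).1 hv1)
  have hsa : star s = s := (IsSelfAdjoint.of_nonneg hs0).star_eq
  have hs1 : s ≤ 1 := by simp [hs]
  have key : (2⁻¹ : ℝ) • (v * s) = 0 := by
    apply eq_of_mem_extremePoints_of_add_of_sub hv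
    · rw [norm_le_one_iff_star_mul_self_le_one, ← sub_nonneg]
      have e : 1 - star (v + (2⁻¹ : ℝ) • (v * s)) * (v + (2⁻¹ : ℝ) • (v * s))
          = (3 / 4 : ℝ) • (star s * s) + (1 / 4 : ℝ) • (star s * s * s) := by
        have e1 : star (v + (2⁻¹ : ℝ) • (v * s)) * (v + (2⁻¹ : ℝ) • (v * s))
          = star v * v + (2⁻¹ : ℝ) • (star v * v * s) + (2⁻¹ : ℝ) • (s * (star v * v))
            + (4⁻¹ : ℝ) • (s * (star v * v) * s) := by
          simp only [star_add, star_smul, star_mul, hsa, star_trivial, mul_add, add_mul,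
            smul_mul_assoc, mul_smul_comm, mul_assoc]
          module
        rw [e1, hb, hsa]
        simp only [mul_sub, sub_mul, mul_one, one_mul]
        module
      rw [e]
      have h3 : 0 ≤ star s * s * s := by
        simpa [hsa] using star_left_conjugate_nonneg hs0 s
      exact add_nonneg (smul_nonneg (by norm_num) (star_mul_self_nonneg s))
        (smul_nonneg (by norm_num) h3)
    · have e : v - (2⁻¹ : ℝ) • (v * s) = v * ((2⁻¹ : ℝ) • ((1 - s) + 1)) := by
        simp only [mul_smul_comm, mul_add, mul_sub, mul_one]
        module
      have h1 : ‖1 - s‖ ≤ 1 :=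
        (CStarAlgebra.norm_le_one_iff_of_nonneg _ (sub_nonneg.2 hs1)).2 (by simpa using hs0)
      have h2 : ‖(1 : A)‖ ≤ 1 := (CStarAlgebra.norm_le_one_iff_of_nonneg _ zero_le_one).2 le_rfl
      have h3 : ‖(2⁻¹ : ℝ) • ((1 - s) + 1)‖ ≤ 1 := by
        rw [norm_smul]
        have := norm_add_le (1 - s) 1
        norm_num
        linarith
      rw [e]
      exact (norm_mul_le _ _).trans (mul_le_one₀ hv1 (norm_nonneg _) h3)
  have h0 : v * s = 0 := by simpa using key
  rw [hs, mul_sub, mul_one, sub_eq_zero] at h0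
  rw [mul_assoc, ← h0]

lemma corner_eq_zero_of_mem_extremePoints {v : A}
    (hv : v ∈ Set.extremePoints ℝ (Metric.closedBall (0 : A) 1)) (x : A) :
    (1 - v * star v) * x * (1 - star v * v) = 0 := by
  let _ := CStarAlgebra.spectralOrder A
  have _ := CStarAlgebra.spectralOrderedRing A
  have hvv := mul_star_mul_self_of_mem_extremePoints hv
  have hvs := partialIsometry_star hvv
  set y := (1 - v * star v) * x * (1 - star v * v) with hy
  have hvy : star v * y = 0 := by
    simp [hy, mul_sub, ← mul_assoc, hvs]
  have hyv : star y * v = 0 := by simpa using congrArg star hvy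
  have hyp : y * (star v * v) = 0 := by
    simp [hy, mul_assoc, sub_mul, ← mul_assoc (star v * v), hvs]
  have hpy : star v * v * star y = 0 := by simpa using congrArg star hyp
  have bound : ∀ z : A, ‖z‖ ≤ 1 → star v * z = 0 → z * (star v * v) = 0 → ‖v + z‖ ≤ 1 := by
    intro z hz1 hz hzp
    have hzv : star z * v = 0 := by simpa using congrArg star hz
    have hpz : star v * v * star z = 0 := by simpa using congrArg star hzp
    rw [norm_le_one_iff_star_mul_self_le_one] at hz1 ⊢
    have h := star_left_conjugate_le_conjugate hz1 (1 - star v * v)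
    have e1 : star (1 - star v * v) * (star z * z) * (1 - star v * v) = star z * z := by
      simp [sub_mul, mul_sub, mul_assoc, hzp]
      rw [← mul_assoc, ← mul_assoc, hpz, zero_mul]
    have e2 : star (1 - star v * v) * 1 * (1 - star v * v) = 1 - star v * v := by
      simp [sub_mul, mul_sub, ← mul_assoc, hvs]
    rw [e1, e2] at h
    have e3 : star (v + z) * (v + z) = star v * v + star z * z := by
      simp [add_mul, mul_add, hz, hzv]
    rw [e3]
    simpa [add_comm] using add_le_add_right h (star v * v)
  obtain ⟨c, hc, hcy⟩ : ∃ c : ℝ, c ≠ 0 ∧ ‖c • y‖ ≤ 1 := by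
    refine ⟨(1 + ‖y‖)⁻¹, by positivity, ?_⟩
    rw [norm_smul, Real.norm_of_nonneg (by positivity), inv_mul_le_one₀ (by positivity)]
    linarith
  have h0 : c • y = 0 := by
    apply eq_of_mem_extremePoints_of_add_of_sub hv
    · exact bound _ hcy (by simp [hvy]) (by simp [hyp])
    · rw [sub_eq_add_neg]
      exact bound _ (by simpa using hcy) (by simp [hvy]) (by simp [hyp])
  exact (smul_eq_zero.1 h0).resolve_left hc

lemma mul_star_mul_self_eq_of_mem_openSegment {v a b : A} (hv : v * star v * v = v)
    (ha : ‖a‖ ≤ 1) (hb : ‖b‖ ≤ 1) (h : v ∈ openSegment ℝ a b) :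
    a * (star v * v) = v := by
  let _ := CStarAlgebra.spectralOrder A
  have _ := CStarAlgebra.spectralOrderedRing A
  have hvs := partialIsometry_star hv
  obtain ⟨s, t, hs, ht, hst, rfl⟩ := h
  set v := s • a + t • b with hvdef
  set p := star v * v with hp
  rw [norm_le_one_iff_star_mul_self_le_one] at ha hb
  have hpp : p * p = p := by rw [hp, ← mul_assoc, hvs]
  have hps : star p = p := by simp [hp]
  have id1 : s • (star (a - v) * (a - v)) + t • (star (b - v) * (b - v))
      = s • (star a * a) + t • (star b * b) - p := by
    have hstar : star v = s • star a + t • star b := by simp [hvdef]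
    simp only [star_sub, hp, sub_mul, mul_sub]
    have e1 : s • (star a * v) + t • (star b * v) = star v * v := by
      rw [hstar, add_mul, smul_mul_assoc, smul_mul_assoc]
    have e2 : s • (star v * a) + t • (star v * b) = star v * v := by
      conv_rhs => rw [hvdef, mul_add, mul_smul_comm, mul_smul_comm]
    have e3 : s • (star v * v) + t • (star v * v) = star v * v := by
      rw [← add_smul, hst, one_smul]
    calc _ = s • (star a * a) + t • (star b * b) - (s • (star a * v) + t • (star b * v))
          - (s • (star v * a) + t • (star v * b)) + (s • (star v * v) + t • (star v * v)) := by
            module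
      _ = _ := by rw [e1, e2, e3]; abel
  have h1 : s • (star (a - v) * (a - v)) ≤ 1 - p := by
    calc _ ≤ s • (star (a - v) * (a - v)) + t • (star (b - v) * (b - v)) :=
          le_add_of_nonneg_right (smul_nonneg ht.le (star_mul_self_nonneg _))
      _ = s • (star a * a) + t • (star b * b) - p := id1
      _ ≤ s • 1 + t • 1 - p := by gcongr
      _ = 1 - p := by rw [← add_smul, hst, one_smul]
  have h2 := star_left_conjugate_le_conjugate h1 p
  have e2 : star p * (1 - p) * p = 0 := by
    rw [hps, mul_sub, mul_one, hpp, sub_self, zero_mul]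
  have e3 : star p * (s • (star (a - v) * (a - v))) * p
      = s • (star ((a - v) * p) * ((a - v) * p)) := by
    simp [mul_assoc]
  rw [e2, e3] at h2
  have h3 := le_antisymm h2 (smul_nonneg hs.le (star_mul_self_nonneg _))
  have h4 : (a - v) * p = 0 :=
    (CStarRing.star_mul_self_eq_zero_iff _).1 ((smul_eq_zero.1 h3).resolve_left hs.ne')
  rw [sub_mul, sub_eq_zero] at h4
  rw [h4, hp, ← mul_assoc, hv]

lemma norm_le_one_of_partialIsometry {v : A} (hv : v * star v * v = v) : ‖v‖ ≤ 1 := by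
  let _ := CStarAlgebra.spectralOrder A
  have _ := CStarAlgebra.spectralOrderedRing A
  rw [norm_le_one_iff_star_mul_self_le_one, ← sub_nonneg]
  have e : 1 - star v * v = star (1 - star v * v) * (1 - star v * v) := by
    simp [sub_mul, mul_sub, ← mul_assoc, partialIsometry_star hv]
  rw [e]
  exact star_mul_self_nonneg _

lemma mem_extremePoints_of_corner_eq_zero {v : A} (hv : v * star v * v = v)
    (h : ∀ x : A, (1 - v * star v) * x * (1 - star v * v) = 0) :
    v ∈ Set.extremePoints ℝ (Metric.closedBall (0 : A) 1) := by
  refine ⟨by simpa using norm_le_one_of_partialIsometry hv, fun a ha b hb hab => ?_⟩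
  replace ha : ‖a‖ ≤ 1 := by simpa using ha
  replace hb : ‖b‖ ≤ 1 := by simpa using hb
  have h1 := mul_star_mul_self_eq_of_mem_openSegment hv ha hb hab
  have h2 : star a * (v * star v) = star v := by
    have := mul_star_mul_self_eq_of_mem_openSegment (v := star v) (a := star a) (b := star b)
      (by simpa using partialIsometry_star hv) (by simpa using ha) (by simpa using hb) ?_
    · simpa using this
    · obtain ⟨s, t, hs, ht, hst, rfl⟩ := hab
      exact ⟨s, t, hs, ht, hst, by simp⟩
  have h3 : v * star v * a = v := by simpa [mul_assoc] using congrArg star h2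
  have h4 := h a
  rw [sub_mul, one_mul, h3, mul_sub, mul_one, sub_mul, h1, ← mul_assoc, hv, sub_self, sub_zero,
    sub_eq_zero] at h4
  exact h4

/-- `a` has a generalized inverse `g` whose defect idempotents `1 - a * g` and `1 - g * a` are
orthogonal in the sense that `(1 - a * g) A (1 - g * a) = 0`. -/
def IsQuasiInvertible (a : A) : Prop :=
  ∃ g : A, a * g * a = a ∧ ∀ z : A, (1 - a * g) * z * (1 - g * a) = 0

lemma isQuasiInvertible_of_mem_extremePoints {v : A}
    (hv : v ∈ Set.extremePoints ℝ (Metric.closedBall (0 : A) 1)) : IsQuasiInvertible v :=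
  ⟨star v, mul_star_mul_self_of_mem_extremePoints hv, corner_eq_zero_of_mem_extremePoints hv⟩

lemma IsQuasiInvertible.units_mul_mul_units {a : A} (h : IsQuasiInvertible a) (x y : Aˣ) :
    IsQuasiInvertible (x * a * y) := by
  obtain ⟨g, hg, hz⟩ := h
  refine ⟨↑y⁻¹ * g * ↑x⁻¹, ?_, fun z => ?_⟩
  · calc (x * a * y * (↑y⁻¹ * g * ↑x⁻¹) * (x * a * y) : A)
        = x * (a * (y * ↑y⁻¹) * g * (↑x⁻¹ * x) * a) * y := by simp only [mul_assoc]
      _ = x * a * y := by simp [hg]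
  · have e1 : (1 : A) - x * a * y * (↑y⁻¹ * g * ↑x⁻¹) = x * (1 - a * g) * ↑x⁻¹ := by
      simp [mul_sub, sub_mul, mul_assoc]
    have e2 : (1 : A) - ↑y⁻¹ * g * ↑x⁻¹ * (x * a * y) = ↑y⁻¹ * (1 - g * a) * y := by
      simp [mul_sub, sub_mul, mul_assoc]
    rw [e1, e2]
    calc (x * (1 - a * g) * ↑x⁻¹ * z * (↑y⁻¹ * (1 - g * a) * y) : A)
        = x * ((1 - a * g) * (↑x⁻¹ * z * ↑y⁻¹) * (1 - g * a)) * y := by simp only [mul_assoc]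
      _ = 0 := by simp [hz]

lemma exists_units_mul_mul_eq_of_norm_sub_lt {v a : A} (hv : v * star v * v = v)
    (ha : ‖a - v‖ < 1) :
    ∃ x y : Aˣ, (x * a * y : A) * (star v * v) = v ∧ v * star v * (x * a * y) = v := by
  have hvs := partialIsometry_star hv
  have hm : ‖-((a - v) * star v)‖ < 1 := by
    have h1 : ‖star v‖ ≤ 1 := by simpa using norm_le_one_of_partialIsometry hv
    rw [norm_neg]
    calc _ ≤ ‖a - v‖ * ‖star v‖ := norm_mul_le _ _
      _ ≤ ‖a - v‖ * 1 := by gcongr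
      _ < 1 := by simpa using ha
  obtain ⟨m, hmv⟩ : ∃ m : Aˣ, (m : A) = 1 + (a - v) * star v :=
    ⟨Units.oneSub _ hm, by simp⟩
  have hmv' : (m : A) * v = a * (star v * v) := by
    rw [hmv, add_mul, one_mul, sub_mul, sub_mul, hv, mul_assoc]; abel
  set b : A := ↑m⁻¹ * a with hb
  have hbp : b * (star v * v) = v := by
    rw [hb, mul_assoc, ← hmv', Units.inv_mul_cancel_left]
  have hbs : b * star v = v * star v := by
    conv_lhs => rw [← hvs, ← mul_assoc, hbp]
  set k : A := star v * b * (1 - star v * v) with hk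
  have hkk : k * k = 0 := by
    have : (1 - star v * v) * star v = 0 := by rw [sub_mul, one_mul, hvs, sub_self]
    rw [hk, mul_assoc, ← mul_assoc (1 - star v * v), ← mul_assoc (1 - star v * v), this]
    simp
  let n : Aˣ := ⟨1 - k, 1 + k, by simp [mul_add, sub_mul, hkk], by simp [mul_sub, add_mul, hkk]⟩
  have hkp : k * (star v * v) = 0 := by
    rw [hk, mul_assoc, sub_mul, one_mul, ← mul_assoc (star v * v), hvs, sub_self, mul_zero]
  refine ⟨m⁻¹, n, ?_, ?_⟩
  · change b * (1 - k) * (star v * v) = v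
    rw [mul_assoc, sub_mul, one_mul, hkp, sub_zero, hbp]
  · change v * star v * (b * (1 - k)) = v
    have e : b * k = v * star v * b * (1 - star v * v) := by
      rw [hk, ← mul_assoc, ← mul_assoc, hbs]
    have e' : v * star v * (v * star v * b * (1 - star v * v)) =
        v * star v * b * (1 - star v * v) := by
      simp only [← mul_assoc, hv]
    rw [mul_sub, mul_one, mul_sub, e, e', mul_sub, mul_one, mul_assoc (v * star v) b, hbp, hv,
      sub_sub_cancel]

lemma exists_pos_smul_one_le {a g : A} [PartialOrder A] [StarOrderedRing A] :
    ∃ C : ℝ, 0 < C ∧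
      1 ≤ C • (star a * a + star (1 - g * a) * (1 - g * a)) := by
  refine ⟨2 * ‖star g * g‖ + 2, by positivity, ?_⟩
  set f := g * a with hf
  have h1 : star f * f ≤ ‖star g * g‖ • (star a * a) := by
    simpa [hf, mul_assoc] using
      CStarAlgebra.star_left_conjugate_le_norm_smul (a := a) (b := star g * g)
  have h2 : (1 : A) ≤ (2 : ℝ) • (star f * f) + (2 : ℝ) • (star (1 - f) * (1 - f)) := by
    rw [← sub_nonneg]
    convert star_mul_self_nonneg (f - (1 - f)) using 1
    simp only [star_sub, star_one, sub_mul, mul_sub, mul_one, one_mul]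
    module
  refine h2.trans ?_
  have h3 := star_mul_self_nonneg a
  have h4 := star_mul_self_nonneg (1 - f)
  have h5 : (2 : ℝ) • (star f * f) ≤ (2 : ℝ) • ‖star g * g‖ • (star a * a) :=
    smul_le_smul_of_nonneg_left h1 (by norm_num)
  have h6 := smul_nonneg (by norm_num : (0 : ℝ) ≤ 2) h3
  have h7 := smul_nonneg (by positivity : (0 : ℝ) ≤ 2 * ‖star g * g‖) h4
  calc _ ≤ (2 : ℝ) • ‖star g * g‖ • (star a * a) + (2 : ℝ) • (star (1 - f) * (1 - f)) := by
        gcongr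
    _ ≤ (2 : ℝ) • ‖star g * g‖ • (star a * a) + (2 : ℝ) • (star (1 - f) * (1 - f))
        + ((2 : ℝ) • (star a * a) + (2 * ‖star g * g‖) • (star (1 - f) * (1 - f))) :=
        le_add_of_nonneg_right (add_nonneg h6 h7)
    _ = _ := by module

/-- Polar decomposition of an element with a generalized inverse. -/
lemma exists_partialIsometry_mul_unit {a g p : A} (hg : a * g * a = a)
    (hp : star a * a * p = p) (hfp : g * a * p = p) :
    ∃ k : Aˣ, IsSelfAdjoint (k : A) ∧ (k : A) * p = p ∧
      (a * k) * star (a * k) * (a * k) = a * (k : A) ∧ (a * k) * star (a * k) * a = a := by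
  let _ := CStarAlgebra.spectralOrder A
  have _ := CStarAlgebra.spectralOrderedRing A
  obtain ⟨C, hC, hle⟩ := exists_pos_smul_one_le (a := a) (g := g)
  set h : A := star a * a + star (1 - g * a) * (1 - g * a) with hh
  have hh0 : 0 ≤ h := add_nonneg (star_mul_self_nonneg _) (star_mul_self_nonneg _)
  have hu : IsUnit h := by
    have h1 : IsUnit (C • h) := CStarAlgebra.isUnit_of_le 1 hle
    exact (isUnit_smul_iff (Units.mk0 C hC.ne') h).1 h1
  obtain ⟨H, hH⟩ := hu
  have hi0 : 0 ≤ (↑H⁻¹ : A) := CFC.inv_nonneg_of_nonneg H (hH ▸ hh0)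
  set k : A := CFC.sqrt (↑H⁻¹ : A) with hk
  have hkk : k * k = ↑H⁻¹ := CFC.sqrt_mul_sqrt_self _ hi0
  have hk0 : 0 ≤ k := CFC.sqrt_nonneg _
  have hks : star k = k := (IsSelfAdjoint.of_nonneg hk0).star_eq
  let K : Aˣ := ⟨k, k * H, by rw [← mul_assoc, hkk, Units.inv_mul], by
    have h1 : H * k * k = 1 := by rw [mul_assoc, hkk, Units.mul_inv]
    have h2 : k * H = H * k := by
      calc k * H = H * k * k * (k * H) := by rw [h1, one_mul]
        _ = H * k * (k * k * H) := by simp only [mul_assoc]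
        _ = H * k := by rw [hkk, Units.inv_mul, mul_one]
    rw [h2, h1]⟩
  have hhp : h * p = p := by
    rw [hh, add_mul, hp, mul_assoc, sub_mul, hfp]; simp
  have hip : (↑H⁻¹ : A) * p = p := by
    rw [Units.inv_mul_eq_iff_eq_mul, hH, hhp]
  have hkp : k * p = p := by
    have hu1 : IsUnit (1 + k) := CStarAlgebra.isUnit_of_le 1 (le_add_of_nonneg_right hk0)
    have h0 : (1 + k) * (k * p - p) = 0 := by
      have : k * (k * p) = p := by rw [← mul_assoc, hkk, hip]
      rw [add_mul, one_mul, mul_sub, this]; abel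
    exact sub_eq_zero.1 (hu1.mul_right_eq_zero.1 h0)
  set f := g * a with hf
  have haf : a * f = a := by rw [hf, ← mul_assoc, hg]
  have hff : (1 - f) * f = 0 := by rw [sub_mul, one_mul, hf, mul_assoc, ← mul_assoc a, hg, sub_self]
  have hfs : star f * star (1 - f) = 0 := by rw [← star_mul, hff, star_zero]
  have hfh : star f * h = star a * a := by
    rw [hh, mul_add, ← mul_assoc, ← mul_assoc, hfs, zero_mul, add_zero, ← star_mul, haf]
  have hax : a * (↑H⁻¹ * star (1 - f)) = 0 := by
    have h1 : star a * a * (↑H⁻¹ * star (1 - f)) = 0 := by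
      rw [← hfh, ← hH, mul_assoc, Units.mul_inv_cancel_left, hfs]
    rw [← CStarRing.star_mul_self_eq_zero_iff, star_mul, mul_assoc, ← mul_assoc (star a), h1,
      mul_zero]
  have haa : a * ↑H⁻¹ * (star a * a) = a := by
    have : star a * a = H - star (1 - f) * (1 - f) := by rw [hH, hh]; abel
    rw [this, mul_sub, Units.inv_mul_cancel_right, ← mul_assoc, mul_assoc a, hax, zero_mul,
      sub_zero]
  have hfin : (a * k) * star (a * k) * a = a := by
    rw [star_mul, hks, mul_assoc a, ← mul_assoc k, hkk, ← mul_assoc a, mul_assoc, haa]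
  exact ⟨K, hks, hkp, by
    change a * k * star (a * k) * (a * k) = _
    rw [← mul_assoc, hfin], hfin⟩

lemma IsQuasiInvertible.exists_extension {v a : A} (ha : IsQuasiInvertible a)
    (hv : v * star v * v = v) (h₁ : a * (star v * v) = v) (h₂ : v * star v * a = v) :
    ∃ w ∈ Set.extremePoints ℝ (Metric.closedBall (0 : A) 1),
      w * (star v * v) = v ∧ v * star v * w = v := by
  obtain ⟨g, hg, hz⟩ := ha
  have hvs := partialIsometry_star hv
  have hav : a * star v = v * star v := by
    conv_lhs => rw [← hvs, ← mul_assoc, h₁]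
  have hva : star v * a = star v * v := by
    conv_lhs => rw [← hvs, mul_assoc (star v), mul_assoc, h₂]
  have hap : a * (1 - star v * v) = a - v := by rw [mul_sub, mul_one, h₁]
  have hra : (1 - v * star v) * a = a - v := by rw [sub_mul, one_mul, h₂]
  set g' : A := star v + (1 - star v * v) * g * (1 - v * star v) with hg'
  have hag : 1 - a * g' = (1 - v * star v) * (1 - a * g) * (1 - v * star v) := by
    have e1 : a * g' = v * star v + (a - v) * g * (1 - v * star v) := by
      rw [hg', mul_add, hav, ← mul_assoc, ← mul_assoc, hap]
    have e2 : (1 - v * star v) * (1 - a * g) = (1 - v * star v) - (a - v) * g := by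
      rw [mul_sub, mul_one, ← mul_assoc, hra]
    have e3 : (1 - v * star v) * (1 - v * star v) = 1 - v * star v := by
      simp [mul_sub, sub_mul, ← mul_assoc, hv]
    rw [e1, e2, sub_mul (1 - v * star v), e3]; abel
  have hga : 1 - g' * a = (1 - star v * v) * (1 - g * a) * (1 - star v * v) := by
    have e1 : g' * a = star v * v + (1 - star v * v) * (g * (a - v)) := by
      rw [hg', add_mul, hva, mul_assoc, hra, mul_assoc]
    have e2 : (1 - g * a) * (1 - star v * v) = (1 - star v * v) - g * (a - v) := by
      rw [sub_mul, one_mul, mul_assoc, hap]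
    have e3 : (1 - star v * v) * (1 - star v * v) = 1 - star v * v := by
      simp [mul_sub, sub_mul, ← mul_assoc, hvs]
    rw [e1, mul_assoc, e2, mul_sub _ (1 - star v * v), e3]; abel
  have hz' : ∀ z : A, (1 - a * g') * z * (1 - g' * a) = 0 := by
    intro z
    rw [hag, hga]
    calc _ = (1 - v * star v) * ((1 - a * g) * ((1 - v * star v) * z * (1 - star v * v))
          * (1 - g * a)) * (1 - star v * v) := by simp only [mul_assoc]
      _ = 0 := by rw [hz, mul_zero, zero_mul]
  have hag' : a * g' * a = a := by
    have h0 : (1 - a * g') * a = 0 := by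
      have : (1 - a * g) * (a - v) = 0 := by
        rw [← hap, ← mul_assoc, sub_mul, one_mul, hg, sub_self, zero_mul]
      rw [hag, mul_assoc, hra, mul_assoc, this, mul_zero]
    rw [sub_mul, one_mul, sub_eq_zero] at h0
    exact h0.symm
  have hfp : g' * a * (star v * v) = star v * v := by
    have h0 : (1 - g' * a) * (star v * v) = 0 := by
      have : (1 - star v * v) * (star v * v) = 0 := by
        rw [sub_mul, one_mul, ← mul_assoc, hvs, sub_self]
      rw [hga, mul_assoc, this, mul_zero]
    rw [sub_mul, one_mul, sub_eq_zero] at h0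
    exact h0.symm
  have hsav : star a * v = star v * v := by simpa using congrArg star hva
  obtain ⟨k, hks, hkp, hw, hwa⟩ := exists_partialIsometry_mul_unit hag'
    (by rw [mul_assoc, h₁, hsav] : star a * a * (star v * v) = star v * v) hfp
  have hpk : star v * v * (k : A) = star v * v := by
    simpa [hks.star_eq] using congrArg star hkp
  refine ⟨a * k, mem_extremePoints_of_corner_eq_zero hw fun x => ?_, ?_, ?_⟩
  · set w := a * (k : A) with hwdef
    have e1 : 1 - w * star w = (1 - w * star w) * (1 - a * g') := by
      have : (1 - w * star w) * a = 0 := by rw [sub_mul, one_mul, hwa, sub_self]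
      rw [mul_sub, mul_one, ← mul_assoc, this, zero_mul, sub_zero]
    have e2 : 1 - star w * w = ↑k⁻¹ * ((1 - g' * a) * (k * (1 - star w * w))) := by
      have : a * (k * (1 - star w * w)) = 0 := by
        rw [← mul_assoc, ← hwdef, mul_sub, mul_one, ← mul_assoc, hw, sub_self]
      rw [sub_mul, one_mul, mul_assoc g', this, mul_zero, sub_zero, Units.inv_mul_cancel_left]
    rw [e1, e2]
    calc _ = (1 - w * star w) * ((1 - a * g') * (x * ↑k⁻¹) * (1 - g' * a))
          * (k * (1 - star w * w)) := by simp only [mul_assoc]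
      _ = 0 := by rw [hz', mul_zero, zero_mul]
  · rw [mul_assoc, hkp, h₁]
  · rw [← mul_assoc, h₂]
    conv_lhs => rw [← hv, mul_assoc, mul_assoc, ← mul_assoc (star v), hpk, ← mul_assoc, hv]

lemma ExtremallyRich.exists_extension (hA : ExtremallyRich A) {v : A}
    (hv : v * star v * v = v) :
    ∃ w ∈ Set.extremePoints ℝ (Metric.closedBall (0 : A) 1),
      w * (star v * v) = v ∧ v * star v * w = v := by
  obtain ⟨a, ha, x, u, y, ⟨x, rfl⟩, ⟨y, rfl⟩, hu, rfl⟩ :=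
    Metric.dense_iff.1 hA v 1 one_pos
  obtain ⟨x', y', h₁, h₂⟩ :=
    exists_units_mul_mul_eq_of_norm_sub_lt hv (by simpa [dist_eq_norm] using ha)
  exact (((isQuasiInvertible_of_mem_extremePoints hu).units_mul_mul_units x y).units_mul_mul_units
    x' y').exists_extension hv h₁ h₂

end PartialIsometries

/-- Let `I` be a C*-algebra with the property that whenever a unital
C*-algebra `D` contains `I` as a closed two-sided ideal, every extremal partial isometry
(extreme point of the closed unit ball) in `D/I` lifts to a partial isometry in `D`.
If `A` is a unital extremally rich C*-algebra containing `I` as a closed two-sided ideal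
(via the isometric embedding `ι`), with `q : A → B` realizing the quotient `B = A/I`, then
every extremal partial isometry in `A/I` lifts to an extremal partial isometry in `A`. -/
theorem stmt7 {I A B : Type u} [NonUnitalCStarAlgebra I] [CStarAlgebra A] [CStarAlgebra B]
    (hlift : ∀ (D B' : Type u) [CStarAlgebra D] [CStarAlgebra B']
      (ι' : I →⋆ₙₐ[ℂ] D), Isometry ι' →
      (∀ (d : D) (x : I), d * ι' x ∈ Set.range ι' ∧ ι' x * d ∈ Set.range ι') →
      ∀ (q' : D →⋆ₐ[ℂ] B'), Function.Surjective q' →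
      (∀ d : D, q' d = 0 ↔ d ∈ Set.range ι') →
      ∀ u ∈ Set.extremePoints ℝ (Metric.closedBall (0 : B') 1),
        ∃ v : D, v * star v * v = v ∧ q' v = u)
    (ι : I →⋆ₙₐ[ℂ] A) (hιisom : Isometry ι)
    (hideal : ∀ (a : A) (x : I), a * ι x ∈ Set.range ι ∧ ι x * a ∈ Set.range ι)
    (q : A →⋆ₐ[ℂ] B) (hqsurj : Function.Surjective q)
    (hker : ∀ a : A, q a = 0 ↔ a ∈ Set.range ι)
    (hA : ExtremallyRich A) :
    ∀ u ∈ Set.extremePoints ℝ (Metric.closedBall (0 : B) 1),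
      ∃ v ∈ Set.extremePoints ℝ (Metric.closedBall (0 : A) 1), q v = u := by
  intro u hu
  obtain ⟨v, hv, rfl⟩ := hlift A B ι hιisom hideal q hqsurj hker u hu
  obtain ⟨w, hw, hwp, hrw⟩ := hA.exists_extension hv
  refine ⟨w, hw, ?_⟩
  have e : w - v = (1 - v * star v) * w * (1 - star v * v) := by
    rw [sub_mul, one_mul, hrw, mul_sub, mul_one, sub_mul, hwp, ← mul_assoc, hv, sub_self,
      sub_zero]
  have h0 := congrArg q e
  simp only [map_sub, map_mul, map_one, map_star, corner_eq_zero_of_mem_extremePoints hu] at h0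
  exact sub_eq_zero.1 h0
end

section
/- Let B be a unital C*-algebra and let u be an extreme point of the closed unit ball of B. Let I⁺ be the closed two-sided ideal of B generated by 1 − u u* and I⁻ the closed two-sided ideal generated by 1 − u* u. Then I⁺ ∩ I⁻ = {0}; equivalently, the *-homomorphism π⁺ ⊕ π⁻ : B → B/I⁺ ⊕ B/I⁻ given by the two quotient maps is injective. -/
/-- If `w B s = 0`, then `w B` annihilates the closed two-sided ideal generated by `s`. -/
theorem mul_mul_eq_zero_of_mem_closure_span {R : Type*} [Ring R] [TopologicalSpace R]
    [IsTopologicalRing R] [T1Space R] {w s b : R} (h : ∀ x, w * x * s = 0)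
    (hb : b ∈ closure (TwoSidedIdeal.span {s} : Set R)) (x : R) : w * x * b = 0 := by
  have hspan : ∀ y ∈ TwoSidedIdeal.span {s}, ∀ x, w * x * y = 0 := by
    intro y hy
    induction hy using TwoSidedIdeal.span_induction with
    | mem y hy => rw [Set.mem_singleton_iff.mp hy]; exact h
    | zero => simp
    | add y z _ _ hy hz => intro x; rw [mul_add, hy, hz, add_zero]
    | neg y _ hy => intro x; rw [mul_neg, hy, neg_zero]
    | left_absorb r y _ hy => intro x; rw [← mul_assoc, mul_assoc w, hy]
    | right_absorb r y _ hy => intro x; rw [← mul_assoc, hy, zero_mul]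
  have hclosed : IsClosed {y : R | w * x * y = 0} :=
    isClosed_singleton.preimage (continuous_const_mul (w * x))
  exact closure_minimal (fun y hy ↦ hspan y hy x) hclosed hb

/-- A contraction `u` stays a contraction when perturbed by a small element of the corner
`(1 - u * star u) B (1 - star u * u)`. -/
theorem norm_add_defect_mul_mul_defect_le_one {B : Type*} [CStarAlgebra B] {u y : B}
    (hu : ‖u‖ ≤ 1) (hy : ‖y‖ ≤ 1 / 8) :
    ‖u + (1 - u * star u) * y * (1 - star u * u)‖ ≤ 1 := by
  nontriviality B
  let _ := CStarAlgebra.spectralOrder B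
  let _ := CStarAlgebra.spectralOrderedRing B
  set a := 1 - u * star u with ha
  set c := 1 - star u * u with hc
  have ha' : star a = a := by simp [ha]
  have hc' : star c = c := by simp [hc]
  have hu' : ‖star u‖ ≤ 1 := by rwa [norm_star]
  have hy' : ‖star y‖ ≤ 1 / 8 := by rwa [norm_star]
  have ha0 : 0 ≤ a := by
    rw [ha, sub_nonneg, ← CStarAlgebra.norm_le_one_iff_of_nonneg _ (mul_star_self_nonneg u),
      CStarRing.norm_self_mul_star]
    nlinarith [norm_nonneg u]
  have ha2 : ‖a‖ ≤ 2 := by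
    have h1 : ‖u * star u‖ ≤ 1 := by
      rw [CStarRing.norm_self_mul_star]; nlinarith [norm_nonneg u]
    calc ‖a‖ ≤ ‖(1 : B)‖ + ‖u * star u‖ := norm_sub_le _ _
      _ ≤ 2 := by rw [norm_one]; linarith
  set t := star u * y + star y * u + star y * (a * a) * y with ht
  have hts : IsSelfAdjoint t := by
    simp only [IsSelfAdjoint, ht, star_add, star_mul, star_star, ha', mul_assoc]
    abel
  have htn : ‖t‖ ≤ 1 := by
    have h1 : ‖star u * y‖ ≤ 1 * (1 / 8) := norm_mul_le_of_le hu' hy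
    have h2 : ‖star y * u‖ ≤ (1 / 8) * 1 := norm_mul_le_of_le hy' hu
    have h3 : ‖star y * (a * a) * y‖ ≤ (1 / 8) * (2 * 2) * (1 / 8) :=
      norm_mul_le_of_le (norm_mul_le_of_le hy' (norm_mul_le_of_le ha2 ha2)) hy
    calc ‖t‖ ≤ ‖star u * y‖ + ‖star y * u‖ + ‖star y * (a * a) * y‖ := norm_add₃_le
      _ ≤ 1 := by linarith
  have ht1 : 0 ≤ 1 - t := by
    rw [sub_nonneg]
    calc t ≤ algebraMap ℝ B ‖t‖ := hts.le_algebraMap_norm_self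
      _ ≤ algebraMap ℝ B 1 := algebraMap_mono B htn
      _ = 1 := map_one _
  have hpos : 0 ≤ star u * a * u + star c * (1 - t) * c :=
    add_nonneg (star_left_conjugate_nonneg ha0 u) (star_left_conjugate_nonneg ht1 c)
  have hua : star u * a = c * star u := by rw [ha, hc]; noncomm_ring
  have hau : a * u = u * c := by rw [ha, hc]; noncomm_ring
  have hcc : star u * a * u = c - c * c := by rw [ha, hc]; noncomm_ring
  have key : star (u + a * y * c) * (u + a * y * c)
      = 1 - (star u * a * u + star c * (1 - t) * c) := by
    have e1 : star u * (a * y * c) = c * (star u * y) * c := by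
      simp only [← mul_assoc, hua]
    have e2 : c * (star y * a) * u = c * (star y * u) * c := by
      simp only [mul_assoc, hau]
    have e3 : star u * u = 1 - c := by rw [hc]; abel
    simp only [star_add, star_mul, ha', hc', add_mul, mul_add]
    rw [e1, e2, e3, hcc, ht]
    noncomm_ring
  have hle : star (u + a * y * c) * (u + a * y * c) ≤ 1 := by
    rw [key]; exact sub_le_self _ hpos
  rw [← CStarAlgebra.norm_le_one_iff_of_nonneg _ (star_mul_self_nonneg _),
    CStarRing.norm_star_mul_self] at hle
  nlinarith [norm_nonneg (u + a * y * c)]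

/-- The necessity half of Kadison's theorem: the defects of an extreme point `u` of the closed
unit ball satisfy `(1 - u * star u) B (1 - star u * u) = 0`. -/
theorem defect_mul_mul_defect_eq_zero {B : Type*} [CStarAlgebra B] {u : B}
    (hu : u ∈ Set.extremePoints ℝ (Metric.closedBall (0 : B) 1)) (y : B) :
    (1 - u * star u) * y * (1 - star u * u) = 0 := by
  have hu1 : ‖u‖ ≤ 1 := by simpa using hu.1
  have hsmall : ∀ y : B, ‖y‖ ≤ 1 / 8 → (1 - u * star u) * y * (1 - star u * u) = 0 := by
    intro y hy
    have hp := norm_add_defect_mul_mul_defect_le_one hu1 hy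
    have hm := norm_add_defect_mul_mul_defect_le_one (y := -y) hu1 (by rwa [norm_neg])
    set x := (1 - u * star u) * y * (1 - star u * u) with hx
    rw [mul_neg, neg_mul, ← hx] at hm
    have hseg : u ∈ openSegment ℝ (u + x) (u + -x) :=
      ⟨1 / 2, 1 / 2, by norm_num, by norm_num, by norm_num, by module⟩
    have := (mem_extremePoints.mp hu).2 (u + x) (by simpa using hp) (u + -x)
      (by simpa using hm) hseg
    simpa using this.1
  obtain ⟨r, hr, hry⟩ : ∃ r : ℝ, r ≠ 0 ∧ ‖r • y‖ ≤ 1 / 8 := by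
    refine ⟨(8 * (‖y‖ + 1))⁻¹, by positivity, ?_⟩
    rw [norm_smul, Real.norm_of_nonneg (by positivity), inv_mul_le_iff₀ (by positivity)]
    linarith
  have h := hsmall (r • y) hry
  rw [mul_smul_comm, smul_mul_assoc] at h
  exact (smul_eq_zero.mp h).resolve_left hr


/-- Let `B` be a unital C*-algebra and `u` an extreme point of its closed
unit ball.  Let `I⁺` be the closed two-sided ideal generated by `1 - u * u*` and `I⁻` the
closed two-sided ideal generated by `1 - u* * u` (the defect ideals of `u`).  Then
`I⁺ ∩ I⁻ = {0}`. -/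
theorem stmt8 {B : Type*} [CStarAlgebra B] (u : B)
    (hu : u ∈ Set.extremePoints ℝ (Metric.closedBall (0 : B) 1))
    (b : B)
    (hb₁ : b ∈ closure (TwoSidedIdeal.span {1 - u * star u} : Set B))
    (hb₂ : b ∈ closure (TwoSidedIdeal.span {1 - star u * u} : Set B)) :
    b = 0 := by
  have hleft : ∀ x, star b * x * (1 - u * star u) = 0 := fun x ↦ by
    have h := congrArg star (mul_mul_eq_zero_of_mem_closure_span
      (defect_mul_mul_defect_eq_zero hu) hb₂ (star x))
    simpa [mul_assoc] using h
  have h := mul_mul_eq_zero_of_mem_closure_span hleft hb₁ 1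
  rwa [mul_one, CStarRing.star_mul_self_eq_zero_iff] at h
end

section
/- Let H be an infinite-dimensional Hilbert space and A the C*-algebra of 2×2 operator matrices over B(H) with compact off-diagonal entries. Let S and T be isometries on H such that 1 − S S* and 1 − T T* are not compact. Then for every R ∈ M₂(K(H)), the element diag(S, T*) + R is not an extreme point of the closed unit ball of A; in particular the extremal partial isometry π(diag(S,T*)) in A/M₂(K(H)) does not lift to an extremal partial isometry in A. -/
noncomputable section

open ContinuousLinearMap

/-- The Hilbert space direct sum `H ⊕ H`. -/
abbrev HilbertSum (H : Type*) [NormedAddCommGroup H] [InnerProductSpace ℂ H] :=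
  WithLp 2 (H × H)

variable (H : Type*) [NormedAddCommGroup H] [InnerProductSpace ℂ H] [CompleteSpace H]

/-- The canonical continuous linear identification of `H ⊕ H` with `H × H`. -/
def hSumEquiv : HilbertSum H ≃L[ℂ] H × H := WithLp.prodContinuousLinearEquiv 2 ℂ H H

/-- The `(1,1)` entry of a bounded operator on `H ⊕ H`, viewed as a 2×2 operator matrix. -/
def entry11 (T : HilbertSum H →L[ℂ] HilbertSum H) : H →L[ℂ] H :=
  fst ℂ H H ∘L (hSumEquiv H).toContinuousLinearMap ∘L T ∘L
    (hSumEquiv H).symm.toContinuousLinearMap ∘L inl ℂ H H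

/-- The `(1,2)` entry of a bounded operator on `H ⊕ H`, viewed as a 2×2 operator matrix. -/
def entry12 (T : HilbertSum H →L[ℂ] HilbertSum H) : H →L[ℂ] H :=
  fst ℂ H H ∘L (hSumEquiv H).toContinuousLinearMap ∘L T ∘L
    (hSumEquiv H).symm.toContinuousLinearMap ∘L inr ℂ H H

/-- The `(2,1)` entry of a bounded operator on `H ⊕ H`, viewed as a 2×2 operator matrix. -/
def entry21 (T : HilbertSum H →L[ℂ] HilbertSum H) : H →L[ℂ] H :=
  snd ℂ H H ∘L (hSumEquiv H).toContinuousLinearMap ∘L T ∘L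
    (hSumEquiv H).symm.toContinuousLinearMap ∘L inl ℂ H H

/-- The `(2,2)` entry of a bounded operator on `H ⊕ H`, viewed as a 2×2 operator matrix. -/
def entry22 (T : HilbertSum H →L[ℂ] HilbertSum H) : H →L[ℂ] H :=
  snd ℂ H H ∘L (hSumEquiv H).toContinuousLinearMap ∘L T ∘L
    (hSumEquiv H).symm.toContinuousLinearMap ∘L inr ℂ H H

/-- The 2×2 diagonal operator matrix `diag(S, T') : H ⊕ H → H ⊕ H`. -/
def diagOp (S T' : H →L[ℂ] H) : HilbertSum H →L[ℂ] HilbertSum H :=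
  (hSumEquiv H).symm.toContinuousLinearMap ∘L S.prodMap T' ∘L
    (hSumEquiv H).toContinuousLinearMap

/-- The set `M₂(K(H))` of 2×2 operator matrices all of whose entries are compact, viewed
inside `B(H ⊕ H)`. -/
def allEntriesCompact : Set (HilbertSum H →L[ℂ] HilbertSum H) :=
  {T | IsCompactOperator ⇑(entry11 H T) ∧ IsCompactOperator ⇑(entry12 H T) ∧
       IsCompactOperator ⇑(entry21 H T) ∧ IsCompactOperator ⇑(entry22 H T)}

open scoped InnerProductSpace

/-- The defect operator `1 - V*V` of a contraction has the form `B*B`. -/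
theorem exists_one_sub_star_mul_self_eq {E : Type*} [NormedAddCommGroup E]
    [InnerProductSpace ℂ E] [CompleteSpace E] {V : E →L[ℂ] E} (hV : ‖V‖ ≤ 1) :
    ∃ B : E →L[ℂ] E, 1 - star V * V = star B * B := by
  rw [← CStarAlgebra.nonneg_iff_eq_star_mul_self, sub_nonneg]
  refine (CStarAlgebra.norm_le_one_iff_of_nonneg _ (star_mul_self_nonneg V)).1 ?_
  rw [CStarRing.norm_star_mul_self]
  exact mul_le_one₀ hV (norm_nonneg _) hV

/-- Perturbing a contraction `V` by a small rank one operator from the range of the defect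
`1 - V*V` to the range of the defect `1 - VV*` gives a contraction. -/
theorem norm_add_smul_rankOne_le_one {E : Type*} [NormedAddCommGroup E]
    [InnerProductSpace ℂ E] [CompleteSpace E] {V B : E →L[ℂ] E}
    (hB : 1 - star V * V = star B * B) (u v : E) (c : ℂ)
    (hc₁ : ‖c‖ * (‖B v‖ * ‖B (star V u)‖) ≤ 1 / 4)
    (hc₂ : ‖c‖ * (‖B v‖ * ‖(1 - V * star V) u‖) ≤ 1 / 4) :
    ‖V + c • InnerProductSpace.rankOne ℂ ((1 - V * star V) u) ((1 - star V * V) v)‖ ≤ 1 := by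
  refine ContinuousLinearMap.opNorm_le_bound _ zero_le_one fun x ↦ ?_
  have hBx : ∀ y z : E, ⟪B y, B z⟫_ℂ = ⟪y, z⟫_ℂ - ⟪V y, V z⟫_ℂ := fun y z ↦ by
    have h : y - star V (V y) = star B (B y) := congr($hB y)
    rw [← adjoint_inner_left, ← star_eq_adjoint, ← h, inner_sub_left, star_eq_adjoint,
      adjoint_inner_left]
  have hnorm : ‖B x‖ ^ 2 = ‖x‖ ^ 2 - ‖V x‖ ^ 2 := by
    have h := congrArg Complex.re (hBx x x)
    simpa only [inner_self_eq_norm_sq_to_K, Complex.sub_re, ← Complex.ofReal_pow,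
      Complex.coe_algebraMap, Complex.ofReal_re] using h
  have hV : ⟪V x, (1 - V * star V) u⟫_ℂ = ⟪B x, B (star V u)⟫_ℂ := by
    rw [hBx, star_eq_adjoint, adjoint_inner_right]
    simp
  have hP : ⟪(1 - star V * V) v, x⟫_ℂ = ⟪B v, B x⟫_ℂ := by
    rw [hB, star_eq_adjoint, mul_apply_eq_comp, adjoint_inner_left]
  set d := (1 - V * star V) u
  have hW : (V + c • InnerProductSpace.rankOne ℂ d ((1 - star V * V) v)) x
      = V x + (c * ⟪B v, B x⟫_ℂ) • d := by
    rw [← hP, mul_smul]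
    rfl
  have hvx : ‖⟪B v, B x⟫_ℂ‖ ≤ ‖B v‖ * ‖B x‖ := norm_inner_le_norm _ _
  have hcross : RCLike.re ⟪V x, (c * ⟪B v, B x⟫_ℂ) • d⟫_ℂ ≤ 1 / 4 * ‖B x‖ ^ 2 :=
    calc
      _ ≤ ‖⟪V x, (c * ⟪B v, B x⟫_ℂ) • d⟫_ℂ‖ := RCLike.re_le_norm _
      _ = ‖c‖ * ‖⟪B v, B x⟫_ℂ‖ * ‖⟪B x, B (star V u)⟫_ℂ‖ := by
        rw [inner_smul_right, hV, norm_mul, norm_mul]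
      _ ≤ ‖c‖ * (‖B v‖ * ‖B x‖) * (‖B x‖ * ‖B (star V u)‖) := by
        gcongr
        exact norm_inner_le_norm _ _
      _ = ‖c‖ * (‖B v‖ * ‖B (star V u)‖) * ‖B x‖ ^ 2 := by ring
      _ ≤ _ := by gcongr
  have hsq : ‖(c * ⟪B v, B x⟫_ℂ) • d‖ ≤ 1 / 4 * ‖B x‖ :=
    calc
      _ = ‖c‖ * ‖⟪B v, B x⟫_ℂ‖ * ‖d‖ := by rw [norm_smul, norm_mul]
      _ ≤ ‖c‖ * (‖B v‖ * ‖B x‖) * ‖d‖ := by gcongr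
      _ = ‖c‖ * (‖B v‖ * ‖d‖) * ‖B x‖ := by ring
      _ ≤ _ := by gcongr
  rw [hW, one_mul]
  refine le_of_sq_le_sq ?_ (norm_nonneg _)
  rw [norm_add_sq (𝕜 := ℂ)]
  have := pow_le_pow_left₀ (norm_nonneg _) hsq 2
  nlinarith [sq_nonneg ‖B x‖]

/-- A contraction that is neither isometric nor coisometric is the midpoint of two distinct
contractions differing from it by a rank one operator. -/
theorem exists_rankOne_perturbation {E : Type*} [NormedAddCommGroup E]
    [InnerProductSpace ℂ E] [CompleteSpace E] {V : E →L[ℂ] E} (hV : ‖V‖ ≤ 1)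
    (h₁ : star V * V ≠ 1) (h₂ : V * star V ≠ 1) :
    ∃ x y : E, InnerProductSpace.rankOne ℂ x y ≠ 0 ∧
      ‖V + InnerProductSpace.rankOne ℂ x y‖ ≤ 1 ∧
      ‖V - InnerProductSpace.rankOne ℂ x y‖ ≤ 1 := by
  obtain ⟨B, hB⟩ := exists_one_sub_star_mul_self_eq hV
  obtain ⟨u, hu⟩ : ∃ u, (1 - V * star V) u ≠ 0 := by
    by_contra! h
    exact h₂ (sub_eq_zero.1 (ContinuousLinearMap.ext h)).symm
  obtain ⟨v, hv⟩ : ∃ v, (1 - star V * V) v ≠ 0 := by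
    by_contra! h
    exact h₁ (sub_eq_zero.1 (ContinuousLinearMap.ext h)).symm
  set p := ‖B v‖ * ‖B (star V u)‖
  set r := ‖B v‖ * ‖(1 - V * star V) u‖
  have hp : 0 ≤ p := by positivity
  have hr : 0 ≤ r := by positivity
  set t : ℝ := 1 / (4 * (1 + p + r))
  have ht : 0 < t := by positivity
  have htp : t * p ≤ 1 / 4 := by
    rw [div_mul_eq_mul_div, div_le_div_iff₀ (by positivity) (by norm_num)]
    linarith
  have htr : t * r ≤ 1 / 4 := by
    rw [div_mul_eq_mul_div, div_le_div_iff₀ (by positivity) (by norm_num)]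
    linarith
  have hnt : ‖(t : ℂ)‖ = t := by simp [abs_of_pos ht]
  have hnt' : ‖(-t : ℂ)‖ = t := by rw [norm_neg, hnt]
  refine ⟨(t : ℂ) • (1 - V * star V) u, (1 - star V * V) v,
    InnerProductSpace.rankOne_ne_zero (smul_ne_zero (by exact_mod_cast ht.ne') hu) hv, ?_, ?_⟩
  · rw [map_smul, smul_apply]
    exact norm_add_smul_rankOne_le_one hB u v t (by rwa [hnt]) (by rwa [hnt])
  · rw [map_smul, smul_apply, sub_eq_add_neg, ← neg_smul]
    exact norm_add_smul_rankOne_le_one hB u v (-t) (by rwa [hnt']) (by rwa [hnt'])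

theorem isCompactOperator_rankOne {E : Type*} [NormedAddCommGroup E]
    [InnerProductSpace ℂ E] (x y : E) :
    IsCompactOperator ⇑(InnerProductSpace.rankOne ℂ x y) := by
  rw [InnerProductSpace.rankOne_def']
  exact ((isCompactOperator_id (E := ℂ)).comp_clm (innerSL ℂ y)).clm_comp
    (ContinuousLinearMap.toSpanSingleton ℂ x)

theorem IsCompactOperator.mem_allEntriesCompact {W : HilbertSum H →L[ℂ] HilbertSum H}
    (hW : IsCompactOperator ⇑W) : W ∈ allEntriesCompact H :=
  ⟨(hW.comp_clm ((hSumEquiv H).symm.toContinuousLinearMap ∘L inl ℂ H H)).clm_comp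
      (fst ℂ H H ∘L (hSumEquiv H).toContinuousLinearMap),
    (hW.comp_clm ((hSumEquiv H).symm.toContinuousLinearMap ∘L inr ℂ H H)).clm_comp
      (fst ℂ H H ∘L (hSumEquiv H).toContinuousLinearMap),
    (hW.comp_clm ((hSumEquiv H).symm.toContinuousLinearMap ∘L inl ℂ H H)).clm_comp
      (snd ℂ H H ∘L (hSumEquiv H).toContinuousLinearMap),
    (hW.comp_clm ((hSumEquiv H).symm.toContinuousLinearMap ∘L inr ℂ H H)).clm_comp
      (snd ℂ H H ∘L (hSumEquiv H).toContinuousLinearMap)⟩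

theorem star_diagOp (S T : H →L[ℂ] H) :
    star (diagOp H S T) = diagOp H (star S) (star T) := by
  rw [star_eq_adjoint, eq_comm, eq_adjoint_iff]
  intro x y
  simp [diagOp, hSumEquiv, star_eq_adjoint, adjoint_inner_left]

theorem diagOp_mul_diagOp (S T S' T' : H →L[ℂ] H) :
    diagOp H S T * diagOp H S' T' = diagOp H (S * S') (T * T') := rfl

theorem one_sub_diagOp (S T : H →L[ℂ] H) :
    1 - diagOp H S T = diagOp H (1 - S) (1 - T) := rfl

theorem entry11_diagOp (S T : H →L[ℂ] H) : entry11 H (diagOp H S T) = S := by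
  ext x
  simp [entry11, diagOp]

theorem entry22_diagOp (S T : H →L[ℂ] H) : entry22 H (diagOp H S T) = T := by
  ext x
  simp [entry22, diagOp]

/-- Let `H` be an infinite-dimensional Hilbert space, `𝒜` the
*-subalgebra of `B(H ⊕ H)` of 2×2 operator matrices with compact off-diagonal entries, and
`q : 𝒜 → B` realize the quotient of `𝒜` by `M₂(K(H))`.  Let `S` and `T` be isometries
on `H` with `1 - S S*` and `1 - T T*` not compact.  Then for every `R ∈ M₂(K(H))`, the
element `diag(S, T*) + R` is not an extreme point of the closed unit ball of `𝒜`; in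
particular the extremal partial isometry `q(diag(S, T*))` does not lift to an extremal
partial isometry in `𝒜`. -/
theorem stmt12 (hH : ¬ FiniteDimensional ℂ H)
    (𝒜 : StarSubalgebra ℂ (HilbertSum H →L[ℂ] HilbertSum H))
    (h𝒜 : ∀ T, T ∈ 𝒜 ↔
      (IsCompactOperator ⇑(entry12 H T) ∧ IsCompactOperator ⇑(entry21 H T)))
    (B : Type*) [CStarAlgebra B]
    (q : 𝒜 →⋆ₐ[ℂ] B) (hqsurj : Function.Surjective q)
    (hqker : ∀ T : 𝒜, q T = 0 ↔
      (T : HilbertSum H →L[ℂ] HilbertSum H) ∈ allEntriesCompact H)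
    (S T : H →L[ℂ] H) (hS : star S * S = 1) (hT : star T * T = 1)
    (hSnc : ¬ IsCompactOperator ⇑(1 - S * star S))
    (hTnc : ¬ IsCompactOperator ⇑(1 - T * star T))
    (D : 𝒜) (hD : (D : HilbertSum H →L[ℂ] HilbertSum H) = diagOp H S (star T)) :
    (∀ V : 𝒜, (∃ R ∈ allEntriesCompact H,
        (V : HilbertSum H →L[ℂ] HilbertSum H) = diagOp H S (star T) + R) →
      V ∉ Set.extremePoints ℝ (Metric.closedBall (0 : 𝒜) 1)) ∧
    ¬ ∃ V ∈ Set.extremePoints ℝ (Metric.closedBall (0 : 𝒜) 1), q V = q D := by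
  have key : ∀ V : 𝒜, q V = q D → V ∉ Set.extremePoints ℝ (Metric.closedBall (0 : 𝒜) 1) := by
    intro V hqV hext
    have hV : ‖(V : HilbertSum H →L[ℂ] HilbertSum H)‖ ≤ 1 := mem_closedBall_zero_iff.1 hext.1
    have h₁ : star (V : HilbertSum H →L[ℂ] HilbertSum H) * V ≠ 1 := by
      intro h
      have h' : star V * V = 1 := Subtype.ext h
      have hD' := (hqker (1 - star D * D)).1 (by
        rw [map_sub, map_mul, map_star, ← hqV, ← map_star, ← map_mul, h', sub_self])
      have hc := hD'.2.2.2
      have he : ((1 - star D * D : 𝒜) : HilbertSum H →L[ℂ] HilbertSum H)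
          = 1 - star (D : HilbertSum H →L[ℂ] HilbertSum H) * D := rfl
      rw [he, hD, star_diagOp, diagOp_mul_diagOp, one_sub_diagOp, entry22_diagOp,
        star_star] at hc
      exact hTnc hc
    have h₂ : (V : HilbertSum H →L[ℂ] HilbertSum H) * star V.1 ≠ 1 := by
      intro h
      have h' : V * star V = 1 := Subtype.ext h
      have hD' := (hqker (1 - D * star D)).1 (by
        rw [map_sub, map_mul, map_star, ← hqV, ← map_star, ← map_mul, h', sub_self])
      have hc := hD'.1
      have he : ((1 - D * star D : 𝒜) : HilbertSum H →L[ℂ] HilbertSum H)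
          = 1 - (D : HilbertSum H →L[ℂ] HilbertSum H) * star D.1 := rfl
      rw [he, hD, star_diagOp, diagOp_mul_diagOp, one_sub_diagOp, entry11_diagOp] at hc
      exact hSnc hc
    obtain ⟨x, y, hne, hadd, hsub⟩ := exists_rankOne_perturbation hV h₁ h₂
    have hcpt := (isCompactOperator_rankOne x y).mem_allEntriesCompact H
    let W : 𝒜 := ⟨InnerProductSpace.rankOne ℂ x y, (h𝒜 _).2 ⟨hcpt.2.1, hcpt.2.2.1⟩⟩
    have hmid : V ∈ openSegment ℝ (V + W) (V - W) :=
      ⟨1 / 2, 1 / 2, by norm_num, by norm_num, by norm_num, by module⟩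
    have hadd' : V + W ∈ Metric.closedBall (0 : 𝒜) 1 := mem_closedBall_zero_iff.2 hadd
    have hsub' : V - W ∈ Metric.closedBall (0 : 𝒜) 1 := mem_closedBall_zero_iff.2 hsub
    have hW : W = 0 := add_eq_left.1 (hext.2 hadd' hsub' hmid)
    exact hne (congrArg Subtype.val hW)
  refine ⟨fun V ⟨R, hR, hVR⟩ ↦ key V ?_, fun ⟨V, hV, hqV⟩ ↦ key V hqV hV⟩
  rw [← sub_eq_zero, ← map_sub, hqker]
  have he : ((V - D : 𝒜) : HilbertSum H →L[ℂ] HilbertSum H) = R := by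
    rw [AddSubgroupClass.coe_sub, hVR, hD, add_sub_cancel_left]
  rwa [he]

end
end

section
/- There exists a C*-algebra I of stable rank one and a unitary u in the corona algebra C(I) = M(I)/I such that no extreme point of the closed unit ball of the multiplier algebra M(I) is mapped to u by the quotient map M(I) → C(I). -/
open scoped MultiplierAlgebra

/-- A witness for Statement 15: a C*-algebra `I` of stable rank one together with a
realization `π : 𝓜(ℂ, I) → C` of the corona algebra `C = C(I) = 𝓜(ℂ, I)/I` (a surjective
star homomorphism whose kernel is the canonical image of `I` in the multiplier algebra),
and a unitary `u` of the corona algebra which is not the image under `π` of any extreme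
point of the closed unit ball of `𝓜(ℂ, I)`. -/
structure Stmt15Witness : Type 1 where
  /-- The C*-algebra `I`. -/
  I : Type
  [instI : NonUnitalCStarAlgebra I]
  /-- `I` has stable rank one: the invertibles are dense in its minimal unitization. -/
  sr1 : Dense {x : Unitization ℂ I | IsUnit x}
  /-- The corona algebra `C(I) = 𝓜(ℂ, I)/I`. -/
  C : Type
  [instC : CStarAlgebra C]
  /-- The quotient map `𝓜(ℂ, I) → C(I)`. -/
  π : 𝓜(ℂ, I) →⋆ₐ[ℂ] C
  surj : Function.Surjective π
  ker : ∀ m : 𝓜(ℂ, I), π m = 0 ↔ ∃ x : I, m = (x : 𝓜(ℂ, I))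
  /-- The unitary of the corona algebra. -/
  u : C
  unit : u ∈ unitary C
  nolift : ∀ v ∈ Set.extremePoints ℝ (Metric.closedBall (0 : 𝓜(ℂ, I)) 1), π v ≠ u

section Quotient

variable {A : Type*} [CStarAlgebra A]

/-- The C*-norm estimate in a quotient: an approximate unit of right multipliers
inside `J` suffices. -/
theorem Submodule.Quotient.norm_mk_sq_le_norm_mk_star_mul_self (J : Ideal A) [J.IsTwoSided]
    (hunit : ∀ j ∈ J, ∀ ε > 0, ∃ e ∈ J, ‖1 - e‖ ≤ 1 ∧ ‖j * (1 - e)‖ ≤ ε) (x : A) :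
    ‖(Submodule.Quotient.mk x : A ⧸ J)‖ * ‖(Submodule.Quotient.mk x : A ⧸ J)‖ ≤
      ‖(Submodule.Quotient.mk (star x * x) : A ⧸ J)‖ := by
  refine le_of_forall_pos_le_add fun ε hε => ?_
  obtain ⟨y, hy, hyn⟩ := Submodule.Quotient.norm_mk_lt
    (Submodule.Quotient.mk (star x * x) : A ⧸ J) (half_pos hε)
  have hj : star x * x - y ∈ J := (Submodule.Quotient.eq J).1 hy.symm
  obtain ⟨e, heJ, he1, he⟩ := hunit _ hj (ε / 2) (half_pos hε)
  have hxe : (Submodule.Quotient.mk x : A ⧸ J) = Submodule.Quotient.mk (x * (1 - e)) := by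
    rw [Submodule.Quotient.eq]
    simpa [mul_sub] using J.mul_mem_left x heJ
  have h1 : ‖(Submodule.Quotient.mk x : A ⧸ J)‖ ≤ ‖x * (1 - e)‖ := by
    rw [hxe]
    exact Submodule.Quotient.norm_mk_le J _
  have h2 : ‖star x * x * (1 - e)‖ ≤ ‖y‖ + ε / 2 := calc
    ‖star x * x * (1 - e)‖ = ‖y * (1 - e) + (star x * x - y) * (1 - e)‖ := by
      rw [← add_mul, add_sub_cancel]
    _ ≤ ‖y‖ * ‖1 - e‖ + ‖(star x * x - y) * (1 - e)‖ :=
      (norm_add_le _ _).trans (by gcongr; exact norm_mul_le _ _)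
    _ ≤ ‖y‖ * 1 + ε / 2 := by gcongr
    _ = ‖y‖ + ε / 2 := by rw [mul_one]
  calc ‖(Submodule.Quotient.mk x : A ⧸ J)‖ * ‖(Submodule.Quotient.mk x : A ⧸ J)‖
      ≤ ‖x * (1 - e)‖ * ‖x * (1 - e)‖ := by gcongr
    _ = ‖star (1 - e) * (star x * x * (1 - e))‖ := by
      rw [← CStarRing.norm_star_mul_self, star_mul]; simp only [mul_assoc]
    _ ≤ ‖star (1 - e)‖ * ‖star x * x * (1 - e)‖ := norm_mul_le _ _
    _ ≤ 1 * ‖star x * x * (1 - e)‖ := by rw [norm_star]; gcongr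
    _ ≤ ‖(Submodule.Quotient.mk (star x * x) : A ⧸ J)‖ + ε := by linarith

/-- The quotient C*-algebra. -/
theorem exists_cstarAlgebra_quotient {A : Type} [CStarAlgebra A] (J : Ideal A) [J.IsTwoSided]
    (hcl : IsClosed (J : Set A)) (hstar : ∀ j ∈ J, star j ∈ J)
    (hunit : ∀ j ∈ J, ∀ ε > 0, ∃ e ∈ J, ‖1 - e‖ ≤ 1 ∧ ‖j * (1 - e)‖ ≤ ε) :
    ∃ (C : Type) (_ : CStarAlgebra C) (π : A →⋆ₐ[ℂ] C), Function.Surjective π ∧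
      ∀ a, π a = 0 ↔ a ∈ J := by
  let nr : NormedRing (A ⧸ J) :=
    { Ideal.Quotient.ring J, Submodule.Quotient.normedAddCommGroup J (hS := hcl) with
      norm_mul_le := fun x y => by
        refine le_of_forall_pos_le_add fun ε hε => ?_
        have := ((Metric.nhds_basis_ball.prod_nhds Metric.nhds_basis_ball).tendsto_iff
          Metric.nhds_basis_ball).mp (continuous_mul.tendsto (‖x‖, ‖y‖)) ε hε
        simp only [Set.mem_prod, Metric.mem_ball, and_imp, Prod.forall, Prod.exists] at this
        rcases this with ⟨ε₁, ε₂, ⟨h₁, h₂⟩, h⟩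
        obtain ⟨a, rfl, ha⟩ := Submodule.Quotient.norm_mk_lt x h₁
        obtain ⟨b, rfl, hb⟩ := Submodule.Quotient.norm_mk_lt y h₂
        simp only [dist, abs_sub_lt_iff] at h
        specialize h ‖a‖ ‖b‖ ⟨by linarith, by linarith [Submodule.Quotient.norm_mk_le J a]⟩
          ⟨by linarith, by linarith [Submodule.Quotient.norm_mk_le J b]⟩
        calc
          _ ≤ ‖a‖ * ‖b‖ := (Submodule.Quotient.norm_mk_le J (a * b)).trans (norm_mul_le a b)
          _ ≤ _ := (sub_lt_iff_lt_add'.mp h.1).le }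
  let st : StarRing (A ⧸ J) :=
    { star := Quotient.map' star fun a b hab => by
        rw [Submodule.quotientRel_def] at hab ⊢
        simpa using hstar _ hab
      star_involutive := by
        rintro ⟨a⟩
        exact congrArg (Ideal.Quotient.mk J) (star_star a)
      star_mul := by
        rintro ⟨a⟩ ⟨b⟩
        exact congrArg (Ideal.Quotient.mk J) (star_mul a b)
      star_add := by
        rintro ⟨a⟩ ⟨b⟩
        exact congrArg (Ideal.Quotient.mk J) (star_add a b) }
  let na : NormedAlgebra ℂ (A ⧸ J) :=
    { Ideal.Quotient.algebra ℂ with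
      norm_smul_le := (Submodule.Quotient.normedSpace J ℂ).norm_smul_le }
  let cs : CStarAlgebra (A ⧸ J) :=
    { nr, st, na with
      complete := (Submodule.Quotient.completeSpace J).complete
      norm_mul_self_le := by
        rintro ⟨a⟩
        exact Submodule.Quotient.norm_mk_sq_le_norm_mk_star_mul_self J hunit a
      star_smul := by
        rintro c ⟨a⟩
        exact congrArg (Ideal.Quotient.mk J) (star_smul c a) }
  exact ⟨A ⧸ J, cs, { Ideal.Quotient.mkₐ ℂ J with map_star' := fun _ => rfl },
    Ideal.Quotient.mk_surjective, fun a => Ideal.Quotient.eq_zero_iff_mem⟩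

end Quotient

/-- Small perturbations of a contraction `v` by elements of `(1 - vv*) A (1 - v*v)` are
contractions. -/
theorem norm_add_one_sub_mul_mul_one_sub_le_one {A : Type*} [CStarAlgebra A] {v b : A}
    (hv : ‖v‖ ≤ 1) (hb : ‖b‖ ≤ 1 / 4) :
    ‖v + (1 - v * star v) * b * (1 - star v * v)‖ ≤ 1 := by
  let := CStarAlgebra.spectralOrder A
  have := CStarAlgebra.spectralOrderedRing A
  nontriviality A
  have hd : 0 ≤ 1 - v * star v := by
    rw [sub_nonneg, ← CStarAlgebra.norm_le_one_iff_of_nonneg _ (mul_star_self_nonneg v),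
      CStarRing.norm_self_mul_star]
    nlinarith [norm_nonneg v]
  have hd1 : ‖1 - v * star v‖ ≤ 1 := by
    rw [CStarAlgebra.norm_le_one_iff_of_nonneg _ hd]
    simp
  set d := 1 - v * star v with hd_def
  set e := 1 - star v * v with he_def
  have hds : star d = d := by simp [hd_def]
  have hes : star e = e := by simp [he_def]
  have hdv : d * v = v * e := by simp [hd_def, he_def, mul_sub, sub_mul, mul_assoc]
  have hvd : star v * d = e * star v := by
    simpa [hds, hes] using congrArg star hdv
  set t := star v * b + star b * v + star b * (d * d) * b with ht_def
  have hts : IsSelfAdjoint t := by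
    simp [IsSelfAdjoint, ht_def, hds, add_comm, mul_assoc]
  have htn : ‖t‖ ≤ 1 := calc
    ‖t‖ ≤ ‖star v‖ * ‖b‖ + ‖star b‖ * ‖v‖ + ‖star b‖ * (‖d‖ * ‖d‖) * ‖b‖ := by
      refine (norm_add₃_le).trans ?_
      gcongr
      · exact norm_mul_le _ _
      · exact norm_mul_le _ _
      · refine (norm_mul_le _ _).trans ?_
        gcongr
        refine (norm_mul_le _ _).trans ?_
        gcongr
        exact norm_mul_le _ _
    _ ≤ 1 * (1 / 4) + 1 / 4 * 1 + 1 / 4 * (1 * 1) * (1 / 4) := by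
      simp only [norm_star]
      gcongr
    _ ≤ 1 := by norm_num
  have ht1 : t ≤ 1 := by
    have := hts.le_algebraMap_norm_self
    refine this.trans ?_
    rw [← map_one (algebraMap ℝ A)]
    exact algebraMap_mono A htn
  have hee : e * e ≤ e := by
    have h : e - e * e = star v * d * v := by
      rw [hvd]; simp only [he_def]; noncomm_ring
    rw [← sub_nonneg, h]
    exact star_left_conjugate_nonneg hd v
  have key : star (v + d * b * e) * (v + d * b * e) ≤ 1 := calc
    star (v + d * b * e) * (v + d * b * e) = star v * v + star e * t * e := by
      simp only [star_add, star_mul, hds, hes, ht_def]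
      have h1 : star v * (d * b * e) = e * (star v * b) * e := by
        rw [← mul_assoc, ← mul_assoc, hvd]; noncomm_ring
      have h2 : e * (star b * d) * v = e * (star b * v) * e := by
        rw [mul_assoc, mul_assoc, hdv]; noncomm_ring
      rw [mul_add, add_mul, add_mul, h1, h2]
      noncomm_ring
    _ ≤ star v * v + star e * 1 * e := by
      gcongr
      exact star_left_conjugate_le_conjugate ht1 e
    _ ≤ star v * v + e := by
      gcongr
      simpa [hes] using hee
    _ = 1 := by simp [he_def]
  rw [← CStarAlgebra.norm_le_one_iff_of_nonneg _ (star_mul_self_nonneg _),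
    CStarRing.norm_star_mul_self] at key
  nlinarith [norm_nonneg (v + d * b * e)]

/-- Half of Kadison's description of the extreme points of the unit ball. -/
theorem one_sub_mul_mul_one_sub_eq_zero_of_mem_extremePoints {A : Type*} [CStarAlgebra A] {v : A}
    (hv : v ∈ Set.extremePoints ℝ (Metric.closedBall (0 : A) 1)) (b : A) :
    (1 - v * star v) * b * (1 - star v * v) = 0 := by
  obtain ⟨hv1, hext⟩ := hv
  rw [mem_closedBall_zero_iff] at hv1
  set r : ℝ := (4 * (‖b‖ + 1))⁻¹ with hr
  have hr0 : 0 < r := by positivity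
  have hrb : ‖r • b‖ ≤ 1 / 4 := by
    rw [norm_smul, Real.norm_of_nonneg hr0.le, hr, inv_mul_le_iff₀ (by positivity)]
    linarith
  set c := (1 - v * star v) * (r • b) * (1 - star v * v) with hc
  have h1 : v + c ∈ Metric.closedBall (0 : A) 1 := by
    rw [mem_closedBall_zero_iff]
    exact norm_add_one_sub_mul_mul_one_sub_le_one hv1 hrb
  have h2 : v - c ∈ Metric.closedBall (0 : A) 1 := by
    rw [mem_closedBall_zero_iff]
    simpa [hc, sub_eq_add_neg] using
      norm_add_one_sub_mul_mul_one_sub_le_one (b := -(r • b)) hv1 (by simpa using hrb)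
  have h3 : v ∈ openSegment ℝ (v + c) (v - c) :=
    ⟨1 / 2, 1 / 2, by norm_num, by norm_num, by norm_num, by
      rw [← smul_add, add_add_sub_cancel, ← two_smul ℝ v, smul_smul]; norm_num⟩
  have h4 : c = 0 := by simpa using hext h1 h2 h3
  rw [hc, mul_smul_comm, smul_mul_assoc, smul_eq_zero] at h4
  exact h4.resolve_left hr0.ne'

section Corona

variable {I : Type*} [NonUnitalCStarAlgebra I]

theorem DoubleCentralizer.mul_coe (m : 𝓜(ℂ, I)) (x : I) :
    m * (x : 𝓜(ℂ, I)) = (m.fst x : I) := by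
  refine DoubleCentralizer.ext ℂ I _ _ (Prod.ext ?_ ?_) <;> ext y
  · change m.fst (x * y) = m.fst x * y
    rw [← sub_eq_zero, ← CStarRing.star_mul_self_eq_zero_iff, mul_sub, ← mul_assoc,
      ← m.central, ← m.central, mul_assoc, sub_self]
  · change m.snd y * x = y * m.fst x
    exact m.central y x

theorem DoubleCentralizer.star_coe (x : I) : star (x : 𝓜(ℂ, I)) = (star x : I) :=
  (map_star (DoubleCentralizer.coeHom : I →⋆ₙₐ[ℂ] 𝓜(ℂ, I)) x).symm

theorem DoubleCentralizer.coe_mul (m : 𝓜(ℂ, I)) (x : I) :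
    (x : 𝓜(ℂ, I)) * m = (m.snd x : I) := by
  rw [← star_inj, star_mul, star_coe, mul_coe, star_coe, star_fst, star_star]

theorem DoubleCentralizer.norm_coe (x : I) : ‖(x : 𝓜(ℂ, I))‖ = ‖x‖ := by
  rw [← DoubleCentralizer.norm_fst, DoubleCentralizer.coe_fst, ContinuousLinearMap.opNorm_mul_apply]

theorem DoubleCentralizer.isClosed_range_coe :
    IsClosed (Set.range fun x : I => (x : 𝓜(ℂ, I))) :=
  (AddMonoidHomClass.isometry_of_norm (DoubleCentralizer.coeHom : I →⋆ₙₐ[ℂ] 𝓜(ℂ, I))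
    DoubleCentralizer.norm_coe).isClosedEmbedding.isClosed_range

theorem NonUnitalCStarAlgebra.exists_norm_mul_one_sub_coe_le (x : I) {ε : ℝ} (hε : 0 < ε) :
    ∃ e : I, ‖1 - (e : 𝓜(ℂ, I))‖ ≤ 1 ∧ ‖(x : 𝓜(ℂ, I)) * (1 - (e : 𝓜(ℂ, I)))‖ ≤ ε := by
  let := CStarAlgebra.spectralOrder I
  have := CStarAlgebra.spectralOrderedRing I
  let := CStarAlgebra.spectralOrder 𝓜(ℂ, I)
  have := CStarAlgebra.spectralOrderedRing 𝓜(ℂ, I)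
  have hu := CStarAlgebra.increasingApproximateUnit I
  have hx := (Metric.tendsto_nhds.1 (hu.tendsto_mul_left x)) ε hε
  obtain ⟨e, ⟨he0, he1⟩, hex⟩ := ((hu.eventually_nonneg.and hu.eventually_norm).and hx).exists
  refine ⟨e, ?_, ?_⟩
  · have h0 : 0 ≤ (e : 𝓜(ℂ, I)) :=
      map_nonneg (DoubleCentralizer.coeHom : I →⋆ₙₐ[ℂ] 𝓜(ℂ, I)) he0
    have h1 : (e : 𝓜(ℂ, I)) ≤ 1 := by
      rw [← CStarAlgebra.norm_le_one_iff_of_nonneg _ h0, DoubleCentralizer.norm_coe]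
      exact he1
    rw [CStarAlgebra.norm_le_one_iff_of_nonneg _ (sub_nonneg.2 h1)]
    simpa using h0
  · have : (x : 𝓜(ℂ, I)) * (1 - (e : 𝓜(ℂ, I))) = ((x - x * e : I) : 𝓜(ℂ, I)) := by
      rw [mul_sub, mul_one]
      exact ((map_sub (DoubleCentralizer.coeHom : I →⋆ₙₐ[ℂ] 𝓜(ℂ, I)) _ _).trans
        (congrArg _ (map_mul (DoubleCentralizer.coeHom : I →⋆ₙₐ[ℂ] 𝓜(ℂ, I)) _ _))).symm
    rw [this, DoubleCentralizer.norm_coe, ← dist_eq_norm, dist_comm]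
    exact hex.le

variable (I) in
/-- The canonical copy of `I` as an ideal of its multiplier algebra. -/
noncomputable def DoubleCentralizer.coeIdeal : Ideal 𝓜(ℂ, I) where
  carrier := Set.range fun x : I => (x : 𝓜(ℂ, I))
  add_mem' := by
    rintro _ _ ⟨x, rfl⟩ ⟨y, rfl⟩
    exact ⟨x + y, map_add (DoubleCentralizer.coeHom : I →⋆ₙₐ[ℂ] 𝓜(ℂ, I)) x y⟩
  zero_mem' := ⟨0, map_zero (DoubleCentralizer.coeHom : I →⋆ₙₐ[ℂ] 𝓜(ℂ, I))⟩
  smul_mem' := by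
    rintro m _ ⟨x, rfl⟩
    exact ⟨m.fst x, (mul_coe m x).symm⟩

instance : (DoubleCentralizer.coeIdeal I).IsTwoSided where
  mul_mem_of_left := by
    rintro _ m ⟨x, rfl⟩
    exact ⟨m.snd x, (DoubleCentralizer.coe_mul m x).symm⟩

theorem exists_corona (I : Type) [NonUnitalCStarAlgebra I] :
    ∃ (C : Type) (_ : CStarAlgebra C) (π : 𝓜(ℂ, I) →⋆ₐ[ℂ] C), Function.Surjective π ∧
      ∀ m, π m = 0 ↔ ∃ x : I, m = (x : 𝓜(ℂ, I)) := by
  obtain ⟨C, hC, π, hπ, hker⟩ := exists_cstarAlgebra_quotient (DoubleCentralizer.coeIdeal I)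
    DoubleCentralizer.isClosed_range_coe
    (by rintro _ ⟨x, rfl⟩; exact ⟨star x, (DoubleCentralizer.star_coe x).symm⟩)
    (by
      rintro _ ⟨x, rfl⟩ ε hε
      obtain ⟨e, he⟩ := NonUnitalCStarAlgebra.exists_norm_mul_one_sub_coe_le x hε
      exact ⟨e, ⟨e, rfl⟩, he⟩)
  exact ⟨C, hC, π, hπ, fun m => (hker m).trans (exists_congr fun _ => eq_comm)⟩

end Corona

section StableRank

open Polynomial

theorem NonUnitalStarAlgHom.finite_spectrum_inr {I A : Type*} [NonUnitalCStarAlgebra I]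
    [CStarAlgebra A] (φ : I →⋆ₙₐ[ℂ] A) (hφ : Function.Injective φ) {g : I}
    (hg : IsAlgebraic ℂ (φ g)) : (spectrum ℂ (g : Unitization ℂ I)).Finite := by
  obtain ⟨q, hq0, hq⟩ := hg
  have hzero : aeval (g : Unitization ℂ I) (X * q) = 0 := by
    have hfst : (aeval (g : Unitization ℂ I) (X * q)).fst = 0 := by
      simp
    have hlift : Unitization.lift φ.toNonUnitalAlgHom (aeval (g : Unitization ℂ I) (X * q)) = 0 := by
      rw [← aeval_algHom_apply]
      simp [hq]
    rw [← Unitization.inl_fst_add_inr_snd_eq (aeval (g : Unitization ℂ I) (X * q)), hfst] at hlift ⊢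
    have : φ (aeval (g : Unitization ℂ I) (X * q)).snd = 0 := by simpa using hlift
    rw [(map_eq_zero_iff φ hφ).1 this]
    simp
  refine ((X * q).roots.toFinset.finite_toSet).subset fun z hz => ?_
  have h := spectrum.subset_polynomial_aeval (g : Unitization ℂ I) (X * q) ⟨z, hz, rfl⟩
  rw [hzero] at h
  have hz0 : eval z (X * q) = 0 := by
    simpa using h
  simpa [mul_ne_zero X_ne_zero hq0] using hz0

theorem NonUnitalStarAlgHom.dense_isUnit_unitization {I A : Type*} [NonUnitalCStarAlgebra I]
    [CStarAlgebra A] (φ : I →⋆ₙₐ[ℂ] A) (hφ : Function.Injective φ)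
    (hd : Dense {g : I | IsAlgebraic ℂ (φ g)}) :
    Dense {x : Unitization ℂ I | IsUnit x} := by
  have hinl : Continuous fun z : ℂ => (algebraMap ℂ (Unitization ℂ I) z) :=
    continuous_algebraMap ℂ _
  have hinr : Continuous (Unitization.inr : I → Unitization ℂ I) := Unitization.continuous_inr
  have key : ∀ g : I, IsAlgebraic ℂ (φ g) → ∀ z : ℂ,
      algebraMap ℂ (Unitization ℂ I) z + (g : Unitization ℂ I) ∈
        closure {x : Unitization ℂ I | IsUnit x} := by
    intro g hg z
    have hfin : (spectrum ℂ (-g : Unitization ℂ I)).Finite := by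
      have := φ.finite_spectrum_inr hφ (g := -g) (by simpa using hg.neg)
      simpa using this
    have hz : z ∈ closure (spectrum ℂ (-g : Unitization ℂ I))ᶜ :=
      (hfin.countable.dense_compl ℂ) z
    have hc : Continuous fun z : ℂ => algebraMap ℂ (Unitization ℂ I) z + (g : Unitization ℂ I) :=
      hinl.add continuous_const
    refine map_mem_closure
      (f := fun z : ℂ => algebraMap ℂ (Unitization ℂ I) z + (g : Unitization ℂ I))
      hc hz fun w hw => ?_
    rw [Set.mem_compl_iff, spectrum.notMem_iff, sub_neg_eq_add] at hw
    exact hw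
  intro y
  obtain ⟨z, f⟩ := y
  have hy : (⟨z, f⟩ : Unitization ℂ I) = algebraMap ℂ (Unitization ℂ I) z + (f : Unitization ℂ I) := by
    rw [Unitization.algebraMap_eq_inl]
    exact (Unitization.inl_fst_add_inr_snd_eq (⟨z, f⟩ : Unitization ℂ I)).symm
  rw [hy, ← closure_closure]
  exact map_mem_closure
    (f := fun g : I => algebraMap ℂ (Unitization ℂ I) z + (g : Unitization ℂ I))
    (continuous_const.add hinr) (hd f) fun g hg => key g hg z

end StableRank

section FiniteRank

variable {E : Type*} [NormedAddCommGroup E] [InnerProductSpace ℂ E]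

theorem ContinuousLinearMap.finiteDimensional_range_comp_left (S T : E →L[ℂ] E)
    (hT : FiniteDimensional ℂ (LinearMap.range (T : E →ₗ[ℂ] E))) :
    FiniteDimensional ℂ (LinearMap.range ((S * T : E →L[ℂ] E) : E →ₗ[ℂ] E)) := by
  have h : LinearMap.range ((S * T : E →L[ℂ] E) : E →ₗ[ℂ] E) =
      (LinearMap.range (T : E →ₗ[ℂ] E)).map (S : E →ₗ[ℂ] E) := LinearMap.range_comp _ _
  rw [h]
  infer_instance

theorem ContinuousLinearMap.finiteDimensional_range_comp_right (S T : E →L[ℂ] E)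
    (hT : FiniteDimensional ℂ (LinearMap.range (T : E →ₗ[ℂ] E))) :
    FiniteDimensional ℂ (LinearMap.range ((T * S : E →L[ℂ] E) : E →ₗ[ℂ] E)) :=
  Submodule.finiteDimensional_of_le
    (LinearMap.range_comp_le_range (S : E →ₗ[ℂ] E) (T : E →ₗ[ℂ] E))

variable [CompleteSpace E]

theorem ContinuousLinearMap.finiteDimensional_range_star (T : E →L[ℂ] E)
    (hT : FiniteDimensional ℂ (LinearMap.range (T : E →ₗ[ℂ] E))) :
    FiniteDimensional ℂ (LinearMap.range ((star T : E →L[ℂ] E) : E →ₗ[ℂ] E)) := by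
  set V := LinearMap.range (T : E →ₗ[ℂ] E) with hV
  have h : V.starProjection * T = T := by
    ext x
    exact Submodule.starProjection_eq_self_iff.2 ⟨x, rfl⟩
  have hs : star T = star T * V.starProjection := by
    conv_lhs => rw [← h, star_mul, (isSelfAdjoint_starProjection V).star_eq]
  rw [hs]
  refine finiteDimensional_range_comp_left _ _ ?_
  have : LinearMap.range (V.starProjection : E →ₗ[ℂ] E) = V := Submodule.range_starProjection V
  rw [this]
  exact hT

variable (E) in
/-- The operators of finite rank. -/
def finiteRankOperators : NonUnitalStarSubalgebra ℂ (E →L[ℂ] E) where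
  carrier := {T | FiniteDimensional ℂ (LinearMap.range (T : E →ₗ[ℂ] E))}
  add_mem' {S T} hS hT := by
    have : FiniteDimensional ℂ (LinearMap.range (S : E →ₗ[ℂ] E)) := hS
    have : FiniteDimensional ℂ (LinearMap.range (T : E →ₗ[ℂ] E)) := hT
    exact Submodule.finiteDimensional_of_le
      (LinearMap.range_add_le (S : E →ₗ[ℂ] E) (T : E →ₗ[ℂ] E))
  zero_mem' := by
    have : LinearMap.range ((0 : E →L[ℂ] E) : E →ₗ[ℂ] E) = ⊥ := LinearMap.range_zero
    change FiniteDimensional ℂ (LinearMap.range ((0 : E →L[ℂ] E) : E →ₗ[ℂ] E))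
    rw [this]
    infer_instance
  mul_mem' {S T} _ hT := ContinuousLinearMap.finiteDimensional_range_comp_left S T hT
  smul_mem' c T hT := by
    have := ContinuousLinearMap.finiteDimensional_range_comp_left (c • 1) T hT
    rwa [smul_one_mul] at this
  star_mem' {T} hT := T.finiteDimensional_range_star hT

theorem mul_mem_finiteRankOperators_left (S : E →L[ℂ] E) {T : E →L[ℂ] E}
    (hT : T ∈ finiteRankOperators E) : S * T ∈ finiteRankOperators E :=
  ContinuousLinearMap.finiteDimensional_range_comp_left S T hT

theorem mul_mem_finiteRankOperators_right (S : E →L[ℂ] E) {T : E →L[ℂ] E}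
    (hT : T ∈ finiteRankOperators E) : T * S ∈ finiteRankOperators E :=
  ContinuousLinearMap.finiteDimensional_range_comp_right S T hT

theorem rankOne_mem_finiteRankOperators (x y : E) :
    InnerProductSpace.rankOne ℂ x y ∈ finiteRankOperators E := by
  refine Submodule.finiteDimensional_of_le (S₂ := ℂ ∙ x) ?_
  rintro _ ⟨z, rfl⟩
  exact Submodule.mem_span_singleton.2 ⟨inner ℂ y z, rfl⟩

theorem isAlgebraic_of_mem_finiteRankOperators {T : E →L[ℂ] E}
    (hT : T ∈ finiteRankOperators E) : IsAlgebraic ℂ T := by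
  set V := LinearMap.range (T : E →ₗ[ℂ] E) with hV
  have hfin : FiniteDimensional ℂ V := hT
  let R : V →ₗ[ℂ] V := (T : E →ₗ[ℂ] E).restrict fun x _ => ⟨x, rfl⟩
  have hR : ∀ (q : Polynomial ℂ) (x : V),
      ((Polynomial.aeval R q x : V) : E) = Polynomial.aeval T q (x : E) := by
    intro q x
    induction q using Polynomial.induction_on' generalizing x with
    | add p q hp hq => simp [hp, hq]
    | monomial n a =>
      simp only [Polynomial.aeval_monomial, Module.algebraMap_end_eq_smul_id]
      have : ∀ x : V, (((R ^ n) x : V) : E) = (T ^ n) (x : E) := by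
        induction n with
        | zero => intro x; simp
        | succ n ih => intro x; rw [pow_succ, pow_succ]; exact ih (R x)
      simp [this, Algebra.algebraMap_eq_smul_one]
  refine ⟨LinearMap.charpoly R * Polynomial.X,
    mul_ne_zero R.charpoly_monic.ne_zero Polynomial.X_ne_zero, ?_⟩
  ext x
  have h := hR R.charpoly ⟨T x, x, rfl⟩
  rw [R.aeval_self_charpoly] at h
  simpa using h.symm

theorem mul_mem_topologicalClosure_finiteRankOperators_left (S : E →L[ℂ] E) {T : E →L[ℂ] E}
    (hT : T ∈ (finiteRankOperators E).topologicalClosure) :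
    S * T ∈ (finiteRankOperators E).topologicalClosure :=
  map_mem_closure (continuous_const_mul S) hT fun _ => mul_mem_finiteRankOperators_left S

theorem mul_mem_topologicalClosure_finiteRankOperators_right (S : E →L[ℂ] E) {T : E →L[ℂ] E}
    (hT : T ∈ (finiteRankOperators E).topologicalClosure) :
    T * S ∈ (finiteRankOperators E).topologicalClosure :=
  map_mem_closure (f := fun T => T * S) (continuous_mul_const S) hT
    fun _ => mul_mem_finiteRankOperators_right S

theorem LinearMap.surjective_one_add_of_finiteDimensional_range {V : Type*} [AddCommGroup V]
    [Module ℂ V] (F : V →ₗ[ℂ] V) [FiniteDimensional ℂ (LinearMap.range F)]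
    (hF : Function.Injective ⇑(1 + F)) : Function.Surjective ⇑(1 + F) := by
  have hmaps : ∀ x ∈ LinearMap.range F, (1 + F) x ∈ LinearMap.range F := fun x hx =>
    Submodule.add_mem _ hx ⟨x, rfl⟩
  have hsurj : Function.Surjective ((1 + F).restrict hmaps) := by
    rw [← LinearMap.injective_iff_surjective]
    intro x y hxy
    exact Subtype.ext (hF (congrArg Subtype.val hxy))
  intro y
  obtain ⟨v, hv⟩ := hsurj ⟨F y, y, rfl⟩
  have hv' : (1 + F) (v : V) = F y := congrArg Subtype.val hv
  exact ⟨y - v, by rw [map_sub, hv']; simp⟩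

/-- An isometry that is a compact perturbation of the adjoint of an isometry `b` forces `b`
to be unitary. -/
theorem mul_star_eq_one_of_isometry_sub_star_mem {b T : E →L[ℂ] E} (hb : star b * b = 1)
    (hT : star T * T = 1) (hk : T - star b ∈ (finiteRankOperators E).topologicalClosure) :
    b * star b = 1 := by
  obtain ⟨F, hF, hFd⟩ := Metric.mem_closure_iff.1 hk (1 / 2) (by norm_num)
  rw [dist_eq_norm] at hFd
  have hTn : ∀ x, ‖T x‖ = ‖x‖ := (ContinuousLinearMap.norm_map_iff_adjoint_comp_self T).2 hT
  have hbn : ∀ x, ‖b x‖ = ‖x‖ := (ContinuousLinearMap.norm_map_iff_adjoint_comp_self b).2 hb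
  have hlow : ∀ x, ‖x‖ ≤ 2 * ‖(star b + F) x‖ := by
    intro x
    have h1 : T x = (star b + F) x + (T - star b - F) x := by simp
    have h2 : ‖(T - star b - F) x‖ ≤ 1 / 2 * ‖x‖ :=
      ((T - star b - F).le_opNorm x).trans (by gcongr)
    have h3 := norm_add_le ((star b + F) x) ((T - star b - F) x)
    rw [← h1, hTn] at h3
    linarith
  have hinj : Function.Injective (star b + F) := by
    rw [injective_iff_map_eq_zero]
    intro x hx
    have := hlow x
    rw [hx, norm_zero, mul_zero] at this
    exact norm_le_zero_iff.1 this
  have hbb : ∀ x, star b (b x) = x := fun x => congrArg (fun S : E →L[ℂ] E => S x) hb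
  have hcomp : ∀ x, (1 + ((F * b : E →L[ℂ] E) : E →ₗ[ℂ] E)) x = (star b + F) (b x) := by
    intro x
    simp [hbb]
  have hfin : FiniteDimensional ℂ (LinearMap.range ((F * b : E →L[ℂ] E) : E →ₗ[ℂ] E)) :=
    mul_mem_finiteRankOperators_right b hF
  have hbinj : Function.Injective b := fun x y hxy => by
    rw [← hbb x, hxy, hbb]
  have hsurj := LinearMap.surjective_one_add_of_finiteDimensional_range
    ((F * b : E →L[ℂ] E) : E →ₗ[ℂ] E) (by
      intro x y hxy
      rw [hcomp, hcomp] at hxy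
      exact hbinj (hinj hxy))
  ext y
  obtain ⟨x, hx⟩ := hsurj ((star b + F) y)
  rw [hcomp] at hx
  have hy : b x = y := hinj hx
  simp [← hy, hbb]

end FiniteRank

section LimitAlgebra

open Filter Topology OnePoint

variable {E : Type*} [NormedAddCommGroup E] [InnerProductSpace ℂ E] [CompleteSpace E]

/-- The algebra of convergent sequences of compact operators whose limit commutes with `e` and
`star e`, realised as functions on the one-point compactification of `ℕ`. -/
noncomputable def commutingLimitAlgebra (e : E →L[ℂ] E) :
    NonUnitalStarSubalgebra ℂ C(OnePoint ℕ, E →L[ℂ] E) where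
  carrier := {f | (∀ x, f x ∈ (finiteRankOperators E).topologicalClosure) ∧
    Commute (f ∞) e ∧ Commute (f ∞) (star e)}
  add_mem' := fun hf hg => ⟨fun x => add_mem (hf.1 x) (hg.1 x),
    hf.2.1.add_left hg.2.1, hf.2.2.add_left hg.2.2⟩
  zero_mem' := ⟨fun _ => zero_mem _, Commute.zero_left _, Commute.zero_left _⟩
  mul_mem' := fun hf hg => ⟨fun x => mul_mem (hf.1 x) (hg.1 x),
    hf.2.1.mul_left hg.2.1, hf.2.2.mul_left hg.2.2⟩
  smul_mem' := fun c _ hf => ⟨fun x => SMulMemClass.smul_mem c (hf.1 x),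
    hf.2.1.smul_left c, hf.2.2.smul_left c⟩
  star_mem' := fun {f} hf => ⟨fun x => star_mem (hf.1 x),
    by simpa using hf.2.2.star_star, hf.2.1.star_star⟩

instance isClosed_commutingLimitAlgebra (e : E →L[ℂ] E) :
    IsClosed (commutingLimitAlgebra e : Set C(OnePoint ℕ, E →L[ℂ] E)) := by
  have hev (x : OnePoint ℕ) : Continuous fun f : C(OnePoint ℕ, E →L[ℂ] E) => f x :=
    continuous_eval_const x
  have h (c : E →L[ℂ] E) :
      IsClosed {f : C(OnePoint ℕ, E →L[ℂ] E) | Commute (f ∞) c} :=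
    isClosed_eq ((hev ∞).mul continuous_const) (continuous_const.mul (hev ∞))
  have hK : IsClosed {f : C(OnePoint ℕ, E →L[ℂ] E) |
      ∀ x, f x ∈ (finiteRankOperators E).topologicalClosure} := by
    rw [Set.ofPred_forall]
    exact isClosed_iInter fun x =>
      (NonUnitalStarSubalgebra.isClosed_topologicalClosure (finiteRankOperators E)).preimage (hev x)
  exact hK.inter ((h e).inter (h (star e)))

theorem ContinuousMap.isAlgebraic_of_forall_of_eventually_eq {B : Type*} [NormedRing B]
    [NormedAlgebra ℂ B] (g : C(OnePoint ℕ, B)) (hg : ∀ x, IsAlgebraic ℂ (g x)) (N : ℕ)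
    (hN : ∀ n : ℕ, N ≤ n → g n = g ∞) : IsAlgebraic ℂ g := by
  choose p hp0 hp using hg
  refine ⟨p ∞ * ∏ n ∈ Finset.range N, p (n : OnePoint ℕ),
    mul_ne_zero (hp0 _) (Finset.prod_ne_zero_iff.2 fun _ _ => hp0 _), ?_⟩
  have key (q : Polynomial ℂ) (x : OnePoint ℕ) :
      (Polynomial.aeval g q) x = Polynomial.aeval (g x) q :=
    (Polynomial.aeval_algHom_apply
      ((Pi.evalAlgHom ℂ (fun _ => B) x).comp (ContinuousMap.coeFnAlgHom ℂ)) g q).symm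
  ext x
  rw [key, ContinuousMap.zero_apply]
  have hdvd (x) (hx : p x ∣ p ∞ * ∏ n ∈ Finset.range N, p (n : OnePoint ℕ)) :
      Polynomial.aeval (g x) (p ∞ * ∏ n ∈ Finset.range N, p (n : OnePoint ℕ)) = 0 := by
    obtain ⟨r, hr⟩ := hx
    rw [hr, map_mul, hp, zero_mul]
  induction x using OnePoint.rec with
  | infty => exact hdvd ∞ (dvd_mul_right _ _)
  | coe n =>
    by_cases hn : N ≤ n
    · rw [hN n hn]
      exact hdvd ∞ (dvd_mul_right _ _)
    · exact hdvd n ((Finset.dvd_prod_of_mem _ (Finset.mem_range.2 (not_le.1 hn))).mul_left _)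

theorem dense_isAlgebraic_commutingLimitAlgebra {e : E →L[ℂ] E} (he : IsStarProjection e) :
    Dense {g : commutingLimitAlgebra e |
      IsAlgebraic ℂ (g : C(OnePoint ℕ, E →L[ℂ] E))} := by
  have hes : star e = e := he.isSelfAdjoint
  have hee : e * e = e := he.isIdempotentElem
  refine Metric.dense_iff.2 fun f ε hε => ?_
  have hlim := (OnePoint.continuous_iff_from_nat _).1 (f : C(OnePoint ℕ, E →L[ℂ] E)).continuous
  obtain ⟨N, hN⟩ := Metric.tendsto_atTop.1 hlim (ε / 4) (by positivity)
  have happ (x : OnePoint ℕ) : ∃ T ∈ finiteRankOperators E,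
      ‖(f : C(OnePoint ℕ, E →L[ℂ] E)) x - T‖ < ε / 8 := by
    simpa [dist_eq_norm] using Metric.mem_closure_iff.1 (f.2.1 x) (ε / 8) (by positivity)
  choose T hT hTf using happ
  let R := e * T ∞ * e + (1 - e) * T ∞ * (1 - e)
  have hR : R ∈ finiteRankOperators E :=
    add_mem (mul_mem_finiteRankOperators_right _ (mul_mem_finiteRankOperators_left _ (hT ∞)))
      (mul_mem_finiteRankOperators_right _ (mul_mem_finiteRankOperators_left _ (hT ∞)))
  have hRe : Commute R e := by
    have h1 : e * (1 - e) = 0 := by rw [mul_sub, hee, mul_one, sub_self]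
    have h2 : (1 - e) * e = 0 := by rw [sub_mul, hee, one_mul, sub_self]
    simp only [Commute, SemiconjBy, R, add_mul, mul_add, mul_assoc, h2, hee, mul_zero, add_zero]
    simp only [← mul_assoc, h1, hee, zero_mul, add_zero]
  have hRf : ‖(f : C(OnePoint ℕ, E →L[ℂ] E)) ∞ - R‖ ≤ ε / 4 := by
    have hc : (f : C(OnePoint ℕ, E →L[ℂ] E)) ∞ * e = e * (f : C(OnePoint ℕ, E →L[ℂ] E)) ∞ :=
      f.2.2.1
    set F := (f : C(OnePoint ℕ, E →L[ℂ] E)) ∞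
    have h0 : F - R = e * (F - T ∞) * e + (1 - e) * (F - T ∞) * (1 - e) := by
      have h1 : e * F * e = F * e := by rw [← hc, mul_assoc, hee]
      have h2 : (1 - e) * F * (1 - e) = F - F * e := by
        rw [mul_one_sub, one_sub_mul, sub_mul, h1, ← hc, sub_self, sub_zero]
      simp only [R, mul_sub _ F, sub_mul _ _ e, sub_mul _ _ (1 - e), h1, h2]
      abel
    have hn : ‖e‖ ≤ 1 := he.norm_le
    have hn' : ‖1 - e‖ ≤ 1 := he.one_sub.norm_le
    have hb {c : E →L[ℂ] E} (hc : ‖c‖ ≤ 1) : ‖c * (F - T ∞) * c‖ ≤ ε / 8 := by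
      calc ‖c * (F - T ∞) * c‖ ≤ ‖c‖ * ‖F - T ∞‖ * ‖c‖ := norm_mul₃_le
        _ ≤ 1 * ‖F - T ∞‖ * 1 := by gcongr
        _ ≤ ε / 8 := by simpa using (hTf ∞).le
    rw [h0]
    refine (norm_add_le _ _).trans ?_
    linarith [hb hn, hb hn']
  let g : C(OnePoint ℕ, E →L[ℂ] E) := OnePoint.continuousMapMkNat
    (fun n => if N ≤ n then R else T n) R
    (tendsto_const_nhds.congr' ((eventually_ge_atTop N).mono fun n hn => by simp [hn]))
  have hginf : g ∞ = R := rfl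
  have hgn (n : ℕ) : g n = if N ≤ n then R else T n := rfl
  have hgfin (x) : g x ∈ finiteRankOperators E := by
    induction x using OnePoint.rec with
    | infty => exact hR
    | coe n => rw [hgn]; split_ifs; exacts [hR, hT n]
  have hgI : g ∈ commutingLimitAlgebra e :=
    ⟨fun x => NonUnitalStarSubalgebra.le_topologicalClosure _ (hgfin x), hRe, hes.symm ▸ hRe⟩
  refine ⟨⟨g, hgI⟩, ?_, ContinuousMap.isAlgebraic_of_forall_of_eventually_eq g
    (fun x => isAlgebraic_of_mem_finiteRankOperators (hgfin x)) N
    fun n hn => by rw [hgn, if_pos hn, hginf]⟩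
  rw [Metric.mem_ball, dist_comm, Subtype.dist_eq]
  refine ((ContinuousMap.dist_le (by positivity : 0 ≤ ε / 2)).2 fun x => ?_).trans_lt
    (half_lt_self hε)
  rw [dist_eq_norm]
  induction x using OnePoint.rec with
  | infty => exact hRf.trans (by linarith)
  | coe n =>
    change ‖_ - g n‖ ≤ _
    rw [hgn]
    split_ifs with hn
    · have := (hN n hn).le
      rw [dist_eq_norm] at this
      calc _ ≤ _ := norm_sub_le_norm_sub_add_norm_sub _
            ((f : C(OnePoint ℕ, E →L[ℂ] E)) ∞) R
        _ ≤ ε / 4 + ε / 4 := add_le_add this hRf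
        _ = ε / 2 := by ring
    · exact (hTf n).le.trans (by linarith)

end LimitAlgebra

section ShiftPair

variable {E : Type*} [NormedAddCommGroup E] [InnerProductSpace ℂ E]

theorem HilbertBasis.continuousLinearMap_ext {ι : Type*} (β : HilbertBasis ι ℂ E)
    {S T : E →L[ℂ] E} (h : ∀ i, S (β i) = T (β i)) : S = T :=
  ContinuousLinearMap.ext_on (Submodule.dense_iff_topologicalClosure_eq_top.2 β.dense_span)
    (Set.forall_mem_range.2 h)

variable [CompleteSpace E]

theorem eq_zero_or_eq_zero_of_mul_finiteRankOperators_mul {P Q : E →L[ℂ] E}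
    (h : ∀ T ∈ finiteRankOperators E, P * T * Q = 0) : P = 0 ∨ Q = 0 := by
  by_contra! hPQ
  obtain ⟨x, hx⟩ := DFunLike.exists_ne hPQ.1
  obtain ⟨z, hz⟩ := DFunLike.exists_ne hPQ.2
  have h0 := DFunLike.congr_fun (h _ (rankOne_mem_finiteRankOperators x (Q z))) z
  simp only [mul_apply_eq_comp, InnerProductSpace.rankOne_apply, map_smul,
    zero_apply, smul_eq_zero, inner_self_eq_zero] at h0
  exact h0.elim hz hx

/-- Proper isometries `a` and `b` of finite corank which commute with a projection `e` and act
nontrivially only on the range of `e` and of `1 - e` respectively. -/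
structure IsSplitIsometryPair (e a b : E →L[ℂ] E) : Prop where
  isStarProjection : IsStarProjection e
  star_mul_left : star a * a = 1
  star_mul_right : star b * b = 1
  commute_left : Commute a e
  commute_right : Commute b e
  left_mul : a * (1 - e) = 1 - e
  right_mul : b * e = e
  defect_left : 1 - a * star a ∈ finiteRankOperators E
  defect_right : 1 - b * star b ∈ finiteRankOperators E
  mul_star_left_ne : a * star a ≠ 1
  mul_star_right_ne : b * star b ≠ 1

namespace IsSplitIsometryPair

variable {e a b : E →L[ℂ] E}

theorem symm (h : IsSplitIsometryPair e a b) : IsSplitIsometryPair (1 - e) b a where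
  isStarProjection := h.isStarProjection.one_sub
  star_mul_left := h.star_mul_right
  star_mul_right := h.star_mul_left
  commute_left := (Commute.one_right b).sub_right h.commute_right
  commute_right := (Commute.one_right a).sub_right h.commute_left
  left_mul := by rw [sub_sub_cancel, h.right_mul]
  right_mul := h.left_mul
  defect_left := h.defect_right
  defect_right := h.defect_left
  mul_star_left_ne := h.mul_star_right_ne
  mul_star_right_ne := h.mul_star_left_ne

theorem star_eq (h : IsSplitIsometryPair e a b) : star e = e := h.isStarProjection.isSelfAdjoint

theorem star_right_mul (h : IsSplitIsometryPair e a b) : star b * e = e := by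
  have h1 := congrArg star (h.commute_right.eq.symm.trans h.right_mul)
  rwa [star_mul, h.star_eq] at h1

theorem commute_star_right (h : IsSplitIsometryPair e a b) : Commute (star b) e := by
  simpa [h.star_eq] using h.commute_right.star_star

theorem commute_mul_star (h : IsSplitIsometryPair e a b) : Commute (a * star b) e :=
  h.commute_left.mul_left h.commute_star_right

/-- No compact perturbation of `a * star b` commuting with `e` is an isometry. -/
theorem star_mul_self_ne_one (h : IsSplitIsometryPair e a b) {W : E →L[ℂ] E} (hWe : Commute W e)
    (hW : W - a * star b ∈ (finiteRankOperators E).topologicalClosure) : star W * W ≠ 1 := by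
  intro hWW
  have hee : e * e = e := h.isStarProjection.isIdempotentElem
  have he0 : e * (1 - e) = 0 := by rw [mul_one_sub, hee, sub_self]
  have he0' : (1 - e) * e = 0 := by rw [one_sub_mul, hee, sub_self]
  have hWe' : Commute W (1 - e) := (Commute.one_right W).sub_right hWe
  refine h.mul_star_right_ne (mul_star_eq_one_of_isometry_sub_star_mem
    (T := W * (1 - e) + e) h.star_mul_right ?_ ?_)
  · have hs : star (W * (1 - e) + e) = (1 - e) * star W + e := by
      simp [h.star_eq]
    rw [hs]
    calc ((1 - e) * star W + e) * (W * (1 - e) + e)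
        = (1 - e) * (star W * W) * (1 - e) + (1 - e) * star W * e + e * (W * (1 - e)) + e * e := by
          noncomm_ring
      _ = 1 := by
          have h1 : star W * e = e * star W := by
            simpa [h.star_eq] using hWe.star_star.eq
          rw [hWW, mul_assoc _ (star W) e, h1, ← mul_assoc _ e, he0', hWe'.eq, ← mul_assoc, he0,
            hee, mul_one, h.isStarProjection.one_sub.isIdempotentElem.eq]
          simp
  · have h1 : a * star b * (1 - e) = star b * (1 - e) := by
      have h2 : Commute (star b) (1 - e) := (Commute.one_right _).sub_right h.commute_star_right
      rw [mul_assoc, h2.eq, ← mul_assoc, h.left_mul]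
    have h3 : W * (1 - e) + e - star b = (W - a * star b) * (1 - e) := by
      rw [sub_mul, h1, mul_one_sub (star b), h.star_right_mul]
      abel
    rw [h3]
    exact mul_mem_topologicalClosure_finiteRankOperators_right _ hW

theorem mul_star_self_ne_one (h : IsSplitIsometryPair e a b) {W : E →L[ℂ] E} (hWe : Commute W e)
    (hW : W - a * star b ∈ (finiteRankOperators E).topologicalClosure) : W * star W ≠ 1 := by
  have hc : Commute (star W) (1 - e) :=
    (Commute.one_right _).sub_right (by simpa [h.star_eq] using hWe.star_star)
  simpa using h.symm.star_mul_self_ne_one (W := star W) hc (by simpa using star_mem hW)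

end IsSplitIsometryPair

theorem HilbertBasis.exists_isometry {ι : Type*} (β : HilbertBasis ι ℂ E) {f : ι → ι}
    (hf : Function.Injective f) :
    ∃ V : E →L[ℂ] E, star V * V = 1 ∧ ∀ i, V (β i) = β (f i) := by
  classical
  have ho : Orthonormal ℂ fun i => β (f i) := β.orthonormal.comp f hf
  let V : E →ₗᵢ[ℂ] E :=
    ho.orthogonalFamily.linearIsometry.comp β.repr.toLinearIsometry
  refine ⟨V.toContinuousLinearMap,
    (ContinuousLinearMap.norm_map_iff_adjoint_comp_self _).1 V.norm_map, fun i => ?_⟩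
  change ho.orthogonalFamily.linearIsometry (β.repr (β i)) = _
  rw [β.repr_self, OrthogonalFamily.linearIsometry_apply_single]
  simp

section Basis

variable {ι : Type*} (β : HilbertBasis ι ℂ E) {f : ι → ι} {V : E →L[ℂ] E}

theorem HilbertBasis.mul_star_ne_one_of_isometry
    (hV : ∀ i, V (β i) = β (f i)) {k : ι} (hk : ∀ i, f i ≠ k) : V * star V ≠ 1 := by
  intro h
  have h0 : star V (β k) = 0 := by
    apply β.repr.injective
    ext i
    rw [β.repr_apply_apply, ContinuousLinearMap.star_eq_adjoint,
      ContinuousLinearMap.adjoint_inner_right, hV, β.orthonormal.inner_eq_zero (hk i), map_zero]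
    rfl
  have h1 := DFunLike.congr_fun h (β k)
  rw [mul_apply_eq_comp, h0, map_zero] at h1
  exact β.orthonormal.ne_zero k h1.symm

theorem HilbertBasis.one_sub_mul_star_mem_finiteRankOperators_of_isometry
    (hVV : star V * V = 1) (hV : ∀ i, V (β i) = β (f i)) {k : ι} (hk : ∀ i, f i ≠ k)
    (hf : ∀ j, j ≠ k → ∃ i, f i = j) : 1 - V * star V ∈ finiteRankOperators E := by
  have h : 1 - V * star V = InnerProductSpace.rankOne ℂ ((1 - V * star V) (β k)) (β k) := by
    refine β.continuousLinearMap_ext fun j => ?_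
    by_cases hj : j = k
    · subst hj
      simp [InnerProductSpace.rankOne_apply, inner_self_eq_norm_sq_to_K,
        β.orthonormal.norm_eq_one]
    · obtain ⟨i, rfl⟩ := hf j hj
      have h0 : (1 - V * star V) * V = 0 := by rw [sub_mul, mul_assoc, hVV]; simp
      rw [InnerProductSpace.rankOne_apply, β.orthonormal.inner_eq_zero (Ne.symm hj), zero_smul,
        ← hV]
      exact DFunLike.congr_fun h0 (β i)
  rw [h]
  exact rankOne_mem_finiteRankOperators _ _

theorem HilbertBasis.exists_isStarProjection (s : Set ι) :
    ∃ e : E →L[ℂ] E, IsStarProjection e ∧ (∀ i ∈ s, e (β i) = β i) ∧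
      ∀ i ∉ s, e (β i) = 0 := by
  let U := (Submodule.span ℂ (β '' s)).topologicalClosure
  have : CompleteSpace U := (Submodule.isClosed_topologicalClosure _).completeSpace_coe
  refine ⟨U.starProjection, isStarProjection_starProjection, fun i hi => ?_, fun i hi => ?_⟩
  · exact Submodule.starProjection_eq_self_iff.2
      (Submodule.le_topologicalClosure _ (Submodule.subset_span ⟨i, hi, rfl⟩))
  · rw [Submodule.starProjection_apply_eq_zero_iff, Submodule.orthogonal_closure,
      Submodule.mem_orthogonal]
    intro u hu
    induction hu using Submodule.span_induction with
    | mem x hx =>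
      obtain ⟨j, hj, rfl⟩ := hx
      exact β.orthonormal.inner_eq_zero fun h => hi (h ▸ hj)
    | zero => simp
    | add x y _ _ hx hy => rw [inner_add_left, hx, hy, add_zero]
    | smul c x _ hx => rw [inner_smul_left, hx, mul_zero]

end Basis

theorem HilbertBasis.exists_isSplitIsometryPair (β : HilbertBasis (ℕ ⊕ ℕ) ℂ E) :
    ∃ e a b : E →L[ℂ] E, IsSplitIsometryPair e a b := by
  obtain ⟨e, he, he1, he0⟩ := β.exists_isStarProjection (Set.range Sum.inl)
  have hl (n : ℕ) : e (β (.inl n)) = β (.inl n) := he1 _ ⟨n, rfl⟩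
  have hr (n : ℕ) : e (β (.inr n)) = 0 := he0 _ (by simp)
  obtain ⟨a, haa, ha⟩ := β.exists_isometry (f := Sum.map Nat.succ id)
    (Sum.map_injective.2 ⟨Nat.succ_injective, Function.injective_id⟩)
  obtain ⟨b, hbb, hb⟩ := β.exists_isometry (f := Sum.map id Nat.succ)
    (Sum.map_injective.2 ⟨Function.injective_id, Nat.succ_injective⟩)
  have hf (i : ℕ ⊕ ℕ) : Sum.map Nat.succ id i ≠ .inl 0 := by cases i <;> simp
  have hg (i : ℕ ⊕ ℕ) : Sum.map id Nat.succ i ≠ .inr 0 := by cases i <;> simp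
  have hf' : ∀ j : ℕ ⊕ ℕ, j ≠ .inl 0 → ∃ i, Sum.map Nat.succ id i = j := by
    rintro ((_ | n) | n) hj
    exacts [absurd rfl hj, ⟨.inl n, rfl⟩, ⟨.inr n, rfl⟩]
  have hg' : ∀ j : ℕ ⊕ ℕ, j ≠ .inr 0 → ∃ i, Sum.map id Nat.succ i = j := by
    rintro (n | (_ | n)) hj
    exacts [⟨.inl n, rfl⟩, absurd rfl hj, ⟨.inr n, rfl⟩]
  refine ⟨e, a, b, he, haa, hbb, ?_, ?_, ?_, ?_,
    β.one_sub_mul_star_mem_finiteRankOperators_of_isometry haa ha hf hf',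
    β.one_sub_mul_star_mem_finiteRankOperators_of_isometry hbb hb hg hg',
    β.mul_star_ne_one_of_isometry ha hf, β.mul_star_ne_one_of_isometry hb hg⟩ <;>
  · refine β.continuousLinearMap_ext ?_
    rintro (n | n) <;> simp [ha, hb, hl, hr]

end ShiftPair

section Implemented

variable {A : Type*} [CStarAlgebra A] {S : NonUnitalStarSubalgebra ℂ A}
  [IsClosed (S : Set A)]

/-- The multiplier `v` of `S` is given by left and right multiplication by `w`. -/
def DoubleCentralizer.IsImplementedBy (v : 𝓜(ℂ, S)) (w : A) : Prop :=
  ∀ y : S, ((v.fst y : S) : A) = w * y ∧ ((v.snd y : S) : A) = y * w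

namespace DoubleCentralizer

theorem exists_isImplementedBy (m : A) (hl : ∀ x ∈ S, m * x ∈ S) (hr : ∀ x ∈ S, x * m ∈ S) :
    ∃ v : 𝓜(ℂ, S), v.IsImplementedBy m := by
  let L : S →L[ℂ] S := LinearMap.mkContinuous
    { toFun := fun x => ⟨m * x, hl x x.2⟩
      map_add' := fun x y => Subtype.ext (mul_add m (x : A) y)
      map_smul' := fun c x => Subtype.ext (mul_smul_comm c m (x : A)) } ‖m‖
    fun x => norm_mul_le m (x : A)
  let R : S →L[ℂ] S := LinearMap.mkContinuous
    { toFun := fun x => ⟨x * m, hr x x.2⟩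
      map_add' := fun x y => Subtype.ext (add_mul (x : A) y m)
      map_smul' := fun c x => Subtype.ext (smul_mul_assoc c (x : A) m) } ‖m‖
    fun x => (norm_mul_le (x : A) m).trans_eq (mul_comm _ _)
  exact ⟨⟨(L, R), fun x y => Subtype.ext (mul_assoc (x : A) m y)⟩, fun y => ⟨rfl, rfl⟩⟩

namespace IsImplementedBy

theorem one : (1 : 𝓜(ℂ, S)).IsImplementedBy (1 : A) :=
  fun y => ⟨(one_mul (y : A)).symm, (mul_one (y : A)).symm⟩

theorem coe (x : S) : (x : 𝓜(ℂ, S)).IsImplementedBy (x : A) := fun _ => ⟨rfl, rfl⟩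

variable {v v' : 𝓜(ℂ, S)} {w w' : A}

theorem add (h : v.IsImplementedBy w) (h' : v'.IsImplementedBy w') :
    (v + v').IsImplementedBy (w + w') := fun y =>
  ⟨(congrArg₂ (· + ·) (h y).1 (h' y).1).trans (add_mul _ _ _).symm,
    (congrArg₂ (· + ·) (h y).2 (h' y).2).trans (mul_add _ _ _).symm⟩

theorem sub (h : v.IsImplementedBy w) (h' : v'.IsImplementedBy w') :
    (v - v').IsImplementedBy (w - w') := fun y =>
  ⟨(congrArg₂ (· - ·) (h y).1 (h' y).1).trans (sub_mul _ _ _).symm,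
    (congrArg₂ (· - ·) (h y).2 (h' y).2).trans (mul_sub _ _ _).symm⟩

theorem mul (h : v.IsImplementedBy w) (h' : v'.IsImplementedBy w') :
    (v * v').IsImplementedBy (w * w') := fun y =>
  ⟨by rw [mul_fst, mul_apply_eq_comp, (h _).1, (h' _).1, mul_assoc],
    by rw [mul_snd, mul_apply_eq_comp, (h' _).2, (h _).2, mul_assoc]⟩

theorem star (h : v.IsImplementedBy w) : (star v).IsImplementedBy (Star.star w) := fun y =>
  ⟨by rw [star_fst]; exact (congrArg Star.star (h (Star.star y)).2).trans (by simp),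
    by rw [star_snd]; exact (congrArg Star.star (h (Star.star y)).1).trans (by simp)⟩

theorem unique (h : v.IsImplementedBy w) (h' : v'.IsImplementedBy w) : v = v' := by
  refine DoubleCentralizer.ext ℂ S _ _ (Prod.ext ?_ ?_) <;> ext y
  · exact (h y).1.trans (h' y).1.symm
  · exact (h y).2.trans (h' y).2.symm

theorem mul_mul_eq_zero_of_mem_extremePoints (h : v.IsImplementedBy w)
    (hv : v ∈ Set.extremePoints ℝ (Metric.closedBall (0 : 𝓜(ℂ, S)) 1)) {c : A} (hc : c ∈ S) :
    (1 - w * Star.star w) * c * (1 - Star.star w * w) = 0 := by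
  have h0 := one_sub_mul_mul_one_sub_eq_zero_of_mem_extremePoints hv
    ((⟨c, hc⟩ : S) : 𝓜(ℂ, S))
  rw [mul_coe, coe_mul] at h0
  have h1 := norm_coe (((1 - Star.star v * v).snd ((1 - v * Star.star v).fst ⟨c, hc⟩)) : S)
  rw [h0, norm_zero, eq_comm, norm_eq_zero] at h1
  have h2 := congrArg (Subtype.val) h1
  rwa [((one.sub (h.star.mul h)) _).2, ((one.sub (h.mul h.star)) _).1] at h2

end IsImplementedBy

/-- An element of `A` multiplying `S` into itself, which is unitary modulo `S` and has no
perturbation by `S` satisfying the extremality condition, defines a unitary of the corona algebra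
of `S` which does not lift to an extreme point. -/
theorem exists_unitary_corona_forall_extremePoints_ne {C : Type*} [CStarAlgebra C]
    (π : 𝓜(ℂ, S) →⋆ₐ[ℂ] C) (hπ : ∀ v, π v = 0 ↔ ∃ x : S, v = (x : 𝓜(ℂ, S))) {m : A}
    (hl : ∀ x ∈ S, m * x ∈ S) (hr : ∀ x ∈ S, x * m ∈ S) (h1 : 1 - star m * m ∈ S)
    (h2 : 1 - m * star m ∈ S)
    (hm : ∀ x ∈ S, ¬ ∀ c ∈ S,
      (1 - (m + x) * star (m + x)) * c * (1 - star (m + x) * (m + x)) = 0) :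
    ∃ u ∈ unitary C, ∀ v ∈ Set.extremePoints ℝ (Metric.closedBall (0 : 𝓜(ℂ, S)) 1), π v ≠ u := by
  obtain ⟨M, hM⟩ := exists_isImplementedBy m hl hr
  have hker {v : 𝓜(ℂ, S)} {w : A} (hv : v.IsImplementedBy w) (hw : w ∈ S) : π v = 0 :=
    (hπ v).2 ⟨⟨w, hw⟩, hv.unique (IsImplementedBy.coe ⟨w, hw⟩)⟩
  refine ⟨π M, ⟨?_, ?_⟩, fun v hv hvM => ?_⟩
  · have := hker (IsImplementedBy.one.sub (hM.star.mul hM)) h1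
    rw [map_sub, map_one, map_mul, map_star, sub_eq_zero] at this
    exact this.symm
  · have := hker (IsImplementedBy.one.sub (hM.mul hM.star)) h2
    rw [map_sub, map_one, map_mul, map_star, sub_eq_zero] at this
    exact this.symm
  · obtain ⟨x, hx⟩ := (hπ (v - M)).1 (by rw [map_sub, hvM, sub_self])
    have hvw : v.IsImplementedBy (m + x) := by
      rw [← add_sub_cancel M v, hx]
      exact hM.add (IsImplementedBy.coe x)
    exact hm x x.2 fun c hc => hvw.mul_mul_eq_zero_of_mem_extremePoints hv hc

end DoubleCentralizer

theorem Stmt15Witness.nonempty_of_subalgebra {A : Type} [CStarAlgebra A]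
    (S : NonUnitalStarSubalgebra ℂ A) [IsClosed (S : Set A)]
    (hd : Dense {g : S | IsAlgebraic ℂ (g : A)}) {m : A}
    (hl : ∀ x ∈ S, m * x ∈ S) (hr : ∀ x ∈ S, x * m ∈ S) (h1 : 1 - star m * m ∈ S)
    (h2 : 1 - m * star m ∈ S)
    (hm : ∀ x ∈ S, ¬ ∀ c ∈ S,
      (1 - (m + x) * star (m + x)) * c * (1 - star (m + x) * (m + x)) = 0) :
    Nonempty Stmt15Witness := by
  obtain ⟨C, hC, π, hsurj, hker⟩ := exists_corona S
  obtain ⟨u, hu, hlift⟩ := DoubleCentralizer.exists_unitary_corona_forall_extremePoints_ne π hker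
    hl hr h1 h2 hm
  exact ⟨⟨S, NonUnitalStarAlgHom.dense_isUnit_unitization (NonUnitalStarSubalgebraClass.subtype S)
    Subtype.val_injective hd, C, π, hsurj, hker, u, hu, hlift⟩⟩

end Implemented

section LimitCorona

open Filter Topology OnePoint

variable {E : Type*} [NormedAddCommGroup E] [InnerProductSpace ℂ E] [CompleteSpace E]

theorem single_mem_commutingLimitAlgebra (e : E →L[ℂ] E) (n : ℕ) {T : E →L[ℂ] E}
    (hT : T ∈ finiteRankOperators E) :
    ∃ c ∈ commutingLimitAlgebra e, c n = T := by
  let c : C(OnePoint ℕ, E →L[ℂ] E) := OnePoint.continuousMapMkNat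
    (fun k => if k = n then T else 0) 0
    (tendsto_const_nhds.congr' ((eventually_gt_atTop n).mono fun k hk => by simp [hk.ne']))
  have hcn (k : ℕ) : c k = if k = n then T else 0 := rfl
  have hc0 : c ∞ = 0 := rfl
  refine ⟨c, ⟨fun x => ?_, hc0 ▸ Commute.zero_left _, hc0 ▸ Commute.zero_left _⟩, by simp [hcn]⟩
  induction x using OnePoint.rec with
  | infty => exact hc0 ▸ zero_mem _
  | coe k =>
    rw [hcn]
    split_ifs
    exacts [NonUnitalStarSubalgebra.le_topologicalClosure _ hT, zero_mem _]

/-- If `1 - w * star w` and `1 - star w * w` annihilate the algebra, the limit of `w` is an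
isometry or a coisometry. -/
theorem apply_infty_eq_one_or_of_mul_commutingLimitAlgebra_mul {e : E →L[ℂ] E}
    {w : C(OnePoint ℕ, E →L[ℂ] E)}
    (h : ∀ c ∈ commutingLimitAlgebra e, (1 - w * star w) * c * (1 - star w * w) = 0) :
    star (w ∞) * w ∞ = 1 ∨ w ∞ * star (w ∞) = 1 := by
  have hn (n : ℕ) : star (w n) * w n = 1 ∨ w n * star (w n) = 1 := by
    refine (eq_zero_or_eq_zero_of_mul_finiteRankOperators_mul fun T hT => ?_).symm.imp
      (fun H => (sub_eq_zero.1 H).symm) (fun H => (sub_eq_zero.1 H).symm)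
    obtain ⟨c, hc, rfl⟩ := single_mem_commutingLimitAlgebra e n hT
    exact DFunLike.congr_fun (h c hc) (n : OnePoint ℕ)
  have hlim := (OnePoint.continuous_iff_from_nat _).1 w.continuous
  refine (Filter.frequently_or_distrib.1 (Frequently.of_forall (f := atTop) hn)).imp
    (fun H => ?_) (fun H => ?_)
  · exact (isClosed_singleton (x := (1 : E →L[ℂ] E))).mem_of_frequently_of_tendsto H
      (hlim.star.mul hlim)
  · exact (isClosed_singleton (x := (1 : E →L[ℂ] E))).mem_of_frequently_of_tendsto H
      (hlim.mul hlim.star)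

theorem const_mem_commutingLimitAlgebra {e T : E →L[ℂ] E} (he : star e = e)
    (hT : T ∈ finiteRankOperators E) (hc : Commute T e) :
    ContinuousMap.const (OnePoint ℕ) T ∈ commutingLimitAlgebra e :=
  ⟨fun _ => NonUnitalStarSubalgebra.le_topologicalClosure _ hT, hc, he.symm ▸ hc⟩

theorem IsSplitIsometryPair.nonempty_stmt15Witness {E : Type} [NormedAddCommGroup E]
    [InnerProductSpace ℂ E] [CompleteSpace E] {e a b : E →L[ℂ] E}
    (h : IsSplitIsometryPair e a b) : Nonempty Stmt15Witness := by
  have hm := h.commute_mul_star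
  have hm' : Commute (a * star b) (star e) := h.star_eq.symm ▸ hm
  have hconst (c : E →L[ℂ] E) (hc : Commute c e) (hd : 1 - c * star c ∈ finiteRankOperators E) :
      ContinuousMap.const (OnePoint ℕ) (1 - c * star c) ∈ commutingLimitAlgebra e :=
    const_mem_commutingLimitAlgebra h.star_eq hd ((Commute.one_left e).sub_left
      (hc.mul_left (by simpa [h.star_eq] using hc.star_star)))
  refine Stmt15Witness.nonempty_of_subalgebra (commutingLimitAlgebra e)
    (dense_isAlgebraic_commutingLimitAlgebra h.isStarProjection)
    (m := ContinuousMap.const (OnePoint ℕ) (a * star b))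
    (fun _ hf => ⟨fun x => mul_mem_topologicalClosure_finiteRankOperators_left _ (hf.1 x),
      hm.mul_left hf.2.1, hm'.mul_left hf.2.2⟩)
    (fun _ hf => ⟨fun x => mul_mem_topologicalClosure_finiteRankOperators_right _ (hf.1 x),
      hf.2.1.mul_left hm, hf.2.2.mul_left hm'⟩) ?_ ?_ fun x hx H => ?_
  · convert hconst b h.commute_right h.defect_right using 1
    ext1 y
    change 1 - star (a * star b) * (a * star b) = 1 - b * star b
    rw [star_mul, star_star, mul_assoc, ← mul_assoc (star a), h.star_mul_left, one_mul]
  · convert hconst a h.commute_left h.defect_left using 1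
    ext1 y
    change 1 - (a * star b) * star (a * star b) = 1 - a * star a
    rw [star_mul, star_star, mul_assoc, ← mul_assoc (star b), h.star_mul_right, one_mul]
  · have hWe : Commute (a * star b + x ∞) e := hm.add_left hx.2.1
    have hWK : a * star b + x ∞ - a * star b ∈ (finiteRankOperators E).topologicalClosure := by
      rw [add_sub_cancel_left]
      exact hx.1 ∞
    exact (apply_infty_eq_one_or_of_mul_commutingLimitAlgebra_mul H).elim
      (h.star_mul_self_ne_one hWe hWK) (h.mul_star_self_ne_one hWe hWK)

end LimitCorona

/-- There exists a C*-algebra `I` of stable rank one and a unitary `u`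
in the corona algebra `C(I) = 𝓜(ℂ, I)/I` such that no extreme point of the closed unit
ball of `𝓜(ℂ, I)` is mapped to `u` by the quotient map. -/
theorem stmt15 : Nonempty Stmt15Witness := by
  let β : HilbertBasis (ℕ ⊕ ℕ) ℂ (lp (fun _ : ℕ ⊕ ℕ => ℂ) 2) := default
  obtain ⟨e, a, b, h⟩ := β.exists_isSplitIsometryPair
  exact h.nonempty_stmt15Witness
end

section
/- There exist a C*-algebra I of stable rank one, a unital C*-algebra A containing I as a closed two-sided ideal with A/I *-isomorphic to C(𝕋), and a unitary u in A/I that does not lift to any partial isometry in A (in particular not to any unitary in A). -/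
/-- A witness for Statement 16: a C*-algebra `I` of stable rank one, a unital C*-algebra
`A` containing `I` as a closed two-sided ideal (via the isometric embedding `ι`) with
`A/I` *-isomorphic to `C(𝕋)` (realized by the surjective star homomorphism
`q : A → C(𝕋, ℂ)` with kernel the image of `I`), and a unitary `u` of `A/I ≅ C(𝕋)` which
does not lift to any partial isometry of `A`. -/
structure Stmt16Witness : Type 1 where
  /-- The C*-algebra `I`. -/
  I : Type
  [instI : NonUnitalCStarAlgebra I]
  /-- The unital C*-algebra `A` containing `I` as a closed two-sided ideal. -/
  A : Type
  [instA : CStarAlgebra A]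
  /-- `I` has stable rank one: the invertibles are dense in its minimal unitization. -/
  sr1 : Dense {x : Unitization ℂ I | IsUnit x}
  /-- The embedding of `I` into `A`. -/
  ι : I →⋆ₙₐ[ℂ] A
  isom : Isometry ι
  ideal : ∀ (a : A) (x : I), a * ι x ∈ Set.range ι ∧ ι x * a ∈ Set.range ι
  /-- The quotient map `A → A/I ≅ C(𝕋)`. -/
  q : A →⋆ₐ[ℂ] C(Circle, ℂ)
  surj : Function.Surjective q
  ker : ∀ a : A, q a = 0 ↔ a ∈ Set.range ι
  /-- The unitary of `A/I ≅ C(𝕋)` that does not lift. -/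
  u : C(Circle, ℂ)
  unit : u ∈ unitary C(Circle, ℂ)
  nolift : ¬ ∃ v : A, v * star v * v = v ∧ q v = u

open Polynomial in
theorem LinearMap.exists_polynomial_eval_eq_det {V ι : Type*} [AddCommGroup V] [Module ℂ V]
    [FiniteDimensional ℂ V] [Fintype ι] (b : ι → ℂ[X]) (l : ι → V →ₗ[ℂ] V) :
    ∃ d : ℂ[X], ∀ z : ℂ, d.eval z = LinearMap.det (1 + ∑ i, (b i).eval z • l i) := by
  classical
  let e := Module.finBasis ℂ V
  refine ⟨Matrix.det (1 + ∑ i, b i • (LinearMap.toMatrix e e (l i)).map C), fun z => ?_⟩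
  rw [← LinearMap.det_toMatrix e, ← coe_evalRingHom, RingHom.map_det]
  congr 1
  ext i j
  simp [Matrix.sum_apply, LinearMap.toMatrix_one, Matrix.one_apply, apply_ite, eval_finsetSum]

/-- The corner `q B q` of an algebra, as a subspace. -/
def cornerSubmodule {B : Type*} [Ring B] [Algebra ℂ B] (q : B) : Submodule ℂ B where
  carrier := {x | q * x * q = x}
  add_mem' {x y} hx hy := by
    simp only [Set.mem_ofPred_eq] at *
    rw [mul_add, add_mul, hx, hy]
  zero_mem' := by simp
  smul_mem' c x hx := by
    simp only [Set.mem_ofPred_eq] at *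
    rw [mul_smul_comm, smul_mul_assoc, hx]

section corner
variable {B : Type*} [Ring B] [Algebra ℂ B] {q x y : B}

theorem mem_cornerSubmodule : x ∈ cornerSubmodule q ↔ q * x * q = x := Iff.rfl

theorem mul_mul_mem_cornerSubmodule (hq : IsIdempotentElem q) (x : B) :
    q * x * q ∈ cornerSubmodule q := by
  rw [mem_cornerSubmodule]
  simp only [mul_assoc, hq.eq]
  simp only [← mul_assoc, hq.eq]

theorem left_mul_of_mem_cornerSubmodule (hq : IsIdempotentElem q) (hx : x ∈ cornerSubmodule q) :
    q * x = x := by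
  rw [mem_cornerSubmodule] at hx
  rw [← hx, ← mul_assoc, ← mul_assoc, hq.eq]

theorem right_mul_of_mem_cornerSubmodule (hq : IsIdempotentElem q) (hx : x ∈ cornerSubmodule q) :
    x * q = x := by
  rw [mem_cornerSubmodule] at hx
  rw [← hx, mul_assoc, hq.eq]

theorem mem_cornerSubmodule_of (h₁ : q * x = x) (h₂ : x * q = x) : x ∈ cornerSubmodule q := by
  rw [mem_cornerSubmodule, h₁, h₂]

theorem mul_mem_cornerSubmodule (hq : IsIdempotentElem q) (hx : x ∈ cornerSubmodule q)
    (hy : y ∈ cornerSubmodule q) : x * y ∈ cornerSubmodule q :=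
  mem_cornerSubmodule_of (by rw [← mul_assoc, left_mul_of_mem_cornerSubmodule hq hx])
    (by rw [mul_assoc, right_mul_of_mem_cornerSubmodule hq hy])

/-- Left multiplication by an element of a corner, as an endomorphism of the corner. -/
def cornerMulLeft (hq : IsIdempotentElem q) (c : cornerSubmodule q) :
    cornerSubmodule q →ₗ[ℂ] cornerSubmodule q :=
  (LinearMap.mulLeft ℂ (c : B)).restrict fun _ hx => mul_mem_cornerSubmodule hq c.2 hx

@[simp]
theorem coe_cornerMulLeft (hq : IsIdempotentElem q) (c x : cornerSubmodule q) :
    (cornerMulLeft hq c x : B) = c * x := rfl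

theorem isUnit_one_add_iff_bijective (hq : IsIdempotentElem q)
    {c : B} (hc : c ∈ cornerSubmodule q) [FiniteDimensional ℂ (cornerSubmodule q)]
    {T : cornerSubmodule q →ₗ[ℂ] cornerSubmodule q}
    (hT : ∀ x, (T x : B) = (1 + c) * x) :
    IsUnit (1 + c) ↔ IsUnit T := by
  have hcl := left_mul_of_mem_cornerSubmodule hq hc
  have hcr := right_mul_of_mem_cornerSubmodule hq hc
  rw [LinearMap.isUnit_iff_ker_eq_bot, LinearMap.ker_eq_bot]
  constructor
  · intro h x y hxy
    have h1 : (T x : B) = T y := by rw [hxy]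
    rw [hT, hT] at h1
    exact Subtype.ext (h.mul_left_cancel h1)
  · intro h
    have hqm : q ∈ cornerSubmodule q := mem_cornerSubmodule_of hq hq
    obtain ⟨⟨x, hx⟩, hxT⟩ := LinearMap.injective_iff_surjective.1 h ⟨q, hqm⟩
    have h1 : (1 + c) * x = q := by rw [← hT ⟨x, hx⟩, hxT]
    have hxl := left_mul_of_mem_cornerSubmodule hq hx
    have hxr := right_mul_of_mem_cornerSubmodule hq hx
    have hy : x * (1 + c) ∈ cornerSubmodule q := by
      rw [mul_add, mul_one]
      exact add_mem hx (mul_mem_cornerSubmodule hq hx hc)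
    have h2 : x * (1 + c) = q := by
      have : T ⟨_, hy⟩ = T ⟨q, hqm⟩ := by
        ext
        rw [hT, hT]
        simp only
        rw [← mul_assoc, h1, mul_add, add_mul, hcl, hcr, mul_one, one_mul]
      exact congrArg Subtype.val (h this)
    refine isUnit_iff_exists.2 ⟨x + (1 - q), ?_, ?_⟩
    · rw [mul_add, h1, mul_sub, mul_one, add_mul, hcr]
      noncomm_ring
    · rw [add_mul, h2, sub_mul, one_mul, mul_add, hcl]
      noncomm_ring

open Polynomial in
theorem finite_not_isUnit_one_add_sum [FiniteDimensional ℂ (cornerSubmodule q)]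
    (hq : IsIdempotentElem q) {ι : Type*} [Fintype ι] (b : ι → ℂ[X]) (c : ι → B)
    (hc : ∀ i, c i ∈ cornerSubmodule q) {z₀ : ℂ}
    (h₀ : IsUnit (1 + ∑ i, (b i).eval z₀ • c i)) :
    {z : ℂ | ¬ IsUnit (1 + ∑ i, (b i).eval z • c i)}.Finite := by
  obtain ⟨d, hd⟩ := LinearMap.exists_polynomial_eval_eq_det b
    fun i => cornerMulLeft hq ⟨c i, hc i⟩
  have key (z : ℂ) : IsUnit (1 + ∑ i, (b i).eval z • c i) ↔ d.eval z ≠ 0 := by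
    rw [hd, ← isUnit_iff_ne_zero, ← LinearMap.isUnit_iff_isUnit_det]
    refine isUnit_one_add_iff_bijective hq
      (Submodule.sum_mem _ fun i _ => Submodule.smul_mem _ _ (hc i)) fun x => ?_
    simp [add_mul, Finset.sum_mul]
  have hd0 : d ≠ 0 := by
    rintro rfl
    simpa using (key z₀).1 h₀
  simp_rw [key, not_not]
  exact (d.roots.toFinset.finite_toSet).subset fun z hz => by simpa [hd0] using hz
end corner

section path
open Polynomial
variable {B : Type*} [NormedRing B] [NormedAlgebra ℂ B] {ι : Type*} [Fintype ι]

/-- The polynomial `z ↦ ∑ i, b i (z) • c i` with values in an algebra, as a continuous map. -/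
noncomputable def polynomialCurve (b : ι → ℂ[X]) (c : ι → B) : C(ℂ, B) where
  toFun z := ∑ i, (b i).eval z • c i

theorem polynomialCurve_apply (b : ι → ℂ[X]) (c : ι → B) (z : ℂ) :
    polynomialCurve b c z = ∑ i, (b i).eval z • c i := rfl

/-- The arcs `t ↦ t + i ε t (1 - t)` from `0` to `1`, which are disjoint except at the endpoints
for distinct `ε`. -/
noncomputable def unitIntervalArcs : C(ℝ × unitInterval, ℂ) where
  toFun p := (p.2 : ℝ) + (p.1 * ((p.2 : ℝ) * (1 - (p.2 : ℝ))) : ℝ) * Complex.I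

theorem unitIntervalArcs_apply (ε : ℝ) (t : unitInterval) :
    unitIntervalArcs (ε, t) = (t : ℝ) + (ε * ((t : ℝ) * (1 - (t : ℝ))) : ℝ) * Complex.I := rfl

theorem exists_path_isUnit_one_add {q : B} [FiniteDimensional ℂ (cornerSubmodule q)]
    (hq : IsIdempotentElem q) (b : ι → ℂ[X]) (c : ι → B) (hc : ∀ i, c i ∈ cornerSubmodule q)
    (h₀ : IsUnit (1 + polynomialCurve b c 0)) (h₁ : IsUnit (1 + polynomialCurve b c 1))
    {f : C(unitInterval, B)} (hf : ∀ t : unitInterval, f t = polynomialCurve b c (t : ℝ))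
    {δ : ℝ} (hδ : 0 < δ) :
    ∃ g : C(unitInterval, B), g 0 = f 0 ∧ g 1 = f 1 ∧ (∀ t, g t ∈ cornerSubmodule q) ∧
      (∀ t, IsUnit (1 + g t)) ∧ dist g f < δ := by
  let G : C(ℝ, C(unitInterval, B)) := ((polynomialCurve b c).comp unitIntervalArcs).curry
  have hG (ε t) : G ε t = polynomialCurve b c (unitIntervalArcs (ε, t)) := rfl
  have hG0 : G 0 = f := by
    ext t
    simp [hG, hf, unitIntervalArcs_apply]
  have hfin := finite_not_isUnit_one_add_sum hq b c hc h₀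
  have hd := ((hfin.image fun z => z.im / (z.re * (1 - z.re))).countable).dense_compl ℝ
  have hopen : IsOpen {ε : ℝ | dist (G ε) f < δ} :=
    isOpen_lt (G.continuous.dist continuous_const) continuous_const
  obtain ⟨ε, hε, hεc⟩ := hd.inter_open_nonempty _ hopen ⟨0, by simpa [hG0] using hδ⟩
  refine ⟨G ε, ?_, ?_, fun t => ?_, fun t => ?_, hε⟩
  · simp [hG, hf, unitIntervalArcs_apply]
  · simp [hG, hf, unitIntervalArcs_apply]
  · exact Submodule.sum_mem _ fun i _ => Submodule.smul_mem _ _ (hc i)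
  · by_contra hu
    rcases eq_or_ne t 0 with rfl | ht0
    · apply hu
      simpa [hG, unitIntervalArcs_apply] using h₀
    rcases eq_or_ne t 1 with rfl | ht1
    · apply hu
      simpa [hG, unitIntervalArcs_apply] using h₁
    refine hεc ⟨unitIntervalArcs (ε, t), hu, ?_⟩
    have e0 : (t : ℝ) ≠ 0 := fun h => ht0 (Subtype.ext h)
    have e1 : 1 - (t : ℝ) ≠ 0 := fun h => ht1 (Subtype.ext (by simpa using (sub_eq_zero.1 h).symm))
    have hre : (unitIntervalArcs (ε, t)).re = t := by
      simp [unitIntervalArcs_apply, -Complex.ofReal_mul, -Complex.ofReal_sub]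
    have him : (unitIntervalArcs (ε, t)).im = ε * (t * (1 - t)) := by
      simp [unitIntervalArcs_apply, -Complex.ofReal_mul, -Complex.ofReal_sub]
    simp only [hre, him]
    field_simp

theorem exists_smul_isUnit_one_add {q : B} [FiniteDimensional ℂ (cornerSubmodule q)]
    (hq : IsIdempotentElem q) {x : B} (hx : x ∈ cornerSubmodule q) {U : Set ℝ} (hU : U ∈ nhds 1) :
    ∃ s ∈ U, IsUnit (1 + (s : ℂ) • x) := by
  have hfin := finite_not_isUnit_one_add_sum hq (fun _ : Unit => (X : ℂ[X])) (fun _ => x)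
    (fun _ => hx) (z₀ := 0) (by simp)
  have hfin' := hfin.preimage (Complex.ofReal_injective.injOn)
  obtain ⟨s, hs, hsU⟩ := (hfin'.countable.dense_compl ℝ).inter_nhds_nonempty hU
  exact ⟨s, hsU, by simpa using hs⟩

end path

/-- A unitary `U` (a bilateral shift) in a C*-algebra, with a projection `P` which nearly commutes
with it and an increasing sequence of projections `Q n` with finite dimensional corners, such that
no compact perturbation of `P * U * P` supported on a corner is invertible in the corner of `P`. -/
structure ShiftSystem (B : Type*) [CStarAlgebra B] where
  /-- The bilateral shift. -/
  U : B
  /-- The projection onto the positive half. -/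
  P : B
  /-- The finite rank projections. -/
  Q : ℕ → B
  U_mem : U ∈ unitary B
  isStarProjection_P : IsStarProjection P
  isStarProjection_Q : ∀ n, IsStarProjection (Q n)
  Q_mul_Q : ∀ {m n}, m ≤ n → Q n * Q m = Q m
  commute_P_Q : ∀ n, Commute P (Q n)
  Q_mul_U_mul_Q : ∀ n, Q (n + 1) * (U * Q n) = U * Q n
  Q_mul_star_U_mul_Q : ∀ n, Q (n + 1) * (star U * Q n) = star U * Q n
  commutator_mem : P * U - U * P ∈ cornerSubmodule (Q 1)
  finiteDimensional : ∀ n, FiniteDimensional ℂ (cornerSubmodule (Q n))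
  not_isUnit : ∀ n, ∀ x ∈ cornerSubmodule (Q n), ¬ IsUnit (P * (U + x) * P + (1 - P))

namespace ShiftSystem
open Filter Topology unitInterval

variable {B : Type*} [CStarAlgebra B] (D : ShiftSystem B)

theorem idem (n : ℕ) : IsIdempotentElem (D.Q n) := (D.isStarProjection_Q n).isIdempotentElem

theorem Q_mul_Q' {m n : ℕ} (h : m ≤ n) : D.Q m * D.Q n = D.Q m := by
  have := congrArg star (D.Q_mul_Q h)
  rwa [star_mul, (D.isStarProjection_Q n).isSelfAdjoint.star_eq,
    (D.isStarProjection_Q m).isSelfAdjoint.star_eq] at this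

theorem corner_mono : Monotone fun n => cornerSubmodule (D.Q n) := fun m n h x hx => by
  refine mem_cornerSubmodule_of ?_ ?_
  · rw [← left_mul_of_mem_cornerSubmodule (D.idem m) hx, ← mul_assoc, D.Q_mul_Q h]
  · rw [← right_mul_of_mem_cornerSubmodule (D.idem m) hx, mul_assoc, D.Q_mul_Q' h]

theorem star_mem_corner {n : ℕ} {x : B} (hx : x ∈ cornerSubmodule (D.Q n)) :
    star x ∈ cornerSubmodule (D.Q n) := by
  rw [mem_cornerSubmodule] at *
  have := congrArg star hx
  rwa [star_mul, star_mul, (D.isStarProjection_Q n).isSelfAdjoint.star_eq, ← mul_assoc] at this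

/-- The union of the corners of the projections `Q n`. -/
noncomputable def cornerUnion : NonUnitalStarSubalgebra ℂ B where
  carrier := {x | ∃ n, x ∈ cornerSubmodule (D.Q n)}
  add_mem' := by
    rintro x y ⟨m, hx⟩ ⟨n, hy⟩
    exact ⟨max m n, add_mem (D.corner_mono (le_max_left _ _) hx)
      (D.corner_mono (le_max_right _ _) hy)⟩
  zero_mem' := ⟨0, zero_mem _⟩
  mul_mem' := by
    rintro x y ⟨m, hx⟩ ⟨n, hy⟩
    exact ⟨max m n, mul_mem_cornerSubmodule (D.idem _) (D.corner_mono (le_max_left _ _) hx)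
      (D.corner_mono (le_max_right _ _) hy)⟩
  smul_mem' := by
    rintro c x ⟨m, hx⟩
    exact ⟨m, Submodule.smul_mem _ _ hx⟩
  star_mem' := by
    rintro x ⟨m, hx⟩
    exact ⟨m, D.star_mem_corner hx⟩

/-- The algebra of compact elements. -/
noncomputable def compacts : NonUnitalStarSubalgebra ℂ B := D.cornerUnion.topologicalClosure

theorem isClosed_compacts : IsClosed (D.compacts : Set B) := isClosed_closure

theorem mem_compacts_of_corner {n : ℕ} {x : B} (hx : x ∈ cornerSubmodule (D.Q n)) :
    x ∈ D.compacts :=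
  D.cornerUnion.le_topologicalClosure ⟨n, hx⟩

theorem norm_Q_le (n : ℕ) : ‖D.Q n‖ ≤ 1 := (D.isStarProjection_Q n).norm_le

theorem tendsto_Q_mul_mul_Q {x : B} (hx : x ∈ D.compacts) :
    Tendsto (fun n => D.Q n * x * D.Q n) atTop (𝓝 x) := by
  rw [Metric.tendsto_atTop]
  intro ε hε
  obtain ⟨y, ⟨m, hy⟩, hxy⟩ := Metric.mem_closure_iff.1 hx (ε / 2) (half_pos hε)
  refine ⟨m, fun n hn => ?_⟩
  have hy' : D.Q n * y * D.Q n = y := D.corner_mono hn hy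
  rw [dist_eq_norm] at *
  calc ‖D.Q n * x * D.Q n - x‖ = ‖D.Q n * (x - y) * D.Q n - (x - y)‖ := by
        rw [mul_sub, sub_mul, hy']; abel_nf
    _ ≤ ‖D.Q n * (x - y) * D.Q n‖ + ‖x - y‖ := norm_sub_le _ _
    _ ≤ 1 * ‖x - y‖ * 1 + ‖x - y‖ := by
        gcongr
        refine (norm_mul_le _ _).trans ?_
        gcongr
        · refine (norm_mul_le _ _).trans ?_
          gcongr
          exact D.norm_Q_le n
        · exact D.norm_Q_le n
    _ < ε := by linarith

theorem mul_mem_compacts_of {T : B} (h : ∀ n, ∃ m, D.Q m * (T * D.Q n) = T * D.Q n) {x : B}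
    (hx : x ∈ D.compacts) : T * x ∈ D.compacts := by
  refine map_mem_closure (continuous_const_mul T) hx ?_
  rintro y ⟨n, hy⟩
  obtain ⟨m, hm⟩ := h n
  have hy' := D.corner_mono (le_max_right m n) hy
  refine ⟨max m n, mem_cornerSubmodule_of ?_ ?_⟩
  · rw [← left_mul_of_mem_cornerSubmodule (D.idem n) hy, ← mul_assoc T, ← hm, ← mul_assoc,
      ← mul_assoc, D.Q_mul_Q (le_max_left m n)]
  · rw [mul_assoc, right_mul_of_mem_cornerSubmodule (D.idem _) hy']

theorem mem_compacts_mul_of {T : B} (h : ∀ n, ∃ m, D.Q m * (star T * D.Q n) = star T * D.Q n)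
    {x : B} (hx : x ∈ D.compacts) : x * T ∈ D.compacts := by
  have := star_mem (D.mul_mem_compacts_of h (star_mem hx))
  rwa [star_mul, star_star, star_star] at this

/-- The multipliers of the compact elements which commute with `P` modulo compact elements. -/
noncomputable def multipliers : StarSubalgebra ℂ B where
  carrier := {T | (∀ x ∈ D.compacts, T * x ∈ D.compacts) ∧ (∀ x ∈ D.compacts, x * T ∈ D.compacts) ∧
    D.P * T - T * D.P ∈ D.compacts}
  mul_mem' := by
    rintro S T ⟨hS₁, hS₂, hS₃⟩ ⟨hT₁, hT₂, hT₃⟩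
    refine ⟨fun x hx => ?_, fun x hx => ?_, ?_⟩
    · rw [mul_assoc]; exact hS₁ _ (hT₁ x hx)
    · rw [← mul_assoc]; exact hT₂ _ (hS₂ x hx)
    · convert! add_mem (hT₂ _ hS₃) (hS₁ _ hT₃) using 1
      noncomm_ring
  add_mem' := by
    rintro S T ⟨hS₁, hS₂, hS₃⟩ ⟨hT₁, hT₂, hT₃⟩
    refine ⟨fun x hx => ?_, fun x hx => ?_, ?_⟩
    · rw [add_mul]; exact add_mem (hS₁ x hx) (hT₁ x hx)
    · rw [mul_add]; exact add_mem (hS₂ x hx) (hT₂ x hx)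
    · convert! add_mem hS₃ hT₃ using 1
      noncomm_ring
  algebraMap_mem' c := by
    refine ⟨fun x hx => ?_, fun x hx => ?_, ?_⟩
    · rw [← Algebra.smul_def]; exact SMulMemClass.smul_mem c hx
    · rw [← Algebra.commutes, ← Algebra.smul_def]; exact SMulMemClass.smul_mem c hx
    · rw [← Algebra.commutes, sub_self]; exact zero_mem _
  star_mem' := by
    rintro T ⟨hT₁, hT₂, hT₃⟩
    refine ⟨fun x hx => ?_, fun x hx => ?_, ?_⟩
    · simpa using star_mem (hT₂ _ (star_mem hx))
    · simpa using star_mem (hT₁ _ (star_mem hx))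
    · have := neg_mem (star_mem hT₃)
      rwa [star_sub, star_mul, star_mul, D.isStarProjection_P.isSelfAdjoint.star_eq,
        neg_sub] at this

theorem isClosed_multipliers : IsClosed (D.multipliers : Set B) := by
  have e : (D.multipliers : Set B) = (⋂ x ∈ D.compacts, (fun T => T * x) ⁻¹' D.compacts) ∩
      ((⋂ x ∈ D.compacts, (fun T => x * T) ⁻¹' D.compacts) ∩
        (fun T => D.P * T - T * D.P) ⁻¹' D.compacts) := by
    ext T
    simp [multipliers]
  rw [e]
  have hc := D.isClosed_compacts
  refine (isClosed_biInter fun x _ => hc.preimage (by fun_prop)).inter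
    ((isClosed_biInter fun x _ => hc.preimage (by fun_prop)).inter (hc.preimage (by fun_prop)))

theorem U_mem_multipliers : D.U ∈ D.multipliers :=
  ⟨fun _ => D.mul_mem_compacts_of fun n => ⟨n + 1, D.Q_mul_U_mul_Q n⟩,
    fun _ => D.mem_compacts_mul_of fun n => ⟨n + 1, D.Q_mul_star_U_mul_Q n⟩,
    D.mem_compacts_of_corner D.commutator_mem⟩

theorem P_mem_multipliers : D.P ∈ D.multipliers := by
  have h (n : ℕ) : D.Q n * (D.P * D.Q n) = D.P * D.Q n := by
    rw [(D.commute_P_Q n).eq, ← mul_assoc, (D.idem n).eq]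
  refine ⟨fun _ => D.mul_mem_compacts_of fun n => ⟨n, h n⟩,
    fun _ => D.mem_compacts_mul_of fun n => ⟨n, ?_⟩, by simp⟩
  rw [D.isStarProjection_P.isSelfAdjoint.star_eq, h n]

/-- The representation of `C(𝕋)` sending the coordinate to `U`. -/
noncomputable def rep : C(Circle, ℂ) →⋆ₐ[ℂ] B :=
  haveI : IsStarNormal D.U := isStarNormal_of_mem_unitary D.U_mem
  (cfcHom (R := ℂ) (a := D.U) this).comp <| ContinuousMap.compStarAlgHom' ℂ ℂ
    ⟨fun z => ⟨z.1, spectrum.subset_circle_of_unitary D.U_mem z.2⟩, by fun_prop⟩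

theorem rep_coe : D.rep ⟨fun z => (z : ℂ), by fun_prop⟩ = D.U := by
  have : IsStarNormal D.U := isStarNormal_of_mem_unitary D.U_mem
  exact cfcHom_id (R := ℂ) this

theorem continuous_rep : Continuous D.rep := by
  have : IsStarNormal D.U := isStarNormal_of_mem_unitary D.U_mem
  exact (cfcHom_continuous (R := ℂ) this).comp (ContinuousMap.continuous_precomp _)

theorem rep_mem_multipliers (g : C(Circle, ℂ)) : D.rep g ∈ D.multipliers := by
  have : IsStarNormal D.U := isStarNormal_of_mem_unitary D.U_mem
  exact StarAlgebra.elemental.le_of_mem D.isClosed_multipliers D.U_mem_multipliers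
    (cfcHom_mem_elemental this _)

theorem not_isUnit_of_commute {v : B} (hv : IsUnit v) (hP : Commute D.P v)
    (hc : v - D.U ∈ D.compacts) : False := by
  have hPP : D.P * D.P = D.P := D.isStarProjection_P.isIdempotentElem
  have hlim : Tendsto (fun n => D.P * (D.U + D.Q n * (v - D.U) * D.Q n) * D.P + (1 - D.P)) atTop
      (𝓝 (D.P * (D.U + (v - D.U)) * D.P + (1 - D.P))) :=
    (((D.tendsto_Q_mul_mul_Q hc).const_add D.U).const_mul D.P |>.mul_const D.P).add_const _
  have hunit : IsUnit (D.P * (D.U + (v - D.U)) * D.P + (1 - D.P)) := by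
    obtain ⟨v, rfl⟩ := hv
    have hPi : D.P * (↑v⁻¹ : B) = ↑v⁻¹ * D.P := hP.units_inv_right
    rw [add_sub_cancel, hP.eq, mul_assoc, hPP]
    have hPv : D.P * (v : B) = v * D.P := hP
    refine isUnit_iff_exists.2 ⟨↑v⁻¹ * D.P + (1 - D.P), ?_, ?_⟩
    · have : (v : B) * D.P * (↑v⁻¹ * D.P) = D.P := by
        rw [← hPv, mul_assoc, v.mul_inv_cancel_left, hPP]
      calc _ = (v : B) * D.P * (↑v⁻¹ * D.P) + v * (D.P - D.P * D.P)
            + (↑v⁻¹ * D.P - D.P * (↑v⁻¹ * D.P)) + (1 - D.P - D.P + D.P * D.P) := by noncomm_ring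
        _ = 1 := by rw [this, ← mul_assoc D.P, hPi, mul_assoc, hPP, sub_self, mul_zero]; abel
    · have : (↑v⁻¹ : B) * D.P * (v * D.P) = D.P := by
        rw [← hPi, mul_assoc, v.inv_mul_cancel_left, hPP]
      calc _ = (↑v⁻¹ : B) * D.P * (v * D.P) + ↑v⁻¹ * (D.P - D.P * D.P)
            + (v * D.P - D.P * (v * D.P)) + (1 - D.P - D.P + D.P * D.P) := by noncomm_ring
        _ = 1 := by rw [this, ← mul_assoc D.P, hPv, mul_assoc, hPP, sub_self, mul_zero]; abel
  obtain ⟨n, hn⟩ := (hlim.eventually (Units.isOpen.mem_nhds hunit)).exists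
  exact D.not_isUnit n _ (mul_mul_mem_cornerSubmodule (D.idem n) _) hn

end ShiftSystem

theorem Unitization.isUnit_one_add_inr {R : Type*} [NonUnitalRing R] [Module ℂ R]
    [IsScalarTower ℂ R R] [SMulCommClass ℂ R R] {g h : R} (h₁ : g + h + g * h = 0)
    (h₂ : g + h + h * g = 0) : IsUnit (1 + (g : Unitization ℂ R)) := by
  refine isUnit_iff_exists.2 ⟨1 + h, ?_, ?_⟩
  · calc (1 + (g : Unitization ℂ R)) * (1 + h) = 1 + ((g + h + g * h : R) : Unitization ℂ R) := by
          simp only [Unitization.inr_add, Unitization.inr_mul]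
          noncomm_ring
      _ = 1 := by rw [h₁]; simp
  · calc (1 + (h : Unitization ℂ R)) * (1 + g) = 1 + ((g + h + h * g : R) : Unitization ℂ R) := by
          simp only [Unitization.inr_add, Unitization.inr_mul]
          noncomm_ring
      _ = 1 := by rw [h₂]; simp

theorem Unitization.dense_isUnit_of_quasiregular {R : Type*} [NonUnitalCStarAlgebra R]
    (H : ∀ f : R, ∀ ε > 0, ∃ g, dist g f < ε ∧ ∃ h, g + h + g * h = 0 ∧ g + h + h * g = 0) :
    Dense {x : Unitization ℂ R | IsUnit x} := by
  let Φ : ℂ × R → Unitization ℂ R := fun p => algebraMap ℂ _ p.1 + (p.2 : Unitization ℂ R)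
  have hΦ : Continuous Φ :=
    ((continuous_algebraMap ℂ _).comp continuous_fst).add
      (Unitization.continuous_inr.comp continuous_snd)
  have hsurj : Function.Surjective Φ := fun x => ⟨(x.fst, x.snd), by
    ext <;> simp [Φ, Unitization.algebraMap_eq_inl]⟩
  have hd : Dense {p : ℂ × R | IsUnit (Φ p)} := by
    rw [Metric.dense_iff]
    rintro ⟨z, f⟩ ε hε
    obtain ⟨w, hw, hw0⟩ := Metric.dense_iff.1 (dense_compl_singleton (0 : ℂ)) z ε hε
    have hw0 : w ≠ 0 := hw0
    obtain ⟨g, hg, h, h₁, h₂⟩ := H (w⁻¹ • f) (ε / ‖w‖) (by positivity)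
    refine ⟨(w, w • g), ?_, ?_⟩
    · rw [Metric.mem_ball, Prod.dist_eq, max_lt_iff]
      refine ⟨hw, ?_⟩
      have : dist (w • g) (w • w⁻¹ • f) < ε := by
        rw [dist_smul₀]
        rwa [lt_div_iff₀' (by positivity)] at hg
      rwa [smul_inv_smul₀ hw0] at this
    · have e : Φ (w, w • g) = algebraMap ℂ _ w * (1 + (g : Unitization ℂ R)) := by
        simp [Φ, mul_add, Algebra.algebraMap_eq_smul_one]
      change IsUnit (Φ (w, w • g))
      rw [e]
      exact ((isUnit_iff_ne_zero.2 hw0).map (algebraMap ℂ (Unitization ℂ R))).mul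
        (Unitization.isUnit_one_add_inr h₁ h₂)
  exact (hsurj.denseRange.dense_image hΦ hd).mono (by rintro _ ⟨p, hp, rfl⟩; exact hp)

namespace ShiftSystem
open Filter Topology unitInterval

variable {B : Type*} [CStarAlgebra B] (D : ShiftSystem B)

/-- Paths of compact elements which commute with `P` at the start and vanish at the end. -/
noncomputable def pathIdeal : NonUnitalStarSubalgebra ℂ C(I, B) where
  carrier := {f | (∀ t, f t ∈ D.compacts) ∧ f 1 = 0 ∧ Commute D.P (f 0)}
  mul_mem' := by
    rintro f g ⟨hf, hf₁, hf₀⟩ ⟨hg, hg₁, hg₀⟩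
    exact ⟨fun t => mul_mem (hf t) (hg t), by simp [hf₁], hf₀.mul_right hg₀⟩
  add_mem' := by
    rintro f g ⟨hf, hf₁, hf₀⟩ ⟨hg, hg₁, hg₀⟩
    exact ⟨fun t => add_mem (hf t) (hg t), by simp [hf₁, hg₁], hf₀.add_right hg₀⟩
  zero_mem' := ⟨fun t => zero_mem _, rfl, Commute.zero_right _⟩
  smul_mem' := by
    rintro c f ⟨hf, hf₁, hf₀⟩
    exact ⟨fun t => SMulMemClass.smul_mem c (hf t), by simp [hf₁], hf₀.smul_right c⟩
  star_mem' := by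
    rintro f ⟨hf, hf₁, hf₀⟩
    refine ⟨fun t => star_mem (hf t), by simp [hf₁], ?_⟩
    have := hf₀.star_star
    rwa [D.isStarProjection_P.isSelfAdjoint.star_eq] at this

theorem mem_pathIdeal {f : C(I, B)} :
    f ∈ D.pathIdeal ↔ (∀ t, f t ∈ D.compacts) ∧ f 1 = 0 ∧ Commute D.P (f 0) := Iff.rfl

/-- Pairs of a function `g` on the circle and a path of compact perturbations of `D.rep g`,
which commutes with `P` at the start and equals `D.rep g` at the end. -/
noncomputable def pathAlgebra : StarSubalgebra ℂ (C(I, B) × C(Circle, ℂ)) where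
  carrier := {p | (∀ t, p.1 t - D.rep p.2 ∈ D.compacts) ∧ p.1 1 = D.rep p.2 ∧ Commute D.P (p.1 0)}
  mul_mem' := by
    rintro ⟨f, a⟩ ⟨g, b⟩ ⟨hf, hf₁, hf₀⟩ ⟨hg, hg₁, hg₀⟩
    refine ⟨fun t => ?_, by simp_all, hf₀.mul_right hg₀⟩
    have h : (f * g) t - D.rep (a * b) = (f t - D.rep a) * (g t - D.rep b)
        + ((f t - D.rep a) * D.rep b + D.rep a * (g t - D.rep b)) := by
      rw [map_mul, ContinuousMap.mul_apply]
      noncomm_ring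
    exact h ▸ add_mem (mul_mem (hf t) (hg t)) (add_mem ((D.rep_mem_multipliers b).2.1 _ (hf t))
      ((D.rep_mem_multipliers a).1 _ (hg t)))
  add_mem' := by
    rintro ⟨f, a⟩ ⟨g, b⟩ ⟨hf, hf₁, hf₀⟩ ⟨hg, hg₁, hg₀⟩
    refine ⟨fun t => ?_, by simp_all, hf₀.add_right hg₀⟩
    have h : (f + g) t - D.rep (a + b) = (f t - D.rep a) + (g t - D.rep b) := by
      rw [map_add, ContinuousMap.add_apply]
      abel
    exact h ▸ add_mem (hf t) (hg t)
  algebraMap_mem' c := by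
    have h (t : I) : (algebraMap ℂ C(I, B) c) t = D.rep (algebraMap ℂ C(Circle, ℂ) c) := by
      rw [AlgHomClass.commutes]; rfl
    refine ⟨fun t => ?_, h 1, Algebra.commutes c D.P |>.symm⟩
    have := h t
    simp only [Prod.algebraMap_apply] at this ⊢
    rw [this, sub_self]
    exact zero_mem _
  star_mem' := by
    rintro ⟨f, a⟩ ⟨hf, hf₁, hf₀⟩
    refine ⟨fun t => ?_, ?_, ?_⟩
    · simpa [map_star] using star_mem (hf t)
    · simp_all [map_star]
    · have := hf₀.star_star
      rwa [D.isStarProjection_P.isSelfAdjoint.star_eq] at this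

theorem mem_pathAlgebra {p : C(I, B) × C(Circle, ℂ)} :
    p ∈ D.pathAlgebra ↔ (∀ t, p.1 t - D.rep p.2 ∈ D.compacts) ∧ p.1 1 = D.rep p.2 ∧
      Commute D.P (p.1 0) := Iff.rfl

theorem isClosed_pathIdeal : IsClosed (D.pathIdeal : Set C(I, B)) := by
  have hc (t : I) : Continuous fun f : C(I, B) => f t := by fun_prop
  have e : (D.pathIdeal : Set C(I, B)) = (⋂ t, (fun f => f t) ⁻¹' D.compacts) ∩
      ({f | f 1 = 0} ∩ {f | D.P * f 0 = f 0 * D.P}) := by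
    ext f
    simp [mem_pathIdeal, Commute, SemiconjBy]
  rw [e]
  exact (isClosed_iInter fun t => D.isClosed_compacts.preimage (hc t)).inter
    ((isClosed_eq (hc 1) continuous_const).inter (isClosed_eq (by fun_prop) (by fun_prop)))

theorem isClosed_pathAlgebra : IsClosed (D.pathAlgebra : Set (C(I, B) × C(Circle, ℂ))) := by
  have hc (t : I) : Continuous fun p : C(I, B) × C(Circle, ℂ) => p.1 t := by fun_prop
  have hr : Continuous fun p : C(I, B) × C(Circle, ℂ) => D.rep p.2 :=
    D.continuous_rep.comp continuous_snd
  have e : (D.pathAlgebra : Set (C(I, B) × C(Circle, ℂ))) =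
      (⋂ t, (fun p => p.1 t - D.rep p.2) ⁻¹' D.compacts) ∩
      ({p | p.1 1 = D.rep p.2} ∩ {p | D.P * p.1 0 = p.1 0 * D.P}) := by
    ext f
    simp [mem_pathAlgebra, Commute, SemiconjBy]
  rw [e]
  exact (isClosed_iInter fun t => D.isClosed_compacts.preimage ((hc t).sub hr)).inter
    ((isClosed_eq (hc 1) hr).inter (isClosed_eq (by fun_prop) (by fun_prop)))

noncomputable instance : NonUnitalCStarAlgebra D.pathIdeal :=
  NonUnitalStarSubalgebra.nonUnitalCStarAlgebra _ (h_closed := D.isClosed_pathIdeal)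

noncomputable instance : CStarAlgebra D.pathAlgebra :=
  StarSubalgebra.cstarAlgebra _ (h_closed := D.isClosed_pathAlgebra)

theorem exists_quasiregular_near {f : C(I, B)} (hf : f ∈ D.pathIdeal) {ε : ℝ} (hε : 0 < ε) :
    ∃ g ∈ D.pathIdeal, dist g f < ε ∧ ∃ h ∈ D.pathIdeal, g + h + g * h = 0 ∧ g + h + h * g = 0 := by
  obtain ⟨hf, hf₁, hf₀⟩ := hf
  have hε4 : 0 < ε / 4 := by positivity
  obtain ⟨N, hN, hN0⟩ := ((Metric.tendsto_nhds.1 (bernsteinApproximation_uniform f) _ hε4).and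
    (eventually_ne_atTop 0)).exists
  obtain ⟨n, hn⟩ : ∃ n, ∀ k : Fin (N + 1),
      dist (D.Q n * f (bernstein.z k) * D.Q n) (f (bernstein.z k)) < ε / 4 :=
    (eventually_all.2 fun k : Fin (N + 1) =>
      Metric.tendsto_nhds.1 (D.tendsto_Q_mul_mul_Q (hf (bernstein.z k))) _ hε4).exists
  let fQ : C(I, B) := .const I (D.Q n) * f * .const I (D.Q n)
  have hfQ (t) : fQ t = D.Q n * f t * D.Q n := rfl
  have hfQc (t) : fQ t ∈ cornerSubmodule (D.Q n) := mul_mul_mem_cornerSubmodule (D.idem n) _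
  let p := bernsteinApproximation N fQ
  have hp : dist p (bernsteinApproximation N f) ≤ ε / 4 := by
    rw [ContinuousMap.dist_le hε4.le]
    intro t
    rw [dist_eq_norm, bernsteinApproximation.apply, bernsteinApproximation.apply,
      ← Finset.sum_sub_distrib]
    refine (norm_sum_le _ _).trans ?_
    calc _ ≤ ∑ k : Fin (N + 1), bernstein N k t * (ε / 4) := by
          gcongr with k
          rw [← smul_sub, norm_smul, Real.norm_of_nonneg bernstein_nonneg]
          gcongr
          rw [← dist_eq_norm]
          exact (hn k).le
      _ = ε / 4 := by rw [← Finset.sum_mul, bernstein.probability, one_mul]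
  have : FiniteDimensional ℂ (cornerSubmodule (D.Q n)) := D.finiteDimensional n
  have hs : ∀ᶠ s : ℝ in 𝓝 1, dist ((s : ℂ) • p) p < ε / 4 := by
    have : Tendsto (fun s : ℝ => (s : ℂ) • p) (𝓝 1) (𝓝 (((1 : ℝ) : ℂ) • p)) :=
      Continuous.tendsto (by fun_prop) 1
    rw [Complex.ofReal_one, one_smul] at this
    exact Metric.tendsto_nhds.1 this _ hε4
  obtain ⟨s, hs, hsu⟩ := exists_smul_isUnit_one_add (D.idem n) (hfQc 0) hs
  let b (k : Fin (N + 1)) := bernsteinPolynomial ℂ N k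
  let c (k : Fin (N + 1)) := (s : ℂ) • fQ (bernstein.z k)
  have hcurve (t : I) : ((s : ℂ) • p) t = polynomialCurve b c (t : ℝ) := by
    rw [ContinuousMap.smul_apply, bernsteinApproximation.apply, polynomialCurve_apply,
      Finset.smul_sum]
    refine Finset.sum_congr rfl fun k _ => ?_
    have : (b k).eval ((t : ℝ) : ℂ) = (bernstein N k t : ℝ) := by
      simp [b, bernsteinPolynomial, bernstein_apply]
    rw [this, smul_comm (s : ℂ)]
    exact (Complex.coe_smul _ _).symm
  have hp₀ : ((s : ℂ) • p) 0 = (s : ℂ) • fQ 0 := by simp [p]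
  have hp₁ : ((s : ℂ) • p) 1 = 0 := by simp [p, hN0, hfQ, hf₁]
  have hu₁ : IsUnit (1 + polynomialCurve b c 1) := by
    have := (hcurve 1).symm.trans hp₁
    rw [Set.Icc.coe_one, Complex.ofReal_one] at this
    rw [this, add_zero]
    exact isUnit_one
  obtain ⟨g, hg₀, hg₁, hgc, hgu, hgd⟩ := exists_path_isUnit_one_add (D.idem n) b c
    (fun k => Submodule.smul_mem _ _ (hfQc _))
    (by simpa using (hcurve 0) ▸ hp₀ ▸ hsu) hu₁ hcurve hε4
  rw [hp₀] at hg₀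
  rw [hp₁] at hg₁
  have hPg : Commute D.P (g 0) := by
    rw [hg₀]
    exact (((D.commute_P_Q n).mul_right hf₀).mul_right (D.commute_P_Q n)).smul_right _
  refine ⟨g, ⟨fun t => D.mem_compacts_of_corner (hgc t), hg₁, hPg⟩, ?_, ?_⟩
  · calc dist g f ≤ dist g ((s : ℂ) • p) + dist ((s : ℂ) • p) p
          + dist p (bernsteinApproximation N f) + dist (bernsteinApproximation N f) f := by
          linarith [dist_triangle g ((s : ℂ) • p) f, dist_triangle ((s : ℂ) • p) p f,
            dist_triangle p (bernsteinApproximation N f) f]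
      _ < ε := by have hs' : dist ((s : ℂ) • p) p < ε / 4 := hs; linarith
  · obtain ⟨w, hw₁, hw₂⟩ := isUnit_iff_exists.1
      ((ContinuousMap.isUnit_iff_forall_isUnit (1 + g)).2 hgu)
    have hw₁ : (1 + g) * w = 1 := hw₁
    have hw₂ : w * (1 + g) = 1 := hw₂
    have h₁ : w - 1 = -(g * w) := by rw [← hw₁]; noncomm_ring
    have h₂ : w - 1 = -(w * g) := by rw [← hw₂]; noncomm_ring
    refine ⟨w - 1, ⟨fun t => D.mem_compacts_of_corner (n := n) (mem_cornerSubmodule_of ?_ ?_), ?_,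
      ?_⟩, ?_, ?_⟩
    · rw [h₁, ContinuousMap.neg_apply, ContinuousMap.mul_apply, mul_neg, ← mul_assoc,
        left_mul_of_mem_cornerSubmodule (D.idem n) (hgc t)]
    · rw [h₂, ContinuousMap.neg_apply, ContinuousMap.mul_apply, neg_mul, mul_assoc,
        right_mul_of_mem_cornerSubmodule (D.idem n) (hgc t)]
    · rw [h₁, ContinuousMap.neg_apply, ContinuousMap.mul_apply, hg₁, zero_mul, neg_zero]
    · have e₁ : (1 + g 0) * w 0 = 1 := DFunLike.congr_fun hw₁ 0
      have e₂ : w 0 * (1 + g 0) = 1 := DFunLike.congr_fun hw₂ 0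
      have := Commute.units_inv_right (u := ⟨1 + g 0, w 0, e₁, e₂⟩)
        ((Commute.one_right D.P).add_right hPg)
      exact Commute.sub_right this (Commute.one_right _)
    · calc
        g + (w - 1) + g * (w - 1) = (1 + g) * w - 1 := by
          rw [mul_sub, mul_one, add_mul, one_mul]
          abel
        _ = 0 := by rw [hw₁, sub_self]
    · calc
        g + (w - 1) + (w - 1) * g = w * (1 + g) - 1 := by
          rw [sub_mul, one_mul, mul_add, mul_one]
          abel
        _ = 0 := by rw [hw₂, sub_self]

theorem dense_isUnit_unitization_pathIdeal :
    Dense {x : Unitization ℂ D.pathIdeal | IsUnit x} :=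
  Unitization.dense_isUnit_of_quasiregular fun f ε hε => by
    obtain ⟨g, hg, hgf, h, hh, h₁, h₂⟩ := D.exists_quasiregular_near f.2 hε
    exact ⟨⟨g, hg⟩, hgf, ⟨h, hh⟩, Subtype.ext h₁, Subtype.ext h₂⟩

end ShiftSystem

theorem IsStarProjection.eq_zero_of_norm_lt_one {B : Type*} [CStarAlgebra B] {e : B}
    (he : IsStarProjection e) (h : ‖e‖ < 1) : e = 0 := by
  have h₁ : ‖e‖ = ‖e‖ * ‖e‖ := by
    rw [← CStarRing.norm_star_mul_self, he.isSelfAdjoint.star_eq, he.isIdempotentElem.eq]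
  rw [← norm_eq_zero]
  nlinarith [norm_nonneg e]

theorem eq_zero_of_isStarProjection_path {B : Type*} [CStarAlgebra B] {e : unitInterval → B}
    (hc : Continuous e) (he : ∀ t, IsStarProjection (e t)) (h₁ : e 1 = 0) (t : unitInterval) :
    e t = 0 := by
  have h : IsClopen {t | e t = 0} := by
    refine ⟨isClosed_eq hc continuous_const, ?_⟩
    have : {t | e t = 0} = {t | ‖e t‖ < 1} := by
      ext t
      exact ⟨fun h => by simp [show e t = 0 from h], (he t).eq_zero_of_norm_lt_one⟩
    rw [this]
    exact isOpen_lt hc.norm continuous_const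
  have := h.eq_univ ⟨1, h₁⟩
  exact (this ▸ Set.mem_univ t : t ∈ {t | e t = 0})

theorem isStarProjection_one_sub_star_mul_self {B : Type*} [Ring B] [StarRing B] {v : B}
    (hv : v * star v * v = v) : IsStarProjection (1 - star v * v) := by
  refine ⟨?_, by simp [IsSelfAdjoint]⟩
  have : star v * v * (star v * v) = star v * v := by
    rw [mul_assoc, ← mul_assoc v, hv]
  rw [IsIdempotentElem, mul_sub, sub_mul, sub_mul, this]
  simp

namespace ShiftSystem
open Filter Topology unitInterval

variable {B : Type*} [CStarAlgebra B] (D : ShiftSystem B)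

theorem star_mul_self_of_path {f : C(I, B)} (hf : ∀ t, f t * star (f t) * f t = f t)
    (h₁ : f 1 ∈ unitary B) (t : I) : star (f t) * f t = 1 := by
  have := eq_zero_of_isStarProjection_path (e := fun t => 1 - star (f t) * f t) (by fun_prop)
    (fun t => isStarProjection_one_sub_star_mul_self (hf t))
    (by simp [Unitary.star_mul_self_of_mem h₁]) t
  exact (sub_eq_zero.1 this).symm

theorem mem_unitary_of_path {f : C(I, B)} (hf : ∀ t, f t * star (f t) * f t = f t)
    (h₁ : f 1 ∈ unitary B) (t : I) : f t ∈ unitary B := by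
  refine Unitary.mem_iff.2 ⟨star_mul_self_of_path hf h₁ t, ?_⟩
  have := star_mul_self_of_path (f := star f) (fun t => ?_) (Unitary.star_mem h₁) t
  · simpa using this
  · simpa [mul_assoc] using congrArg star (hf t)

theorem path_isometry_not_lift {f : C(I, B)} {a : C(Circle, ℂ)} (h : (f, a) ∈ D.pathAlgebra)
    (hf : f * star f * f = f) (ha : D.rep a = D.U) : False := by
  obtain ⟨h₁, h₂, h₃⟩ := D.mem_pathAlgebra.1 h
  have hu := mem_unitary_of_path (fun t => DFunLike.congr_fun hf t) (h₂ ▸ ha ▸ D.U_mem) 0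
  exact D.not_isUnit_of_commute (Unitary.isUnit_coe (U := ⟨_, hu⟩)) h₃ (ha ▸ h₁ 0)

/-- The inclusion of the ideal. -/
noncomputable def inclusion : D.pathIdeal →⋆ₙₐ[ℂ] D.pathAlgebra where
  toFun f := ⟨((f : C(I, B)), 0), by
    obtain ⟨h₁, h₂, h₃⟩ := f.2
    exact ⟨fun t => by simpa using h₁ t, by simpa using h₂, h₃⟩⟩
  map_smul' c f := by ext <;> simp
  map_zero' := rfl
  map_add' f g := by ext <;> simp
  map_mul' f g := by ext <;> simp
  map_star' f := by ext <;> simp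

@[simp]
theorem coe_inclusion (f : D.pathIdeal) :
    (D.inclusion f : C(I, B) × C(Circle, ℂ)) = ((f : C(I, B)), 0) := rfl

theorem isometry_inclusion : Isometry D.inclusion := by
  refine Isometry.of_dist_eq fun f g => ?_
  rw [Subtype.dist_eq, Subtype.dist_eq, Prod.dist_eq]
  simp

/-- The quotient map, with kernel `D.pathIdeal`. -/
noncomputable def quotientMap : D.pathAlgebra →⋆ₐ[ℂ] C(Circle, ℂ) :=
  (StarAlgHom.snd ℂ C(I, B) C(Circle, ℂ)).comp D.pathAlgebra.subtype

theorem quotientMap_apply (p : D.pathAlgebra) :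
    D.quotientMap p = (p : C(I, B) × C(Circle, ℂ)).2 := rfl

theorem quotientMap_eq_zero_iff (p : D.pathAlgebra) :
    D.quotientMap p = 0 ↔ p ∈ Set.range D.inclusion := by
  constructor
  · obtain ⟨⟨f, a⟩, h₁, h₂, h₃⟩ := p
    rintro rfl
    exact ⟨⟨f, fun t => by simpa [quotientMap_apply] using h₁ t,
      by simpa [quotientMap_apply] using h₂, h₃⟩, rfl⟩
  · rintro ⟨f, rfl⟩
    rfl

theorem quotientMap_surjective : Function.Surjective D.quotientMap := by
  intro a
  have hPP : D.P * D.P = D.P := D.isStarProjection_P.isIdempotentElem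
  obtain ⟨-, -, hc⟩ := D.rep_mem_multipliers a
  obtain ⟨hPl, hPr, -⟩ := D.P_mem_multipliers
  set T := D.rep a with hT
  let k := (D.P * T - T * D.P) * D.P - (D.P * T - T * D.P) * (1 - D.P)
  have hk : k ∈ D.compacts := by
    have := sub_mem (hPr _ hc) (sub_mem hc (hPr _ hc))
    rwa [show (D.P * T - T * D.P) - (D.P * T - T * D.P) * D.P
      = (D.P * T - T * D.P) * (1 - D.P) by noncomm_ring] at this
  let f : C(I, B) := ⟨fun t => T + ((1 - (t : ℝ) : ℝ) : ℂ) • k, by fun_prop⟩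
  refine ⟨⟨(f, a), fun t => ?_, by simp [f, hT], ?_⟩, rfl⟩
  · simpa [f, hT] using SMulMemClass.smul_mem ((1 - (t : ℝ) : ℝ) : ℂ) hk
  · have e : f 0 = D.P * T * D.P + (1 - D.P) * T * (1 - D.P) := by
      have h₁ : f 0 = T + k := by simp [f]
      rw [h₁]
      calc T + k = D.P * T * D.P + (1 - D.P) * T * (1 - D.P)
            + (D.P * T * D.P - D.P * T * D.P) + 2 • (T * D.P - T * (D.P * D.P)) := by
            simp only [k]; noncomm_ring
        _ = _ := by rw [hPP]; simp
    have h₁ : Commute D.P (D.P * T * D.P) := by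
      rw [Commute, SemiconjBy, mul_assoc _ D.P D.P, hPP, ← mul_assoc, ← mul_assoc, hPP]
    have h₂ : Commute D.P ((1 - D.P) * T * (1 - D.P)) := by
      have e₁ : D.P * (1 - D.P) = 0 := by rw [mul_sub, hPP, mul_one, sub_self]
      have e₂ : (1 - D.P) * D.P = 0 := by rw [sub_mul, hPP, one_mul, sub_self]
      rw [Commute, SemiconjBy, mul_assoc _ (1 - D.P) D.P, e₂, ← mul_assoc, ← mul_assoc, e₁]
      simp
    exact e ▸ h₁.add_right h₂

end ShiftSystem

/-- The extension of `C(𝕋)` by `D.pathIdeal` associated with a shift system. -/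
noncomputable def ShiftSystem.witness {B : Type} [CStarAlgebra B] (D : ShiftSystem B) :
    Stmt16Witness where
  I := D.pathIdeal
  A := D.pathAlgebra
  sr1 := D.dense_isUnit_unitization_pathIdeal
  ι := D.inclusion
  isom := D.isometry_inclusion
  ideal a x := by
    have h : D.quotientMap (D.inclusion x) = 0 := (D.quotientMap_eq_zero_iff _).2 ⟨x, rfl⟩
    constructor <;> rw [← D.quotientMap_eq_zero_iff, map_mul, h] <;> simp
  q := D.quotientMap
  surj := D.quotientMap_surjective
  ker := D.quotientMap_eq_zero_iff
  u := ⟨fun z => (z : ℂ), by fun_prop⟩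
  unit := by
    rw [Unitary.mem_iff]
    have h (z : Circle) : starRingEnd ℂ (z : ℂ) * z = 1 := by
      rw [← Complex.normSq_eq_conj_mul_self]
      simp
    exact ⟨ContinuousMap.ext h, ContinuousMap.ext fun z => (mul_comm _ _).trans (h z)⟩
  nolift := by
    rintro ⟨⟨⟨f, a⟩, h⟩, hv, rfl⟩
    exact D.path_isometry_not_lift h (congrArg (fun x => x.1.1) hv) D.rep_coe
theorem finiteDimensional_cornerSubmodule_of_range {H : Type*} [NormedAddCommGroup H]
    [NormedSpace ℂ H] (q : H →L[ℂ] H) (hq : IsIdempotentElem q)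
    [FiniteDimensional ℂ q.range] :
    FiniteDimensional ℂ (cornerSubmodule q) := by
  let Φ : (q.range →ₗ[ℂ] q.range) →ₗ[ℂ] H →L[ℂ] H :=
    { toFun g := q.range.subtypeL ∘L LinearMap.toContinuousLinearMap g ∘L
        q.codRestrict q.range (LinearMap.mem_range_self q.toLinearMap)
      map_add' g h := by ext; simp
      map_smul' c g := by ext; simp }
  refine Submodule.finiteDimensional_of_le (S₂ := LinearMap.range Φ) fun x hx => ?_
  have hxl := left_mul_of_mem_cornerSubmodule hq hx
  have hxr := right_mul_of_mem_cornerSubmodule hq hx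
  refine ⟨x.toLinearMap.restrict fun v _ => ⟨x v, DFunLike.congr_fun hxl v⟩, ?_⟩
  ext v
  exact DFunLike.congr_fun hxr v

namespace HilbertBasis

theorem clm_ext {ι H : Type*} [NormedAddCommGroup H] [InnerProductSpace ℂ H]
    (b : HilbertBasis ι ℂ H) {S T : H →L[ℂ] H} (h : ∀ i, S (b i) = T (b i)) : S = T :=
  ContinuousLinearMap.ext_on (Submodule.dense_iff_topologicalClosure_eq_top.2 b.dense_span)
    (by rintro _ ⟨i, rfl⟩; exact h i)

section
variable {ι H : Type*} [NormedAddCommGroup H] [InnerProductSpace ℂ H] [CompleteSpace H]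
  (b : HilbertBasis ι ℂ H)

/-- The orthogonal projection onto the closed span of a set of basis vectors. -/
noncomputable def diagonalProjection (s : Set ι) : H →L[ℂ] H :=
  (Submodule.span ℂ (b '' s)).topologicalClosure.starProjection

theorem isStarProjection_diagonalProjection (s : Set ι) :
    IsStarProjection (b.diagonalProjection s) := isStarProjection_starProjection

theorem diagonalProjection_basis (s : Set ι) (i : ι) [Decidable (i ∈ s)] :
    b.diagonalProjection s (b i) = if i ∈ s then b i else 0 := by
  split_ifs with h
  · exact Submodule.starProjection_eq_self_iff.2 <|
      Submodule.le_topologicalClosure _ <| Submodule.subset_span ⟨i, h, rfl⟩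
  · rw [diagonalProjection, Submodule.starProjection_apply_eq_zero_iff,
      Submodule.orthogonal_closure]
    have : Submodule.span ℂ (b '' s) ⟂ Submodule.span ℂ {b i} := by
      rw [Submodule.isOrtho_span]
      rintro _ ⟨j, hj, rfl⟩ _ rfl
      exact b.orthonormal.2 fun e => h (e ▸ hj)
    exact this.symm (Submodule.mem_span_singleton_self _)

theorem diagonalProjection_mul (s t : Set ι) :
    b.diagonalProjection s * b.diagonalProjection t = b.diagonalProjection (s ∩ t) := by
  classical
  refine b.clm_ext fun i => ?_
  by_cases hs : i ∈ s <;> by_cases ht : i ∈ t <;> simp [diagonalProjection_basis, hs, ht]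

theorem range_diagonalProjection {s : Set ι} (hs : s.Finite) :
    (b.diagonalProjection s).range = Submodule.span ℂ (b '' s) := by
  have : FiniteDimensional ℂ (Submodule.span ℂ (b '' s)) :=
    FiniteDimensional.span_of_finite ℂ (hs.image b)
  rw [diagonalProjection, Submodule.range_starProjection]
  exact (Submodule.closed_of_finiteDimensional _).submodule_topologicalClosure_eq

theorem finiteDimensional_range_diagonalProjection {s : Set ι} (hs : s.Finite) :
    FiniteDimensional ℂ (b.diagonalProjection s).range := by
  rw [b.range_diagonalProjection hs]
  exact FiniteDimensional.span_of_finite ℂ (hs.image b)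

theorem finrank_range_diagonalProjection (s : Finset ι) :
    Module.finrank ℂ (b.diagonalProjection s).range = s.card := by
  rw [b.range_diagonalProjection s.finite_toSet, ← Set.finrank, Set.image_eq_range]
  have := finrank_span_eq_card (b.orthonormal.linearIndependent.comp
    (Subtype.val : s → ι) Subtype.val_injective)
  rw [Fintype.card_coe] at this
  exact this

end

section shift
variable {H : Type*} [NormedAddCommGroup H] [InnerProductSpace ℂ H] [CompleteSpace H]
  (b : HilbertBasis ℤ ℂ H)

/-- The Hilbert basis translated by one. -/
noncomputable def succBasis : HilbertBasis ℤ ℂ H :=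
  HilbertBasis.mk (b.orthonormal.comp (fun k => k + 1) (add_left_injective 1)) <| by
    have : Set.range (b ∘ fun k : ℤ => k + 1) = Set.range b :=
      (Equiv.addRight (1 : ℤ)).surjective.range_comp b
    rw [this, b.dense_span]

theorem succBasis_apply (k : ℤ) : b.succBasis k = b (k + 1) := by simp [succBasis]

/-- The bilateral shift. -/
noncomputable def bilateralShift : unitary (H →L[ℂ] H) :=
  Unitary.linearIsometryEquiv.symm (b.repr.trans b.succBasis.repr.symm)

theorem bilateralShift_basis (k : ℤ) : (b.bilateralShift : H →L[ℂ] H) (b k) = b (k + 1) := by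
  classical
  rw [← succBasis_apply]
  simp [bilateralShift, b.repr_self, b.succBasis.repr_symm_single]

theorem star_bilateralShift_basis (k : ℤ) :
    star (b.bilateralShift : H →L[ℂ] H) (b k) = b (k - 1) := by
  have h := DFunLike.congr_fun (Unitary.star_mul_self_of_mem b.bilateralShift.2) (b (k - 1))
  rwa [mul_apply_eq_comp, bilateralShift_basis, sub_add_cancel] at h

open Classical in
/-- The bilateral shift, with the diagonal projections of a Hilbert basis indexed by `ℤ`. -/
noncomputable def shiftSystem : ShiftSystem (H →L[ℂ] H) where
  U := b.bilateralShift
  P := b.diagonalProjection (Set.Ici 0)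
  Q n := b.diagonalProjection (Set.Ico (-n) n)
  U_mem := b.bilateralShift.2
  isStarProjection_P := b.isStarProjection_diagonalProjection _
  isStarProjection_Q _ := b.isStarProjection_diagonalProjection _
  Q_mul_Q h := by
    rw [diagonalProjection_mul, Set.inter_eq_right.2 (Set.Ico_subset_Ico (by lia) (by lia))]
  commute_P_Q n := by
    rw [Commute, SemiconjBy, diagonalProjection_mul, diagonalProjection_mul, Set.inter_comm]
  Q_mul_U_mul_Q n := by
    refine b.clm_ext fun k => ?_
    by_cases h : k ∈ Set.Ico (-n : ℤ) n
    · have h' : k + 1 ∈ Set.Ico (-(n + 1 : ℕ) : ℤ) (n + 1 : ℕ) := by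
        rw [Set.mem_Ico] at *; lia
      simp only [mul_apply_eq_comp, diagonalProjection_basis, if_pos h,
        bilateralShift_basis, if_pos h']
    · simp only [mul_apply_eq_comp, diagonalProjection_basis, if_neg h, map_zero]
  Q_mul_star_U_mul_Q n := by
    refine b.clm_ext fun k => ?_
    by_cases h : k ∈ Set.Ico (-n : ℤ) n
    · have h' : k - 1 ∈ Set.Ico (-(n + 1 : ℕ) : ℤ) (n + 1 : ℕ) := by
        rw [Set.mem_Ico] at *; lia
      simp only [mul_apply_eq_comp, diagonalProjection_basis, if_pos h,
        star_bilateralShift_basis, if_pos h']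
    · simp only [mul_apply_eq_comp, diagonalProjection_basis, if_neg h, map_zero]
  commutator_mem := by
    rw [mem_cornerSubmodule]
    refine b.clm_ext fun k => ?_
    rcases lt_trichotomy k (-1) with h | rfl | h
    · have h₁ : ¬ 0 ≤ k := by lia
      have h₂ : ¬ 0 ≤ k + 1 := by lia
      have h₃ : ¬ (-1 ≤ k ∧ k < 1) := by lia
      simp [diagonalProjection_basis, bilateralShift_basis, h₁, h₂, h₃]
    · simp [diagonalProjection_basis, bilateralShift_basis]
    · have h₁ : 0 ≤ k := by lia
      have h₂ : 0 ≤ k + 1 := by lia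
      by_cases h₃ : -1 ≤ k ∧ k < 1 <;>
      simp [diagonalProjection_basis, bilateralShift_basis, h₁, h₂, h₃]
  finiteDimensional n :=
    have := b.finiteDimensional_range_diagonalProjection (Set.finite_Ico (-n : ℤ) n)
    finiteDimensional_cornerSubmodule_of_range _
      (b.isStarProjection_diagonalProjection _).isIdempotentElem
  not_isUnit n x hx hu := by
    have hxQ := right_mul_of_mem_cornerSubmodule
      (b.isStarProjection_diagonalProjection _).isIdempotentElem hx
    obtain ⟨y, hy⟩ := hu
    have hyb (k : ℤ) (hk : ¬ (0 ≤ k ∧ k < n)) :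
        b.diagonalProjection (Finset.Ico 0 (n + 1 : ℤ)) ((y : H →L[ℂ] H) (b k)) = 0 := by
      rw [hy]
      by_cases h : 0 ≤ k
      · have hxk : x (b k) = 0 := by
          rw [← hxQ, mul_apply_eq_comp, diagonalProjection_basis, if_neg, map_zero]
          rw [Set.mem_Ico]; lia
        have h₂ : 0 ≤ k + 1 := by lia
        have h₃ : ¬ k < n := by lia
        simp [diagonalProjection_basis, bilateralShift_basis, h, hxk, h₂, h₃]
      · simp [diagonalProjection_basis, h]
    have hfac : b.diagonalProjection (Finset.Ico 0 (n + 1 : ℤ)) * y =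
        b.diagonalProjection (Finset.Ico 0 (n + 1 : ℤ)) * y *
          b.diagonalProjection (Finset.Ico 0 (n : ℤ)) := by
      refine b.clm_ext fun k => ?_
      by_cases hk : 0 ≤ k ∧ k < n
      · simp [diagonalProjection_basis, hk]
      · simpa [diagonalProjection_basis, hk] using hyb k hk
    have hle : (b.diagonalProjection (Finset.Ico 0 (n + 1 : ℤ))).range ≤
        (b.diagonalProjection (Finset.Ico 0 (n : ℤ))).range.map
          (b.diagonalProjection (Finset.Ico 0 (n + 1 : ℤ)) * (y : H →L[ℂ] H)).toLinearMap := by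
      rintro _ ⟨h, rfl⟩
      refine ⟨_, ⟨(↑y⁻¹ : H →L[ℂ] H) h, rfl⟩, ?_⟩
      have e : b.diagonalProjection (Finset.Ico 0 (n + 1 : ℤ)) * (y : H →L[ℂ] H) *
          b.diagonalProjection (Finset.Ico 0 (n : ℤ)) * ↑y⁻¹ =
          b.diagonalProjection (Finset.Ico 0 (n + 1 : ℤ)) := by
        rw [← hfac, mul_assoc, y.mul_inv, mul_one]
      exact DFunLike.congr_fun e h
    have := b.finiteDimensional_range_diagonalProjection (Finset.Ico 0 (n : ℤ)).finite_toSet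
    have h₁ := (Submodule.finrank_mono hle).trans (Submodule.finrank_map_le _ _)
    rw [finrank_range_diagonalProjection, finrank_range_diagonalProjection] at h₁
    simp only [Int.card_Ico] at h₁
    lia

end shift
end HilbertBasis

/-- There exist a C*-algebra `I` of stable rank one, a unital C*-algebra
`A` containing `I` as a closed two-sided ideal with `A/I` *-isomorphic to `C(𝕋)`, and a
unitary `u` in `A/I` that does not lift to any partial isometry in `A` (in particular not
to any unitary in `A`). -/
theorem stmt16 : Nonempty Stmt16Witness := by
  have b : HilbertBasis ℤ ℂ (lp (fun _ : ℤ => ℂ) 2) := ⟨LinearIsometryEquiv.refl ℂ _⟩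
  exact ⟨b.shiftSystem.witness⟩
end
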